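/- arXiv:1005.2993 — 2 statements merged into one kernel-verified Lean document; each statement's English description precedes it below -/
import Mathlib

section
/- Let K = Q(√-1) or Q(√-3) and p a prime. For p-integral Hermitian modular forms f, g of degree 2 over K (with characters ν as above) satisfying f ≢ 0 (mod p) and g ≢ 0 (mod p), one has ord_p(fg) = ord_p(f) + ord_p(g), where ord_p is the minimal index, in the lexicographic order on Λ_2(K), of a Fourier coefficient not divisible by p. -/
open Complex Matrix
open scoped ComplexOrder

noncomputable section

/-- `√d_K` for an imaginary quadratic discriminant `d < 0`,
taken as `√|d| · i` in the upper half plane. -/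
def sqrtD (d : ℤ) : ℂ := Real.sqrt (-d) * Complex.I

/-- The ring of integers `O_K = ℤ[(d + √d)/2]` of the imaginary quadratic field of
discriminant `d`, viewed as a subset of `ℂ`. -/
def ringInt (d : ℤ) : Set ℂ :=
  {z | ∃ a b : ℤ, z = (a : ℂ) + (b : ℂ) * (((d : ℂ) + sqrtD d) / 2)}

/-- The inverse different `D_K⁻¹ = O_K / √d_K`. -/
def invDiff (d : ℤ) : Set ℂ := {z | sqrtD d * z ∈ ringInt d}

/-- The Hermitian upper half-space of degree 2:
`Z` with `(Z - ᵗZ̄)/(2i)` positive definite. -/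
def HermitianUpperHalfSpace : Set (Matrix (Fin 2) (Fin 2) ℂ) :=
  {Z | ((Z - Zᴴ).map (fun w => w / (2 * Complex.I))).PosDef}

/-- The lattice `Λ₂(K)`: Hermitian matrices with integral diagonal and
`√d_K ·`(off-diagonal entries) in `O_K`. -/
def LambdaH (d : ℤ) : Set (Matrix (Fin 2) (Fin 2) ℂ) :=
  {H | H.IsHermitian ∧ (∀ i, ∃ n : ℤ, H i i = (n : ℂ)) ∧
    ∀ i j, sqrtD d * H i j ∈ ringInt d}

/-- Semi-positive elements of `Λ₂(K)`, the index set of Fourier expansions. -/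
def HermLattice (d : ℤ) : Set (Matrix (Fin 2) (Fin 2) ℂ) :=
  {H | H ∈ LambdaH d ∧ H.PosSemidef}

/-- The symplectic-form matrix `J₂ = [[0, -1], [1, 0]]` (2×2 blocks). -/
def J2 : Matrix (Fin 2 ⊕ Fin 2) (Fin 2 ⊕ Fin 2) ℂ :=
  Matrix.fromBlocks 0 (-1) 1 0

/-- The Hermitian modular group `U₂(O_K)`:
matrices with entries in `O_K` satisfying `ᵗM̄ J₂ M = J₂`. -/
def HermitianModularGroup (d : ℤ) : Set (Matrix (Fin 2 ⊕ Fin 2) (Fin 2 ⊕ Fin 2) ℂ) :=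
  {M | (∀ i j, M i j ∈ ringInt d) ∧ Mᴴ * J2 * M = J2}

/-- The fractional-linear action `Z ↦ (AZ + B)(CZ + D)⁻¹`. -/
def matAct (M : Matrix (Fin 2 ⊕ Fin 2) (Fin 2 ⊕ Fin 2) ℂ)
    (Z : Matrix (Fin 2) (Fin 2) ℂ) : Matrix (Fin 2) (Fin 2) ℂ :=
  (M.toBlocks₁₁ * Z + M.toBlocks₁₂) * (M.toBlocks₂₁ * Z + M.toBlocks₂₂)⁻¹

/-- The character `ν_k`: `det^{k/2}` for `K = ℚ(√-1)` (i.e. `d = -4`, `k` even),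
and `det^k` for `K = ℚ(√-3)` (i.e. `d = -3`). -/
def nuChar (d k : ℤ) (M : Matrix (Fin 2 ⊕ Fin 2) (Fin 2 ⊕ Fin 2) ℂ) : ℂ :=
  if d = -4 then M.det ^ (k / 2) else M.det ^ k

/-- A Hermitian modular form of degree 2, weight `k` and character `ν_k` for `U₂(O_K)`,
bundled with its Fourier expansion over the semi-positive part of `Λ₂(K)`. -/
structure HermitianModularForm (d k : ℤ) where
  toFun : Matrix (Fin 2) (Fin 2) ℂ → ℂ
  coeff : Matrix (Fin 2) (Fin 2) ℂ → ℂ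
  holo : DifferentiableOn ℂ (fun Z : Fin 2 → Fin 2 → ℂ => toFun (Matrix.of Z))
    {Z | Matrix.of Z ∈ HermitianUpperHalfSpace}
  transform : ∀ M ∈ HermitianModularGroup d, ∀ Z ∈ HermitianUpperHalfSpace,
    toFun (matAct M Z) =
      nuChar d k M * (M.toBlocks₂₁ * Z + M.toBlocks₂₂).det ^ k * toFun Z
  coeff_supported : ∀ H, coeff H ≠ 0 → H ∈ HermLattice d
  expansion : ∀ Z ∈ HermitianUpperHalfSpace,
    HasSum (fun H : HermLattice d =>
      coeff H * Complex.exp (2 * Real.pi * Complex.I * ((H : Matrix (Fin 2) (Fin 2) ℂ) * Z).trace))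
      (toFun Z)

/-- A Hermitian modular form is symmetric if `f(ᵗZ) = f(Z)`. -/
def IsSymmetricHMF {d k : ℤ} (f : HermitianModularForm d k) : Prop :=
  ∀ Z ∈ HermitianUpperHalfSpace, f.toFun Zᵀ = f.toFun Z

/-- `z` is a `p`-integral rational number: `z = a/b` with `p ∤ b`. -/
def IsPIntegral (p : ℕ) (z : ℂ) : Prop :=
  ∃ a b : ℤ, ¬ (p : ℤ) ∣ b ∧ (b : ℂ) * z = (a : ℂ)

/-- `z ≡ w (mod p^l)` in the local ring `ℤ_(p)`, i.e. `(z - w)/p^l` is `p`-integral. -/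
def ModCongr (p l : ℕ) (z w : ℂ) : Prop :=
  IsPIntegral p ((z - w) / (p : ℂ) ^ l)


/-- The lexicographic order on `Λ₂(K)` used to define `ord_p`:
compare first `tr H`, then the `(1,1)`-entry `m`, then (for off-diagonal entry
`(a + b i)/2`) first `a`, then `b`. -/
def lexLt (H H' : Matrix (Fin 2) (Fin 2) ℂ) : Prop :=
  H.trace.re < H'.trace.re ∨
    (H.trace = H'.trace ∧
      ((H 0 0).re < (H' 0 0).re ∨
        (H 0 0 = H' 0 0 ∧
          ((H 0 1).re < (H' 0 1).re ∨
            ((H 0 1).re = (H' 0 1).re ∧ (H 0 1).im < (H' 0 1).im)))))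

/-- The Siegel upper half-space of degree `n`: symmetric complex matrices with
positive definite imaginary part. -/
def SiegelUpperHalfSpace (n : ℕ) : Set (Matrix (Fin n) (Fin n) ℂ) :=
  {Z | Z.IsSymm ∧ ((Z - Zᴴ).map (fun w => w / (2 * Complex.I))).PosDef}

/-- The symplectic-form matrix over `ℤ` in degree `n`. -/
def Jn (n : ℕ) : Matrix (Fin n ⊕ Fin n) (Fin n ⊕ Fin n) ℤ :=
  Matrix.fromBlocks 0 (-1) 1 0

/-- The Siegel modular group `Γ_n = Sp_n(ℤ)` (as a set of `2n × 2n` integer matrices). -/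
def SiegelModularGroup (n : ℕ) : Set (Matrix (Fin n ⊕ Fin n) (Fin n ⊕ Fin n) ℤ) :=
  {M | Mᵀ * Jn n * M = Jn n}

/-- The fractional-linear action of an integral symplectic matrix on the Siegel
upper half-space. -/
def matActS {n : ℕ} (M : Matrix (Fin n ⊕ Fin n) (Fin n ⊕ Fin n) ℤ)
    (Z : Matrix (Fin n) (Fin n) ℂ) : Matrix (Fin n) (Fin n) ℂ :=
  ((M.map (fun a => (a : ℂ))).toBlocks₁₁ * Z + (M.map (fun a => (a : ℂ))).toBlocks₁₂) *
    ((M.map (fun a => (a : ℂ))).toBlocks₂₁ * Z + (M.map (fun a => (a : ℂ))).toBlocks₂₂)⁻¹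

/-- The index lattice of Fourier expansions of Siegel modular forms of level `N`:
semi-positive symmetric rational matrices `T` with `N·T` half-integral,
i.e. `T ∈ (1/N)Λ_n`. -/
def SiegelLattice (n : ℕ) (N : ℕ) : Set (Matrix (Fin n) (Fin n) ℚ) :=
  {T | T.IsSymm ∧ (∀ i, ∃ a : ℤ, (N : ℚ) * T i i = (a : ℚ)) ∧
    (∀ i j, ∃ a : ℤ, 2 * (N : ℚ) * T i j = (a : ℚ)) ∧
    (T.map (fun q => (q : ℝ))).PosSemidef}

/-- A Siegel modular form of degree `n` and weight `k` for a subgroup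
`Γ ⊆ Γ_n = Sp_n(ℤ)` of level `N`, bundled with its Fourier expansion. For the
full modular group take `Γ = SiegelModularGroup n` and `N = 1`. -/
structure SiegelModularForm (n : ℕ) (k : ℤ)
    (Γ : Set (Matrix (Fin n ⊕ Fin n) (Fin n ⊕ Fin n) ℤ)) (N : ℕ) where
  toFun : Matrix (Fin n) (Fin n) ℂ → ℂ
  coeff : Matrix (Fin n) (Fin n) ℚ → ℂ
  holo : DifferentiableOn ℂ (fun Z : Fin n → Fin n → ℂ => toFun (Matrix.of Z))
    {Z | Matrix.of Z ∈ SiegelUpperHalfSpace n}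
  transform : ∀ M ∈ Γ, ∀ Z ∈ SiegelUpperHalfSpace n,
    toFun (matActS M Z) =
      ((M.map (fun a => (a : ℂ))).toBlocks₂₁ * Z +
        (M.map (fun a => (a : ℂ))).toBlocks₂₂).det ^ k * toFun Z
  coeff_supported : ∀ T, coeff T ≠ 0 → T ∈ SiegelLattice n N
  expansion : ∀ Z ∈ SiegelUpperHalfSpace n,
    HasSum (fun T : SiegelLattice n N =>
      coeff T * Complex.exp (2 * Real.pi * Complex.I *
        (((T : Matrix (Fin n) (Fin n) ℚ).map (fun q => (q : ℂ))) * Z).trace))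
      (toFun Z)


/-- A Hermitian cusp form (degree 2, class number one field): the Fourier
coefficients vanish off the positive definite part of the lattice. -/
def IsCuspHMF {d k : ℤ} (f : HermitianModularForm d k) : Prop :=
  ∀ H, ¬ H.PosDef → f.coeff H = 0

/-- `H0 = ord_p f`: `H0` is the minimal element of `Λ₂(K)`, in the lexicographic
order `lexLt`, whose Fourier coefficient is not divisible by `p`. -/
def IsOrdP (p : ℕ) {d k : ℤ} (f : HermitianModularForm d k)
    (H0 : Matrix (Fin 2) (Fin 2) ℂ) : Prop :=
  H0 ∈ HermLattice d ∧ ¬ ModCongr p 1 (f.coeff H0) 0 ∧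
    ∀ H ∈ HermLattice d, lexLt H H0 → ModCongr p 1 (f.coeff H) 0

/-! ### Arithmetic of `p`-integral numbers -/

lemma IsPIntegral.add {p : ℕ} (hp : p.Prime) {z w : ℂ} (hz : IsPIntegral p z)
    (hw : IsPIntegral p w) : IsPIntegral p (z + w) := by
  obtain ⟨a, b, hb, h⟩ := hz
  obtain ⟨a', b', hb', h'⟩ := hw
  refine ⟨a * b' + a' * b, b * b', fun hdvd => ?_, ?_⟩
  · exact ((Nat.prime_iff_prime_int.mp hp).dvd_or_dvd hdvd).elim hb hb'
  · push_cast
    rw [← h, ← h']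
    ring

lemma IsPIntegral.neg {p : ℕ} {z : ℂ} (hz : IsPIntegral p z) : IsPIntegral p (-z) := by
  obtain ⟨a, b, hb, h⟩ := hz
  exact ⟨-a, b, hb, by push_cast; rw [← h]; ring⟩

lemma IsPIntegral.mul {p : ℕ} (hp : p.Prime) {z w : ℂ} (hz : IsPIntegral p z)
    (hw : IsPIntegral p w) : IsPIntegral p (z * w) := by
  obtain ⟨a, b, hb, h⟩ := hz
  obtain ⟨a', b', hb', h'⟩ := hw
  refine ⟨a * a', b * b', fun hdvd => ?_, ?_⟩
  · exact ((Nat.prime_iff_prime_int.mp hp).dvd_or_dvd hdvd).elim hb hb'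
  · push_cast
    rw [← h, ← h']
    ring

lemma isPIntegral_zero {p : ℕ} (hp : p.Prime) : IsPIntegral p 0 :=
  ⟨0, 1, (Nat.prime_iff_prime_int.mp hp).not_dvd_one, by simp⟩

lemma modCongr_one_zero_iff {p : ℕ} {z : ℂ} :
    ModCongr p 1 z 0 ↔ IsPIntegral p (z / p) := by
  simp [ModCongr]

lemma ModCongr.sum {ι : Type*} {p : ℕ} (hp : p.Prime) {s : Finset ι} {F : ι → ℂ}
    (h : ∀ i ∈ s, ModCongr p 1 (F i) 0) : ModCongr p 1 (∑ i ∈ s, F i) 0 := by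
  rw [modCongr_one_zero_iff, Finset.sum_div]
  exact Finset.sum_induction _ (IsPIntegral p) (fun _ _ => IsPIntegral.add hp)
    (isPIntegral_zero hp) fun i hi => modCongr_one_zero_iff.mp (h i hi)

lemma ModCongr.mul_right {p : ℕ} (hp : p.Prime) {z w : ℂ} (hz : ModCongr p 1 z 0)
    (hw : IsPIntegral p w) : ModCongr p 1 (z * w) 0 := by
  rw [modCongr_one_zero_iff] at *
  rw [mul_div_right_comm]
  exact hz.mul hp hw

lemma ModCongr.mul_left {p : ℕ} (hp : p.Prime) {z w : ℂ} (hz : IsPIntegral p z)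
    (hw : ModCongr p 1 w 0) : ModCongr p 1 (z * w) 0 := by
  rw [mul_comm]
  exact hw.mul_right hp hz

lemma IsPIntegral.modCongr_or_modCongr_of_mul {p : ℕ} (hp : p.Prime) {z w : ℂ}
    (hz : IsPIntegral p z) (hw : IsPIntegral p w) (h : ModCongr p 1 (z * w) 0) :
    ModCongr p 1 z 0 ∨ ModCongr p 1 w 0 := by
  simp only [modCongr_one_zero_iff] at *
  have hp0 : (p : ℂ) ≠ 0 := Nat.cast_ne_zero.mpr hp.ne_zero
  have hprime := Nat.prime_iff_prime_int.mp hp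
  obtain ⟨a, b, hb, hab⟩ := hz
  obtain ⟨a', b', hb', hab'⟩ := hw
  obtain ⟨r, s, hs, hrs⟩ := h
  have key : s * (a * a') = p * (r * b * b') := by
    have : (s : ℂ) * (a * a') = p * (r * b * b') := by
      rw [← hab, ← hab', ← hrs]
      field_simp
    exact_mod_cast this
  rcases hprime.dvd_or_dvd (Dvd.intro _ key.symm) with h | h
  · exact absurd h hs
  rcases hprime.dvd_or_dvd h with ⟨c, rfl⟩ | ⟨c, rfl⟩
  · refine Or.inl ⟨c, b, hb, ?_⟩
    rw [← mul_div_assoc, hab]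
    push_cast
    field_simp
  · refine Or.inr ⟨c, b', hb', ?_⟩
    rw [← mul_div_assoc, hab']
    push_cast
    field_simp

/-! ### The lexicographic order -/

/-- The entries of a Hermitian matrix compared by `lexLt`, as an element of a lexicographic
product. -/
def lexKey (H : Matrix (Fin 2) (Fin 2) ℂ) : ℝ ×ₗ ℝ ×ₗ ℝ ×ₗ ℝ :=
  toLex (H.trace.re, toLex ((H 0 0).re, toLex ((H 0 1).re, (H 0 1).im)))

lemma lexKey_add (H H' : Matrix (Fin 2) (Fin 2) ℂ) :
    lexKey (H + H') = lexKey H + lexKey H' := by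
  simp only [lexKey, Matrix.trace_add, Matrix.add_apply, Complex.add_re, Complex.add_im]
  rfl

lemma Matrix.IsHermitian.apply_self_im {H : Matrix (Fin 2) (Fin 2) ℂ} (hH : H.IsHermitian)
    (i : Fin 2) : (H i i).im = 0 :=
  Complex.conj_eq_iff_im.mp (hH.apply i i)

lemma lexLt_iff_lexKey_lt {H H' : Matrix (Fin 2) (Fin 2) ℂ} (hH : H.IsHermitian)
    (hH' : H'.IsHermitian) : lexLt H H' ↔ lexKey H < lexKey H' := by
  simp [lexLt, lexKey, Prod.Lex.lt_iff, Complex.ext_iff, Matrix.trace_fin_two,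
    hH.apply_self_im, hH'.apply_self_im]

lemma eq_of_lexKey_eq {H H' : Matrix (Fin 2) (Fin 2) ℂ} (hH : H.IsHermitian)
    (hH' : H'.IsHermitian) (h : lexKey H = lexKey H') : H = H' := by
  simp only [lexKey, EmbeddingLike.apply_eq_iff_eq, Prod.mk.injEq, Matrix.trace_fin_two,
    Complex.add_re] at h
  obtain ⟨htr, h00, hre, him⟩ := h
  have h01 : H 0 1 = H' 0 1 := Complex.ext hre him
  ext i j
  fin_cases i <;> fin_cases j
  · exact Complex.ext h00 (by simp [hH.apply_self_im, hH'.apply_self_im])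
  · exact h01
  · change H 1 0 = H' 1 0
    rw [← hH.apply 1 0, ← hH'.apply 1 0, h01]
  · exact Complex.ext (by simpa [h00] using htr) (by simp [hH.apply_self_im, hH'.apply_self_im])

/-! ### The index lattice -/

lemma ringInt_add {d : ℤ} {z w : ℂ} (hz : z ∈ ringInt d) (hw : w ∈ ringInt d) :
    z + w ∈ ringInt d := by
  obtain ⟨a, b, rfl⟩ := hz
  obtain ⟨a', b', rfl⟩ := hw
  exact ⟨a + a', b + b', by push_cast; ring⟩

lemma HermLattice_add {d : ℤ} {H H' : Matrix (Fin 2) (Fin 2) ℂ} (hH : H ∈ HermLattice d)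
    (hH' : H' ∈ HermLattice d) : H + H' ∈ HermLattice d := by
  obtain ⟨⟨h, hdiag, hoff⟩, hpos⟩ := hH
  obtain ⟨⟨h', hdiag', hoff'⟩, hpos'⟩ := hH'
  refine ⟨⟨h.add h', fun i => ?_, fun i j => ?_⟩, hpos.add hpos'⟩
  · obtain ⟨n, hn⟩ := hdiag i
    obtain ⟨n', hn'⟩ := hdiag' i
    exact ⟨n + n', by simp [hn, hn']⟩
  · rw [Matrix.add_apply, mul_add]
    exact ringInt_add (hoff i j) (hoff' i j)

lemma exists_diag_eq_natCast {d : ℤ} {H : Matrix (Fin 2) (Fin 2) ℂ} (hH : H ∈ HermLattice d)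
    (i : Fin 2) : ∃ n : ℕ, H i i = n := by
  obtain ⟨n, hn⟩ := hH.1.2.1 i
  have h : (0 : ℂ) ≤ n := hn ▸ hH.2.diag_nonneg
  lift n to ℕ using by exact_mod_cast h
  exact ⟨n, by simpa using hn⟩

lemma exists_trace_eq_natCast {d : ℤ} {H : Matrix (Fin 2) (Fin 2) ℂ} (hH : H ∈ HermLattice d) :
    ∃ n : ℕ, H.trace = n := by
  obtain ⟨m, hm⟩ := exists_diag_eq_natCast hH 0
  obtain ⟨n, hn⟩ := exists_diag_eq_natCast hH 1
  exact ⟨m + n, by simp [Matrix.trace_fin_two, hm, hn]⟩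

lemma normSq_le_of_posSemidef {H : Matrix (Fin 2) (Fin 2) ℂ} (hH : H.PosSemidef) :
    Complex.normSq (H 0 1) ≤ (H 0 0).re * (H 1 1).re := by
  have h := (Complex.le_def.mp hH.det_nonneg).1
  rw [Matrix.det_fin_two, ← hH.1.apply 1 0] at h
  simp only [Complex.sub_re, Complex.mul_re, RCLike.star_def, Complex.conj_re, Complex.conj_im,
    hH.1.apply_self_im, Complex.zero_re] at h
  rw [Complex.normSq_apply]
  linarith

lemma finite_setOf_trace_le {d : ℤ} (hd : d = -4 ∨ d = -3) (N : ℕ) :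
    {H | H ∈ HermLattice d ∧ H.trace.re ≤ N}.Finite := by
  have hbox : (Set.Icc (0 : ℕ) N ×ˢ Set.Icc (0 : ℕ) N ×ˢ Set.Icc (-(6 * N : ℤ)) (6 * N) ×ˢ
      Set.Icc (-(2 * N : ℤ)) (2 * N)).Finite :=
    (Set.finite_Icc _ _).prod <| (Set.finite_Icc _ _).prod <|
      (Set.finite_Icc _ _).prod <| Set.finite_Icc _ _
  let z : ℤ → ℤ → ℂ := fun a b => (a + b * ((d + sqrtD d) / 2)) / sqrtD d
  refine (hbox.image fun x : ℕ × ℕ × ℤ × ℤ =>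
    !![(x.1 : ℂ), z x.2.2.1 x.2.2.2; star (z x.2.2.1 x.2.2.2), x.2.1]).subset ?_
  rintro H ⟨hH, htr⟩
  obtain ⟨m, hm⟩ := exists_diag_eq_natCast hH 0
  obtain ⟨n, hn⟩ := exists_diag_eq_natCast hH 1
  obtain ⟨a, b, hab⟩ := hH.1.2.2 0 1
  have hmn : (m : ℝ) + n ≤ N := by simpa [Matrix.trace_fin_two, hm, hn] using htr
  have hm0 : (0 : ℝ) ≤ m := m.cast_nonneg
  have hn0 : (0 : ℝ) ≤ n := n.cast_nonneg
  have hnorm := normSq_le_of_posSemidef hH.2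
  rw [hm, hn, Complex.natCast_re, Complex.natCast_re] at hnorm
  have hN : Complex.normSq (H 0 1) ≤ N ^ 2 := by nlinarith
  set s : ℝ := √(-d) with hs
  have hs2 : s ^ 2 = -d := Real.sq_sqrt (by rcases hd with rfl | rfl <;> norm_num)
  have hspos : 0 < s := Real.sqrt_pos.mpr (by rcases hd with rfl | rfl <;> norm_num)
  have hsD : sqrtD d = s * Complex.I := rfl
  have hsD0 : sqrtD d ≠ 0 := by
    rw [hsD]
    exact mul_ne_zero (by exact_mod_cast hspos.ne') Complex.I_ne_zero
  have hre := congrArg Complex.re hab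
  have him := congrArg Complex.im hab
  simp [hsD] at hre him
  rw [Complex.normSq_apply] at hN
  have hbN : (b : ℝ) ^ 2 ≤ (2 * N) ^ 2 := by
    have : s * ((H 0 1).re - b / 2) = 0 := by linarith
    have h2 : (b : ℝ) = 2 * (H 0 1).re := by
      rcases mul_eq_zero.mp this with h | h
      · exact absurd h hspos.ne'
      · linarith
    rw [h2]
    nlinarith [mul_self_nonneg (H 0 1).im]
  have hb := abs_le.mp (abs_le_of_sq_le_sq hbN (by positivity))
  have haN : ((a : ℝ) + b * (d / 2)) ^ 2 ≤ (2 * N) ^ 2 := by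
    have hd4 : -(d : ℝ) ≤ 4 := by rcases hd with rfl | rfl <;> norm_num
    have : ((a : ℝ) + b * (d / 2)) ^ 2 = -d * (H 0 1).im ^ 2 := by
      rw [← hs2, ← hre]
      ring
    rw [this]
    nlinarith [mul_self_nonneg (H 0 1).im, mul_self_nonneg (H 0 1).re]
  have ha := abs_le.mp (abs_le_of_sq_le_sq haN (by positivity))
  refine ⟨(m, n, a, b), ⟨⟨Nat.zero_le _, ?_⟩, ⟨Nat.zero_le _, ?_⟩, ⟨?_, ?_⟩, ⟨?_, ?_⟩⟩, ?_⟩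
  · exact_mod_cast (by linarith : (m : ℝ) ≤ N)
  · exact_mod_cast (by linarith : (n : ℝ) ≤ N)
  · exact_mod_cast (by rcases hd with rfl | rfl <;> push_cast at ha <;> linarith :
      -(6 * N : ℝ) ≤ a)
  · exact_mod_cast (by rcases hd with rfl | rfl <;> push_cast at ha <;> linarith :
      (a : ℝ) ≤ 6 * N)
  · exact_mod_cast hb.1
  · exact_mod_cast hb.2
  · have hz : z a b = H 0 1 := by
      simp only [z]
      rw [← hab, mul_div_cancel_left₀ _ hsD0]
    ext i j
    fin_cases i <;> fin_cases j
    · simp [hm]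
    · simp [hz]
    · simpa [hz] using hH.1.1.apply 1 0
    · simp [hn]

/-! ### Uniqueness of Fourier expansions -/

lemma add_I_smul_one_mem {X : Matrix (Fin 2) (Fin 2) ℂ} (hX : X.IsHermitian) {t : ℝ}
    (ht : 0 < t) : X + (t * Complex.I) • 1 ∈ HermitianUpperHalfSpace := by
  have h : ((X + (t * Complex.I) • 1) - (X + (t * Complex.I) • 1)ᴴ).map
      (fun w => w / (2 * Complex.I)) = (t : ℂ) • (1 : Matrix (Fin 2) (Fin 2) ℂ) := by
    rw [Matrix.conjTranspose_add, hX.eq]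
    ext i j
    by_cases hij : i = j
    · subst hij
      simp
      field_simp
      ring
    · simp [hij]
  rw [HermitianUpperHalfSpace, Set.mem_ofPred_eq, h]
  exact Matrix.PosDef.one.smul (by exact_mod_cast ht)

/-- The character `X ↦ exp(2πi tr(HX))` of the group of Hermitian matrices. -/
def traceChar (H : Matrix (Fin 2) (Fin 2) ℂ) :
    Multiplicative (selfAdjoint (Matrix (Fin 2) (Fin 2) ℂ)) →* ℂ where
  toFun X := Complex.exp (2 * Real.pi * Complex.I *
    (H * (X.toAdd : Matrix (Fin 2) (Fin 2) ℂ)).trace)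
  map_one' := by simp
  map_mul' X Y := by
    rw [← Complex.exp_add, toAdd_mul, AddSubgroup.coe_add, Matrix.mul_add, Matrix.trace_add,
      mul_add]

lemma traceChar_injOn :
    Set.InjOn traceChar {H | H.IsHermitian} := by
  intro H hH H' hH' h
  by_contra hne
  have hD : (H - H').IsHermitian := hH.sub hH'
  have hD0 : H - H' ≠ 0 := sub_ne_zero.mpr hne
  set r : ℂ := ((H - H') * (H - H')).trace with hr
  have hr0 : r ≠ 0 := by
    intro h0
    apply hD0
    rw [← Matrix.trace_conjTranspose_mul_self_eq_zero_iff, hD.eq]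
    exact h0
  have hrreal : star r = r := by
    rw [hr, ← Matrix.trace_conjTranspose, Matrix.conjTranspose_mul, hD.eq]
  let X : selfAdjoint (Matrix (Fin 2) (Fin 2) ℂ) :=
    ⟨(1 / (2 * r)) • (H - H'), by
      rw [selfAdjoint.mem_iff, Matrix.star_eq_conjTranspose, Matrix.conjTranspose_smul, hD.eq]
      congr 1
      simpa using hrreal⟩
  have hX := DFunLike.congr_fun h (Multiplicative.ofAdd X)
  change Complex.exp (2 * Real.pi * Complex.I * (H * ((1 / (2 * r)) • (H - H'))).trace) =
    Complex.exp (2 * Real.pi * Complex.I * (H' * ((1 / (2 * r)) • (H - H'))).trace) at hX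
  have htr : (H * ((1 / (2 * r)) • (H - H'))).trace =
      (H' * ((1 / (2 * r)) • (H - H'))).trace + 1 / 2 := by
    rw [← sub_eq_iff_eq_add', ← Matrix.trace_sub, ← Matrix.sub_mul, Matrix.mul_smul,
      Matrix.trace_smul, ← hr, smul_eq_mul]
    field_simp
  rw [htr, mul_add, Complex.exp_add, show 2 * (Real.pi : ℂ) * Complex.I * (1 / 2) =
    Real.pi * Complex.I by ring, Complex.exp_pi_mul_I] at hX
  have := Complex.exp_ne_zero
    (2 * Real.pi * Complex.I * (H' * ((1 / (2 * r)) • (H - H'))).trace)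
  apply this
  linear_combination (-1 / 2) * hX

lemma exp_trace_add_I_smul_one {H : Matrix (Fin 2) (Fin 2) ℂ} {n : ℕ} (hn : H.trace = n)
    (Z : Matrix (Fin 2) (Fin 2) ℂ) (t : ℝ) :
    Complex.exp (2 * Real.pi * Complex.I * (H * (Z + (t * Complex.I) • 1)).trace) =
      Complex.exp (2 * Real.pi * Complex.I * (H * Z).trace) *
        Real.exp (-(2 * Real.pi * n * t)) := by
  rw [Matrix.mul_add, Matrix.trace_add, Matrix.mul_smul, Matrix.mul_one, Matrix.trace_smul, hn,
    mul_add, Complex.exp_add, Complex.ofReal_exp]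
  congr 2
  push_cast
  rw [smul_eq_mul]
  linear_combination (2 * Real.pi * t * n : ℂ) * Complex.I_mul_I

lemma coeff_eq_zero_of_hasSum_zero {d : ℤ} (hd : d = -4 ∨ d = -3) {c : HermLattice d → ℂ}
    (hc : ∀ Z ∈ HermitianUpperHalfSpace, HasSum (fun H : HermLattice d =>
      c H * Complex.exp (2 * Real.pi * Complex.I *
        ((H : Matrix (Fin 2) (Fin 2) ℂ) * Z).trace)) 0)
    (H : HermLattice d) : c H = 0 := by
  choose tr htr using fun H : HermLattice d => exists_trace_eq_natCast H.2
  suffices h : ∀ n : ℕ, ∀ H, tr H = n → c H = 0 from h _ H rfl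
  intro n
  induction n using Nat.strong_induction_on with
  | _ n ih =>
  have hfin : {H : HermLattice d | tr H = n}.Finite := by
    refine Set.Finite.of_finite_image ((finite_setOf_trace_le hd n).subset ?_)
      Subtype.val_injective.injOn
    rintro _ ⟨H, hH, rfl⟩
    refine ⟨H.2, ?_⟩
    rw [htr H, hH, Complex.natCast_re]
  have hsum : ∀ X : selfAdjoint (Matrix (Fin 2) (Fin 2) ℂ),
      ∑ H ∈ hfin.toFinset, c H * Real.exp (-(2 * Real.pi * n * 1)) *
        traceChar H (Multiplicative.ofAdd X) = 0 := by
    intro X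
    have hX : (X : Matrix (Fin 2) (Fin 2) ℂ).IsHermitian := X.2
    let F : ℝ → HermLattice d → ℂ := fun t H => c H * Complex.exp (2 * Real.pi * Complex.I *
      ((H : Matrix (Fin 2) (Fin 2) ℂ) * (X + ((1 + t : ℝ) * Complex.I) • 1)).trace) *
        Real.exp (2 * Real.pi * n * t)
    let G : HermLattice d → ℂ := fun H =>
      c H * Complex.exp (2 * Real.pi * Complex.I *
        ((H : Matrix (Fin 2) (Fin 2) ℂ) * (X + ((1 : ℝ) * Complex.I) • 1)).trace)
    have hFG : ∀ t H, F t H = G H * Real.exp (-(2 * Real.pi * (tr H - n) * t)) := by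
      intro t H
      simp only [F, G, exp_trace_add_I_smul_one (htr H)]
      have hexp : Real.exp (-(2 * Real.pi * tr H * (1 + t))) * Real.exp (2 * Real.pi * n * t) =
          Real.exp (-(2 * Real.pi * tr H * 1)) *
            Real.exp (-(2 * Real.pi * (tr H - n) * t)) := by
        rw [← Real.exp_add, ← Real.exp_add]
        congr 1
        ring
      have hexp' := congrArg Complex.ofReal hexp
      rw [Complex.ofReal_mul, Complex.ofReal_mul] at hexp'
      linear_combination (c H * Complex.exp (2 * Real.pi * Complex.I *
        ((H : Matrix (Fin 2) (Fin 2) ℂ) * X).trace)) * hexp'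
    have hF : ∀ t, 0 < t → ∑' H, F t H = 0 := by
      intro t ht
      have := (hc _ (add_I_smul_one_mem hX (t := 1 + t) (by linarith))).mul_right
        (Real.exp (2 * Real.pi * n * t) : ℂ)
      rw [zero_mul] at this
      exact this.tsum_eq
    have hG : Summable fun H => ‖G H‖ :=
      (hc _ (add_I_smul_one_mem hX one_pos)).summable.norm
    have hlim : Filter.Tendsto (fun t => ∑' H, F t H) Filter.atTop
        (nhds (∑' H, {H | tr H = n}.indicator G H)) := by
      refine tendsto_tsum_of_dominated_convergence hG (fun H => ?_) ?_
      · rcases lt_trichotomy (tr H) n with h | h | h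
        · simp [F, ih _ h H rfl, Set.indicator, h.ne]
        · simp [hFG, Set.indicator, h]
        · have hpos : 0 < 2 * Real.pi * ((tr H : ℝ) - n) := by
            have : (n : ℝ) < tr H := by exact_mod_cast h
            have := Real.pi_pos
            exact mul_pos (by linarith) (by linarith)
          have h0 : Filter.Tendsto (fun t : ℝ =>
              Real.exp (-(2 * Real.pi * (tr H - n) * t))) Filter.atTop (nhds 0) :=
            Real.tendsto_exp_neg_atTop_nhds_zero.comp
              (Filter.tendsto_id.const_mul_atTop hpos)
          have h1 := ((Complex.continuous_ofReal.tendsto 0).comp h0).const_mul (G H)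
          simpa [hFG, Set.indicator, h.ne', Function.comp_def] using h1
      · filter_upwards [Filter.eventually_gt_atTop 0] with t ht H
        rcases lt_or_ge (tr H) n with h | h
        · simp [F, ih _ h H rfl]
        · rw [hFG, norm_mul, Complex.norm_real, Real.norm_eq_abs, Real.abs_exp]
          refine mul_le_of_le_one_right (norm_nonneg _) (Real.exp_le_one_iff.mpr ?_)
          have : (n : ℝ) ≤ tr H := by exact_mod_cast h
          have := Real.pi_pos
          have : 0 ≤ 2 * Real.pi * ((tr H : ℝ) - n) * t :=
            mul_nonneg (mul_nonneg (by linarith) (by linarith)) ht.le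
          linarith
    have hzero : ∑' H, {H | tr H = n}.indicator G H = 0 := by
      refine tendsto_nhds_unique hlim (tendsto_const_nhds.congr' ?_)
      filter_upwards [Filter.eventually_gt_atTop 0] with t ht
      exact (hF t ht).symm
    rw [← tsum_subtype, ← hfin.coe_toFinset, Finset.tsum_subtype'] at hzero
    rw [← hzero]
    refine Finset.sum_congr rfl fun H hH => ?_
    have hHn : tr H = n := by simpa using hH
    simp only [G]
    rw [exp_trace_add_I_smul_one (htr H), hHn, mul_assoc, mul_comm (Complex.ofReal _)]
    rfl
  have hli := (linearIndependent_monoidHom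
    (Multiplicative (selfAdjoint (Matrix (Fin 2) (Fin 2) ℂ))) ℂ).comp
      (fun H : HermLattice d => traceChar H)
      (fun H H' h => Subtype.ext (traceChar_injOn H.2.1.1 H'.2.1.1 h))
  rw [linearIndependent_iff'] at hli
  intro H hH
  have h := hli hfin.toFinset (fun H => c H * Real.exp (-(2 * Real.pi * n * 1))) (by
    funext X
    simpa using hsum X.toAdd) H (by simpa using hH)
  simpa using h

/-! ### Fourier coefficients of a product -/

/-- The sum of two elements of the index lattice. -/
def latticeAdd {d : ℤ} (x : HermLattice d × HermLattice d) : HermLattice d :=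
  ⟨x.1 + x.2, HermLattice_add x.1.2 x.2.2⟩

lemma finite_latticeAdd_fiber {d : ℤ} (hd : d = -4 ∨ d = -3) (H : HermLattice d) :
    (latticeAdd ⁻¹' {H}).Finite := by
  obtain ⟨n, hn⟩ := exists_trace_eq_natCast H.2
  have hfin : {H' : HermLattice d | (H' : Matrix (Fin 2) (Fin 2) ℂ).trace.re ≤ n}.Finite := by
    refine Set.Finite.of_finite_image ((finite_setOf_trace_le hd n).subset ?_)
      Subtype.val_injective.injOn
    rintro _ ⟨H', hH', rfl⟩
    exact ⟨H'.2, hH'⟩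
  refine (hfin.prod hfin).subset ?_
  rintro ⟨H₁, H₂⟩ h
  obtain ⟨n₁, h₁⟩ := exists_trace_eq_natCast H₁.2
  obtain ⟨n₂, h₂⟩ := exists_trace_eq_natCast H₂.2
  have hsum : (H₁ : Matrix (Fin 2) (Fin 2) ℂ) + H₂ = H := congrArg Subtype.val h
  have htr := congrArg Matrix.trace hsum
  rw [Matrix.trace_add, h₁, h₂, hn] at htr
  have hnat : n₁ + n₂ = n := by exact_mod_cast htr
  constructor
  · simp only [Set.mem_ofPred_eq, h₁, Complex.natCast_re, Nat.cast_le]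
    omega
  · simp only [Set.mem_ofPred_eq, h₂, Complex.natCast_re, Nat.cast_le]
    omega

lemma coe_add_coe_eq_of_mem_fiber {d : ℤ} (hd : d = -4 ∨ d = -3) {H : HermLattice d}
    {x : HermLattice d × HermLattice d} (hx : x ∈ (finite_latticeAdd_fiber hd H).toFinset) :
    (x.1 : Matrix (Fin 2) (Fin 2) ℂ) + x.2 = H := by
  have h : latticeAdd x = H := by simpa using hx
  exact congrArg Subtype.val h

lemma HasSum.mul_sum_fiberwise {ι κ γ : Type*} {F : ι → ℂ} {G : κ → ℂ} {a b : ℂ}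
    (hF : HasSum F a) (hG : HasSum G b) {φ : ι × κ → γ} (hφ : ∀ c, (φ ⁻¹' {c}).Finite) :
    HasSum (fun c => ∑ x ∈ (hφ c).toFinset, F x.1 * G x.2) (a * b) := by
  have hs : Summable fun x : ι × κ => F x.1 * G x.2 :=
    summable_mul_of_summable_norm hF.summable.norm hG.summable.norm
  refine ((hF.mul hG hs).tsum_fiberwise φ).congr_fun fun c => ?_
  have h := Finset.tsum_subtype' (hφ c).toFinset fun x : ι × κ => F x.1 * G x.2
  rw [(hφ c).coe_toFinset] at h
  exact h.symm

lemma coeff_mul_eq_sum {d : ℤ} (hd : d = -4 ∨ d = -3) {k k' l : ℤ}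
    (f : HermitianModularForm d k) (g : HermitianModularForm d k')
    (fg : HermitianModularForm d l)
    (hmul : ∀ Z ∈ HermitianUpperHalfSpace, fg.toFun Z = f.toFun Z * g.toFun Z)
    (H : HermLattice d) :
    fg.coeff H =
      ∑ x ∈ (finite_latticeAdd_fiber hd H).toFinset, f.coeff x.1 * g.coeff x.2 := by
  let conv : HermLattice d → ℂ := fun H =>
    ∑ x ∈ (finite_latticeAdd_fiber hd H).toFinset, f.coeff x.1 * g.coeff x.2
  have hconv : ∀ Z ∈ HermitianUpperHalfSpace, HasSum (fun H : HermLattice d =>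
      (fg.coeff H - conv H) * Complex.exp (2 * Real.pi * Complex.I *
        ((H : Matrix (Fin 2) (Fin 2) ℂ) * Z).trace)) 0 := by
    intro Z hZ
    have hf := f.expansion Z hZ
    have hg := g.expansion Z hZ
    have hprod := hf.mul_sum_fiberwise hg (finite_latticeAdd_fiber hd)
    have hdiff := (fg.expansion Z hZ).sub hprod
    rw [hmul Z hZ, sub_self] at hdiff
    refine hdiff.congr_fun fun H => ?_
    rw [sub_mul, Finset.sum_mul]
    congr 1
    refine Finset.sum_congr rfl fun x hx => ?_
    have hx' : (x.1 : Matrix (Fin 2) (Fin 2) ℂ) + x.2 = H :=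
      coe_add_coe_eq_of_mem_fiber hd hx
    rw [← hx', Matrix.add_mul, Matrix.trace_add, mul_add, Complex.exp_add]
    ring
  exact sub_eq_zero.mp (coeff_eq_zero_of_hasSum_zero hd hconv H)

lemma eq_or_lexLt_or_lexLt_of_add {H₁ H₂ Hf Hg : Matrix (Fin 2) (Fin 2) ℂ}
    (h₁ : H₁.IsHermitian) (h₂ : H₂.IsHermitian) (hf : Hf.IsHermitian) (hg : Hg.IsHermitian)
    (h : H₁ + H₂ = Hf + Hg ∨ lexLt (H₁ + H₂) (Hf + Hg)) :
    lexLt H₁ Hf ∨ lexLt H₂ Hg ∨ (H₁ + H₂ = Hf + Hg ∧ H₁ = Hf ∧ H₂ = Hg) := by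
  rw [lexLt_iff_lexKey_lt h₁ hf, lexLt_iff_lexKey_lt h₂ hg]
  have hle : lexKey H₁ + lexKey H₂ ≤ lexKey Hf + lexKey Hg := by
    rw [← lexKey_add, ← lexKey_add]
    rcases h with h | h
    · rw [h]
    · exact ((lexLt_iff_lexKey_lt (h₁.add h₂) (hf.add hg)).mp h).le
  rcases lt_or_ge (lexKey H₁) (lexKey Hf) with hlt₁ | hge₁
  · exact Or.inl hlt₁
  rcases lt_or_ge (lexKey H₂) (lexKey Hg) with hlt₂ | hge₂
  · exact Or.inr (Or.inl hlt₂)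
  have heq₁ : lexKey H₁ = lexKey Hf := by
    refine hge₁.antisymm' (le_of_not_gt fun hgt => ?_)
    exact absurd hle (not_le_of_gt (add_lt_add_of_lt_of_le hgt hge₂))
  have heq₂ : lexKey H₂ = lexKey Hg := by
    refine hge₂.antisymm' (le_of_not_gt fun hgt => ?_)
    exact absurd hle (not_le_of_gt (add_lt_add_of_le_of_lt hge₁ hgt))
  obtain rfl := eq_of_lexKey_eq h₁ hf heq₁
  obtain rfl := eq_of_lexKey_eq h₂ hg heq₂
  exact Or.inr (Or.inr ⟨rfl, rfl, rfl⟩)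

/-- **Additivity of `ord_p`** (Lemma 4.3): for `p`-integral Hermitian modular
forms `f`, `g` of degree 2 over `K = ℚ(√-1)` or `ℚ(√-3)` which are not `≡ 0 (mod p)`
(so that their orders `Hf = ord_p f`, `Hg = ord_p g` exist), the product `fg`
(a modular form of weight `k + k'`) satisfies `ord_p (fg) = ord_p f + ord_p g`. -/
theorem ordP_mul
    (d : ℤ) (hd : d = -4 ∨ d = -3) (p : ℕ) (hp : Nat.Prime p)
    (k k' : ℤ) (hk : d = -4 → Even k) (hk' : d = -4 → Even k')
    (f : HermitianModularForm d k) (g : HermitianModularForm d k')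
    (fg : HermitianModularForm d (k + k'))
    (hmul : ∀ Z ∈ HermitianUpperHalfSpace, fg.toFun Z = f.toFun Z * g.toFun Z)
    (hfint : ∀ H, IsPIntegral p (f.coeff H)) (hgint : ∀ H, IsPIntegral p (g.coeff H))
    (Hf Hg : Matrix (Fin 2) (Fin 2) ℂ)
    (hf : IsOrdP p f Hf) (hg : IsOrdP p g Hg) :
    IsOrdP p fg (Hf + Hg) := by
  have hlat := HermLattice_add hf.1 hg.1
  refine ⟨hlat, fun hcongr => ?_, fun H hH hlt => ?_⟩
  · rw [coeff_mul_eq_sum hd f g fg hmul ⟨Hf + Hg, hlat⟩] at hcongr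
    let x₀ : HermLattice d × HermLattice d := (⟨Hf, hf.1⟩, ⟨Hg, hg.1⟩)
    have hx₀ : x₀ ∈ (finite_latticeAdd_fiber hd ⟨Hf + Hg, hlat⟩).toFinset :=
      (Set.Finite.mem_toFinset _).mpr rfl
    rw [← Finset.add_sum_erase _ _ hx₀] at hcongr
    have hrest := ModCongr.sum hp (p := p)
      (s := (finite_latticeAdd_fiber hd ⟨Hf + Hg, hlat⟩).toFinset.erase x₀)
      (F := fun x => f.coeff x.1 * g.coeff x.2) (fun x hx => by
        obtain ⟨hne, hx⟩ := Finset.mem_erase.mp hx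
        have hx' : (x.1 : Matrix (Fin 2) (Fin 2) ℂ) + x.2 = Hf + Hg :=
          coe_add_coe_eq_of_mem_fiber hd hx
        rcases eq_or_lexLt_or_lexLt_of_add x.1.2.1.1 x.2.2.1.1 hf.1.1.1 hg.1.1.1
          (Or.inl hx') with h | h | ⟨-, h₁, h₂⟩
        · exact (hf.2.2 _ x.1.2 h).mul_right hp (hgint _)
        · exact ModCongr.mul_left hp (hfint _) (hg.2.2 _ x.2.2 h)
        · exact absurd (Prod.ext (Subtype.ext h₁) (Subtype.ext h₂)) hne)
    have hlead : ModCongr p 1 (f.coeff Hf * g.coeff Hg) 0 := by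
      rw [modCongr_one_zero_iff] at *
      have h := hcongr.add hp hrest.neg
      rwa [← sub_eq_add_neg, ← sub_div, add_sub_cancel_right] at h
    exact ((hfint Hf).modCongr_or_modCongr_of_mul hp (hgint Hg) hlead).elim hf.2.1 hg.2.1
  · rw [coeff_mul_eq_sum hd f g fg hmul ⟨H, hH⟩]
    refine ModCongr.sum hp fun x hx => ?_
    have hx' : (x.1 : Matrix (Fin 2) (Fin 2) ℂ) + x.2 = H :=
      coe_add_coe_eq_of_mem_fiber hd hx
    rcases eq_or_lexLt_or_lexLt_of_add x.1.2.1.1 x.2.2.1.1 hf.1.1.1 hg.1.1.1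
      (Or.inr (hx'.symm ▸ hlt)) with h | h | ⟨hsum, -, -⟩
    · exact (hf.2.2 _ x.1.2 h).mul_right hp (hgint _)
    · exact ModCongr.mul_left hp (hfint _) (hg.2.2 _ x.2.2 h)
    · rw [lexLt_iff_lexKey_lt hH.1.1 hlat.1.1, ← hx', hsum] at hlt
      exact absurd hlt (lt_irrefl _)

end
end

section
/- Let n ≥ 1 and p a prime with p > n + 3 or p ≡ 1 (mod 4). Let f ∈ M_k(Γ_n)_{Z_(p)} and g ∈ M_{k'}(Γ_n)_{Z_(p)} be Siegel modular forms of degree n for Γ_n = Sp_n(Z) with p-integral Fourier coefficients. If f ≡ g (mod p^l) (coefficientwise) and f ≢ 0 (mod p), then k ≡ k' (mod (p−1)p^{l−1}). -/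
open Complex Matrix
open scoped ComplexOrder

noncomputable section

section

open UpperHalfPlane hiding I
open PowerSeries Function Filter
open scoped Topology Manifold MatrixGroups ModularForm

/-- `F` is the sum of the power series `φ` in `q_R = exp (2πiτ/R)` on the upper half plane. -/
def HasQSeries (R : ℕ) (F : ℍ → ℂ) (φ : ℂ⟦X⟧) : Prop :=
  ∀ τ : ℍ, HasSum (fun m => coeff m φ * Periodic.qParam R τ ^ m) (F τ)

namespace HasQSeries

variable {R : ℕ} {F G : ℍ → ℂ} {φ ψ : ℂ⟦X⟧}

theorem add (hF : HasQSeries R F φ) (hG : HasQSeries R G ψ) : HasQSeries R (F + G) (φ + ψ) :=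
  fun τ => by simpa [add_mul] using! (hF τ).add (hG τ)

theorem neg (hF : HasQSeries R F φ) : HasQSeries R (-F) (-φ) :=
  fun τ => by simpa using! (hF τ).neg

theorem const (R : ℕ) (c : ℂ) : HasQSeries R (fun _ => c) (C c) := fun τ => by
  have := hasSum_single (f := fun m => coeff m (C c) * Periodic.qParam R τ ^ m) 0
    fun m hm => by simp [coeff_C, hm]
  simpa using this

theorem mul (hF : HasQSeries R F φ) (hG : HasQSeries R G ψ) : HasQSeries R (F * G) (φ * ψ) :=
  fun τ => by
  have h1 := (hF τ).summable.norm
  have h2 := (hG τ).summable.norm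
  have h3 := summable_norm_sum_mul_antidiagonal_of_summable_norm h1 h2
  have h4 := tsum_mul_tsum_eq_tsum_sum_antidiagonal_of_summable_norm h1 h2
  rw [(hF τ).tsum_eq, (hG τ).tsum_eq] at h4
  have h5 := h3.of_norm.hasSum
  rw [← h4] at h5
  refine h5.congr_fun fun m => ?_
  rw [coeff_mul, Finset.sum_mul]
  refine Finset.sum_congr rfl fun x hx => ?_
  rw [← Finset.HasAntidiagonal.mem_antidiagonal.1 hx, pow_add]
  ring

theorem exists_analytic (hR : 0 < R) (hF : HasQSeries R F φ) :
    ∃ g : ℂ → ℂ, HasFPowerSeriesOnBall g (.ofScalars ℂ fun m => coeff m φ) 0 1 ∧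
      ∀ τ : ℍ, F τ = g (Periodic.qParam R τ) := by
  have hR' : (0 : ℝ) < R := by exact_mod_cast hR
  have key : ∀ q : ℂ, ‖q‖ < 1 → q ≠ 0 → Summable fun m => coeff m φ * q ^ m := by
    intro q hq hq0
    have h1 := Periodic.im_invQParam_pos_of_norm_lt_one hR' hq hq0
    have := (hF ⟨_, h1⟩).summable
    simpa [Periodic.qParam_right_inv hR'.ne' hq0] using this
  have hrad : 1 ≤ (FormalMultilinearSeries.ofScalars ℂ fun m => coeff m φ).radius := by
    refine le_of_forall_lt_imp_le_of_dense fun r hr ↦ ?_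
    rcases eq_or_ne r 0 with rfl | hr'
    · simp
    · lift r to NNReal using hr.ne_top
      apply FormalMultilinearSeries.le_radius_of_summable
      have := (key (r : ℂ) (by simpa using hr) (mod_cast hr')).norm
      simpa [norm_mul, mul_comm] using this
  refine ⟨_, (FormalMultilinearSeries.hasFPowerSeriesOnBall _
    (lt_of_lt_of_le one_pos hrad)).mono one_pos hrad, fun τ => ?_⟩
  rw [← (hF τ).tsum_eq]
  simp [FormalMultilinearSeries.sum, mul_comm]

theorem unique (hR : 0 < R) (hF : HasQSeries R F φ) (hF' : HasQSeries R F ψ) : φ = ψ := by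
  have hR' : (0 : ℝ) < R := by exact_mod_cast hR
  obtain ⟨g, hg, hgF⟩ := hF.exists_analytic hR
  obtain ⟨g', hg', hgF'⟩ := hF'.exists_analytic hR
  have hev : g =ᶠ[𝓝 0] g' := by
    refine (hg.hasFPowerSeriesAt.continuousAt.eventuallyEq_nhds_iff_eventuallyEq_nhdsNE
      hg'.hasFPowerSeriesAt.continuousAt).mp ?_
    have : ∀ᶠ q : ℂ in 𝓝[≠] 0, ‖q‖ < 1 :=
      nhdsWithin_le_nhds (by simpa [Metric.ball, dist_eq_norm] using Metric.ball_mem_nhds (0 : ℂ) one_pos)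
    filter_upwards [self_mem_nhdsWithin, this] with q hq0 hq
    have h1 := Periodic.im_invQParam_pos_of_norm_lt_one hR' hq hq0
    have := (hgF ⟨_, h1⟩).symm.trans (hgF' ⟨_, h1⟩)
    simpa [Periodic.qParam_right_inv hR'.ne' hq0] using this
  have := (hg.hasFPowerSeriesAt.congr hev).eq_formalMultilinearSeries hg'.hasFPowerSeriesAt
  ext m
  simpa using congr_arg (FormalMultilinearSeries.coeff · m) this

theorem tendsto (hR : 0 < R) (hF : HasQSeries R F φ) :
    Tendsto F atImInfty (𝓝 (constantCoeff φ)) := by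
  have hR' : (0 : ℝ) < R := by exact_mod_cast hR
  obtain ⟨g, hg, hgF⟩ := hF.exists_analytic hR
  have h0 : g 0 = constantCoeff φ := by
    have := hg.coeff_zero (fun _ => 0)
    simpa using this.symm
  rw [funext hgF, ← h0]
  have := hg.hasFPowerSeriesAt.continuousAt.tendsto.comp
    (qParam_tendsto_atImInfty hR')
  exact this

theorem mdifferentiable (hR : 0 < R) (hF : HasQSeries R F φ) : MDiff F := by
  have hR' : (0 : ℝ) < R := by exact_mod_cast hR
  obtain ⟨g, hg, hgF⟩ := hF.exists_analytic hR
  rw [UpperHalfPlane.mdifferentiable_iff]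
  have h1 : DifferentiableOn ℂ (fun z => g (Periodic.qParam R z)) {z | 0 < z.im} := by
    refine hg.differentiableOn.comp (Periodic.differentiable_qParam.differentiableOn) fun z hz => ?_
    have := Periodic.norm_qParam_lt_one hR' hz
    rw [Metric.mem_eball, edist_zero_right, ← ofReal_norm]
    rwa [ENNReal.ofReal_lt_one]
  refine h1.congr fun z hz => ?_
  simp [hgF, UpperHalfPlane.ofComplex_apply_of_im_pos hz]

theorem periodic (hR : 0 < R) (hF : HasQSeries R F φ) : Periodic (F ∘ ofComplex) (R : ℝ) := by
  intro z
  obtain ⟨g, -, hgF⟩ := hF.exists_analytic hR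
  by_cases hz : 0 < z.im
  · have hz' : 0 < (z + (R : ℝ)).im := by simpa using hz
    have : Periodic.qParam (R : ℝ) (z + (R : ℝ)) = Periodic.qParam (R : ℝ) z := by
      rw [Periodic.qParam, Periodic.qParam, mul_add, add_div, exp_add,
        mul_div_cancel_right₀ _ (by simpa using hR.ne'), exp_two_pi_mul_I, mul_one]
    simp only [Function.comp_apply, hgF, ofComplex_apply_of_im_pos hz,
      ofComplex_apply_of_im_pos hz', this]
  · have hz' : ¬ 0 < (z + (R : ℝ)).im := by simpa using hz
    simp only [Function.comp_apply, ofComplex_apply_of_im_nonpos (not_lt.1 hz),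
      ofComplex_apply_of_im_nonpos (not_lt.1 hz')]

theorem inv (hR : 0 < R) (hF : HasQSeries R F φ) (h0 : ∀ τ, F τ ≠ 0)
    (hφ : φ * ψ = 1) : HasQSeries R (fun τ => (F τ)⁻¹) ψ := by
  have hR' : (0 : ℝ) < R := by exact_mod_cast hR
  have hc : constantCoeff φ ≠ 0 := fun h => by simpa [h] using congr_arg constantCoeff hφ
  have hd : MDiff (fun τ => (F τ)⁻¹) := by
    have := hF.mdifferentiable hR
    rw [UpperHalfPlane.mdifferentiable_iff] at this ⊢
    exact this.inv fun z _ => h0 _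
  have hb : IsBoundedAtImInfty (fun τ => (F τ)⁻¹) :=
    ((hF.tendsto hR).inv₀ hc).isBigO_one ℝ
  have hp : Periodic ((fun τ => (F τ)⁻¹) ∘ ofComplex) (R : ℝ) := fun z => by
    have := hF.periodic hR z
    simp only [Function.comp_apply] at this ⊢
    rw [this]
  have hs : HasQSeries R (fun τ => (F τ)⁻¹) (qExpansion R fun τ => (F τ)⁻¹) :=
    fun τ => by simpa using hasSum_qExpansion hR' hp hd hb τ
  have h1 : φ * (qExpansion R fun τ => (F τ)⁻¹) = 1 := by
    refine (hF.mul hs).unique hR ?_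
    have := const R 1
    rw [map_one] at this
    convert! this using 2 with τ
    exact mul_inv_cancel₀ (h0 τ)
  have : ψ = qExpansion R fun τ => (F τ)⁻¹ :=
    (mul_left_cancel₀ (fun h => by simp [h] at hφ) (hφ.trans h1.symm))
  rwa [this]

theorem comp {R' a : ℕ} {u : ℂ} (ha : a ≠ 0) (hF : HasQSeries R F φ) (σ : ℍ → ℍ)
    (hσ : ∀ τ : ℍ, Periodic.qParam R (σ τ) = u * Periodic.qParam R' τ ^ a) :
    HasQSeries R' (fun τ => F (σ τ)) (expand a ha (rescale u φ)) := fun τ => by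
  have := hF (σ τ)
  simp only [hσ] at this
  have hinj : Injective fun m : ℕ => a * m := fun x y h => by simpa [ha] using h
  rw [← hinj.hasSum_iff]
  · convert this using 2 with m
    simp [coeff_expand_mul, coeff_rescale, mul_pow, pow_mul]
    ring
  · intro m hm
    rw [coeff_expand_of_not_dvd, zero_mul]
    rintro ⟨c, rfl⟩
    exact hm ⟨c, rfl⟩

theorem qParam_pow (R a : ℕ) : HasQSeries R (fun τ => Periodic.qParam R τ ^ a) (X ^ a) :=
  fun τ => by
  have := hasSum_single (f := fun m => coeff m (X ^ a : ℂ⟦X⟧) * Periodic.qParam R τ ^ m) a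
    fun m hm => by simp [coeff_X_pow, hm]
  simpa using this

end HasQSeries

namespace HasQSeries

theorem div_qParam_pow {R a : ℕ} {F : ℍ → ℂ} {φ : ℂ⟦X⟧} (hF : HasQSeries R F (X ^ a * φ)) :
    HasQSeries R (fun τ => F τ / Periodic.qParam R τ ^ a) φ := fun τ => by
  have h := hF τ
  rw [← (add_left_injective a).hasSum_iff] at h
  · have := h.div_const (Periodic.qParam R τ ^ a)
    refine this.congr_fun fun m => ?_
    simp only [Function.comp_apply, add_comm m a, pow_add]
    rw [add_comm a m, coeff_X_pow_mul]
    field_simp [pow_ne_zero a (Periodic.qParam_ne_zero (h := (R : ℝ)) (τ : ℂ))]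
  · intro m hm
    rw [coeff_X_pow_mul', if_neg, zero_mul]
    exact fun h => hm ⟨m - a, Nat.sub_add_cancel h⟩

end HasQSeries

/-- The factor of automorphy `cτ + d`. -/
def autFactor (γ : SL(2, ℤ)) (τ : ℍ) : ℂ := (γ 1 0 : ℂ) * τ + (γ 1 1 : ℂ)

theorem autFactor_eq_denom (γ : SL(2, ℤ)) (τ : ℍ) :
    autFactor γ τ = denom (γ : GL (Fin 2) ℝ) τ := (ModularGroup.denom_apply γ τ).symm

theorem autFactor_ne_zero (γ : SL(2, ℤ)) (τ : ℍ) : autFactor γ τ ≠ 0 := by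
  rw [autFactor_eq_denom]
  exact denom_ne_zero _ _

theorem coe_smul_eq (γ : SL(2, ℤ)) (τ : ℍ) :
    ((γ • τ : ℍ) : ℂ) = ((γ 0 0 : ℂ) * τ + (γ 0 1 : ℂ)) / autFactor γ τ := by
  rw [coe_specialLinearGroup_apply]
  simp [autFactor]

theorem autFactor_mul (γ δ : SL(2, ℤ)) (τ : ℍ) :
    autFactor (γ * δ) τ = autFactor γ (δ • τ) * autFactor δ τ := by
  have h := autFactor_ne_zero δ τ
  rw [autFactor, autFactor, coe_smul_eq]
  field_simp
  have h0 : (γ * δ) 1 0 = γ 1 0 * δ 0 0 + γ 1 1 * δ 1 0 := by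
    simp [Matrix.mul_apply, Fin.sum_univ_two]
  have h1 : (γ * δ) 1 1 = γ 1 0 * δ 0 1 + γ 1 1 * δ 1 1 := by
    simp [Matrix.mul_apply, Fin.sum_univ_two]
  rw [h0, h1, autFactor]
  push_cast
  ring

/-- `F` is the sum of a power series in `q_R` with coefficients in `O`. -/
def HasQInt (O : ValuationSubring ℂ) (R : ℕ) (F : ℍ → ℂ) (φ : O⟦X⟧) : Prop :=
  HasQSeries R F (PowerSeries.map O.subtype φ)

/-- Pairs consisting of a function and its integral expansion form a ring. -/
def qIntSubring (O : ValuationSubring ℂ) (R : ℕ) : Subring ((ℍ → ℂ) × O⟦X⟧) where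
  carrier := {x | HasQInt O R x.1 x.2}
  mul_mem' {x y} hx hy := by
    simpa [HasQInt] using HasQSeries.mul hx hy
  one_mem' := by
    have := HasQSeries.const R 1
    simpa [HasQInt] using! this
  add_mem' {x y} hx hy := by
    simpa [HasQInt] using HasQSeries.add hx hy
  zero_mem' := by
    have := HasQSeries.const R 0
    simpa [HasQInt] using! this
  neg_mem' {x} hx := by
    simpa [HasQInt] using HasQSeries.neg hx

/-- Reduction of power series modulo the maximal ideal. -/
abbrev redSeries (O : ValuationSubring ℂ) : O⟦X⟧ →+* (IsLocalRing.ResidueField O)⟦X⟧ :=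
  PowerSeries.map (IsLocalRing.residue O)

namespace HasQInt

variable {O : ValuationSubring ℂ} {R : ℕ} {F G : ℍ → ℂ} {φ ψ : O⟦X⟧}

theorem mul (hF : HasQInt O R F φ) (hG : HasQInt O R G ψ) :
    HasQInt O R (fun τ => F τ * G τ) (φ * ψ) :=
  (qIntSubring O R).mul_mem (x := (F, φ)) (y := (G, ψ)) hF hG

theorem add (hF : HasQInt O R F φ) (hG : HasQInt O R G ψ) :
    HasQInt O R (fun τ => F τ + G τ) (φ + ψ) :=
  (qIntSubring O R).add_mem (x := (F, φ)) (y := (G, ψ)) hF hG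

theorem sub (hF : HasQInt O R F φ) (hG : HasQInt O R G ψ) :
    HasQInt O R (fun τ => F τ - G τ) (φ - ψ) :=
  (qIntSubring O R).sub_mem (x := (F, φ)) (y := (G, ψ)) hF hG

theorem pow (hF : HasQInt O R F φ) (a : ℕ) : HasQInt O R (fun τ => F τ ^ a) (φ ^ a) :=
  (qIntSubring O R).pow_mem (x := (F, φ)) hF a

theorem const (R : ℕ) (c : O) : HasQInt O R (fun _ => (c : ℂ)) (C c) := by
  simpa [HasQInt] using HasQSeries.const R c

theorem sum {ι : Type*} (s : Finset ι) {F : ι → ℍ → ℂ} {φ : ι → O⟦X⟧}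
    (h : ∀ i ∈ s, HasQInt O R (F i) (φ i)) :
    HasQInt O R (fun τ => ∑ i ∈ s, F i τ) (∑ i ∈ s, φ i) := by
  have := (qIntSubring O R).sum_mem (t := s) (f := fun i => (F i, φ i)) h
  change HasQInt O R _ _ at this
  rw [Prod.fst_sum, Prod.snd_sum] at this
  convert this using 1
  ext τ
  simp

theorem prod {ι : Type*} (s : Finset ι) {F : ι → ℍ → ℂ} {φ : ι → O⟦X⟧}
    (h : ∀ i ∈ s, HasQInt O R (F i) (φ i)) :
    HasQInt O R (fun τ => ∏ i ∈ s, F i τ) (∏ i ∈ s, φ i) := by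
  have := (qIntSubring O R).prod_mem (t := s) (f := fun i => (F i, φ i)) h
  change HasQInt O R _ _ at this
  rw [Prod.fst_prod, Prod.snd_prod] at this
  convert this using 1
  ext τ
  simp

theorem unique (hR : 0 < R) (hF : HasQInt O R F φ) (hF' : HasQInt O R F ψ) : φ = ψ :=
  PowerSeries.map_injective _ Subtype.val_injective (HasQSeries.unique hR hF hF')

theorem comp {R' a : ℕ} {u : O} (ha : a ≠ 0) (hF : HasQInt O R F φ) (σ : ℍ → ℍ)
    (hσ : ∀ τ : ℍ, Periodic.qParam R (σ τ) = u * Periodic.qParam R' τ ^ a) :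
    HasQInt O R' (fun τ => F (σ τ)) (expand a ha (rescale u φ)) := by
  have := HasQSeries.comp ha hF σ hσ
  rw [HasQInt, map_expand]
  convert this using 2
  ext m
  simp

theorem inv (hR : 0 < R) (hF : HasQInt O R F φ) (h0 : ∀ τ, F τ ≠ 0) (h : φ * ψ = 1) :
    HasQInt O R (fun τ => (F τ)⁻¹) ψ :=
  HasQSeries.inv hR hF h0 (by rw [← map_mul, h, map_one])

theorem div_qParam_pow {a : ℕ} (hF : HasQInt O R F (X ^ a * φ)) :
    HasQInt O R (fun τ => F τ / Periodic.qParam R τ ^ a) φ :=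
  HasQSeries.div_qParam_pow (by simpa [HasQInt] using hF)

theorem qParam_pow (O : ValuationSubring ℂ) (R a : ℕ) :
    HasQInt O R (fun τ => Periodic.qParam R τ ^ a) (X ^ a) := by
  simpa [HasQInt] using HasQSeries.qParam_pow R a

end HasQInt

section Discriminant

variable {O : ValuationSubring ℂ}

theorem hasQSeries_qExpansion {k : ℤ} (f : ModularForm 𝒮ℒ k) :
    HasQSeries 1 f (qExpansion 1 f) := fun τ => by
  simpa using ModularForm.hasSum_qExpansion f one_pos one_mem_strictPeriods_SL τ

theorem exists_hasQInt_of_coeff_mem {k : ℤ} (f : ModularForm 𝒮ℒ k)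
    (h : ∀ m, coeff m (qExpansion 1 f) ∈ O) :
    ∃ φ : O⟦X⟧, HasQInt O 1 f φ ∧ ∀ m,
      O.subtype (coeff m φ) = coeff m (qExpansion 1 f) := by
  refine ⟨PowerSeries.mk fun m => ⟨_, h m⟩, ?_, fun m => by simp⟩
  have : PowerSeries.map O.subtype (PowerSeries.mk fun m => (⟨_, h m⟩ : O)) = qExpansion 1 f := by
    ext m
    simp
  rw [HasQInt, this]
  exact hasQSeries_qExpansion f

theorem exists_hasQInt_E₄ : ∃ φ : O⟦X⟧, HasQInt O 1 ModularForm.E₄ φ ∧ constantCoeff φ = 1 := by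
  obtain ⟨φ, h, hφ⟩ := exists_hasQInt_of_coeff_mem (O := O) ModularForm.E₄ fun m => by
    rw [EisensteinSeries.E_qExpansion_coeff _ ⟨2, rfl⟩]
    split_ifs
    · exact O.one_mem
    · have : -(2 * (4 : ℕ) / bernoulli 4 : ℂ) = (240 : ℤ) := by
        rw [show bernoulli 4 = -1 / 30 by decide +kernel]; norm_num
      rw [this]
      exact O.mul_mem _ _ (intCast_mem _ _) (natCast_mem _ _)
  refine ⟨φ, h, Subtype.val_injective ?_⟩
  rw [← coeff_zero_eq_constantCoeff_apply]
  exact (hφ 0).trans (EisensteinSeries.E_qExpansion_coeff_zero _ ⟨2, rfl⟩)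

theorem exists_hasQInt_E₆ : ∃ φ : O⟦X⟧, HasQInt O 1 ModularForm.E₆ φ := by
  obtain ⟨φ, h, hφ⟩ := exists_hasQInt_of_coeff_mem (O := O) ModularForm.E₆ fun m => by
    rw [EisensteinSeries.E_qExpansion_coeff _ ⟨3, rfl⟩]
    split_ifs
    · exact O.one_mem
    · have : -(2 * (6 : ℕ) / bernoulli 6 : ℂ) = (-504 : ℤ) := by
        rw [show bernoulli 6 = 1 / 42 by decide +kernel]; norm_num
      rw [this]
      exact O.mul_mem _ _ (intCast_mem _ _) (natCast_mem _ _)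
  exact ⟨φ, h⟩

theorem exists_hasQInt_discriminant (h6 : (1728 : ℂ)⁻¹ ∈ O) :
    ∃ δ : O⟦X⟧, HasQInt O 1 ModularForm.discriminant (X * δ) ∧ constantCoeff δ = 1 := by
  obtain ⟨φ, hφ, -⟩ := exists_hasQInt_E₄ (O := O)
  obtain ⟨ψ, hψ⟩ := exists_hasQInt_E₆ (O := O)
  have h := (HasQInt.const 1 ⟨_, h6⟩).mul ((hφ.pow 3).sub (hψ.pow 2))
  have hΔ : HasQInt O 1 ModularForm.discriminant (C ⟨_, h6⟩ * (φ ^ 3 - ψ ^ 2)) := by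
    convert h using 2 with τ
    rw [ModularForm.discriminant_eq_E₄_cube_sub_E₆_sq]
    ring
  have hq : PowerSeries.map O.subtype (C ⟨_, h6⟩ * (φ ^ 3 - ψ ^ 2)) =
      qExpansion 1 ModularForm.discriminant := by
    refine HasQSeries.unique one_pos hΔ fun τ => ?_
    simpa using ModularForm.hasSum_qExpansion CuspForm.discriminant one_pos
      one_mem_strictPeriods_SL τ
  have h0 : constantCoeff (C ⟨_, h6⟩ * (φ ^ 3 - ψ ^ 2)) = 0 := by
    apply Subtype.val_injective
    have := congr_arg (coeff 0) hq
    rw [coeff_map] at this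
    rw [coeff_zero_eq_constantCoeff_apply] at this
    refine this.trans ?_
    exact CuspFormClass.qExpansion_coeff_zero CuspForm.discriminant one_pos one_mem_strictPeriods_SL
  obtain ⟨δ, hδ⟩ := X_dvd_iff.2 h0
  refine ⟨δ, hδ ▸ hΔ, Subtype.val_injective ?_⟩
  have := congr_arg (coeff 1) hq
  rw [coeff_map, hδ, ModularForm.discriminant_qExpansion_coeff_one, ← zero_add 1,
    coeff_succ_X_mul] at this
  simpa using this

/-- The nowhere vanishing function `Δ / q`. -/
def reducedDelta (τ : ℍ) : ℂ := ModularForm.discriminant τ / Periodic.qParam 1 τ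

theorem discriminant_eq_qParam_mul (τ : ℍ) :
    ModularForm.discriminant τ = Periodic.qParam 1 τ * reducedDelta τ := by
  rw [reducedDelta, mul_div_cancel₀ _ (Periodic.qParam_ne_zero _)]

theorem exists_hasQInt_reducedDelta (h6 : (1728 : ℂ)⁻¹ ∈ O) :
    ∃ δ δ' : O⟦X⟧, HasQInt O 1 reducedDelta δ ∧ HasQInt O 1 (fun τ => (reducedDelta τ)⁻¹) δ' ∧
      δ * δ' = 1 := by
  obtain ⟨δ, hδ, h1⟩ := exists_hasQInt_discriminant h6
  have h2 : HasQInt O 1 reducedDelta δ := by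
    have := HasQInt.div_qParam_pow (a := 1) (φ := δ) (by simpa using hδ)
    convert! this using 2 with τ
    simp [reducedDelta]
  obtain ⟨δ', hδ'⟩ := (isUnit_iff_constantCoeff.2 (h1 ▸ isUnit_one) : IsUnit δ).exists_right_inv
  refine ⟨δ, δ', h2, h2.inv one_pos (fun τ => ?_) hδ', hδ'⟩
  exact div_ne_zero (ModularForm.discriminant_ne_zero τ) (Periodic.qParam_ne_zero _)

theorem modularForm_smul {k : ℤ} (f : ModularForm 𝒮ℒ k) (γ : SL(2, ℤ)) (τ : ℍ) :
    f (γ • τ) = autFactor γ τ ^ k * f τ := by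
  rw [autFactor_eq_denom]
  exact SlashInvariantForm.slash_action_eqn'' f (MonoidHom.mem_range.2 ⟨γ, rfl⟩) τ

theorem discriminant_smul (γ : SL(2, ℤ)) (τ : ℍ) :
    ModularForm.discriminant (γ • τ) = autFactor γ τ ^ 12 * ModularForm.discriminant τ := by
  rw [autFactor_eq_denom]
  exact SlashInvariantForm.slash_action_eqn'' CuspForm.discriminant (MonoidHom.mem_range.2 ⟨γ, rfl⟩) τ

end Discriminant

section Sturm

theorem exists_modularForm_of_hasQSeries {R : ℕ} (hR : 0 < R) {k : ℤ} {D : ℍ → ℂ} {φ : ℂ⟦X⟧}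
    (hD : ∀ (γ : SL(2, ℤ)) τ, D (γ • τ) = autFactor γ τ ^ k * D τ) (hφ : HasQSeries R D φ) :
    ∃ f : ModularForm 𝒮ℒ k, ⇑f = D := by
  have hs : ∀ γ : SL(2, ℤ), D ∣[k] γ = D := fun γ => by
    ext τ
    rw [ModularForm.SL_slash_apply, hD, autFactor_eq_denom, mul_right_comm,
      ← zpow_add₀ (denom_ne_zero _ _), add_neg_cancel, zpow_zero, one_mul]
  refine ⟨⟨⟨D, ?_⟩, hφ.mdifferentiable hR, ?_⟩, rfl⟩
  · rintro _ ⟨γ, rfl⟩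
    exact hs γ
  · intro c hc
    rw [Subgroup.IsArithmetic.isCusp_iff_isCusp_SL2Z] at hc
    rw [OnePoint.isBoundedAt_iff_forall_SL2Z hc]
    intro γ _
    change IsBoundedAtImInfty (D ∣[k] γ)
    rw [hs]
    exact (hφ.tendsto hR).isBigO_one ℝ

variable {O : ValuationSubring ℂ}

theorem redSeries_eq_zero_of_levelOne (h6 : (1728 : ℂ)⁻¹ ∈ O) (W : ℕ) :
    ∀ {D : ℍ → ℂ} {φ : O⟦X⟧},
      (∀ (γ : SL(2, ℤ)) τ, D (γ • τ) = autFactor γ τ ^ (12 * W) * D τ) →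
      HasQInt O 1 D φ → (∀ m ≤ W, coeff m (redSeries O φ) = 0) → redSeries O φ = 0 := by
  induction W with
  | zero =>
    intro D φ hD hφ h0
    obtain ⟨f, hf⟩ := exists_modularForm_of_hasQSeries (k := 0) one_pos (by simpa using hD) hφ
    obtain ⟨c, hc⟩ := ModularFormClass.levelOne_weight_zero_const f
    have h1 : HasQSeries 1 D (C c) := by
      rw [← hf, hc]
      exact HasQSeries.const 1 c
    have h2 := HasQSeries.unique one_pos hφ h1
    ext m
    rcases Nat.eq_zero_or_pos m with rfl | hm
    · simpa using h0 0 le_rfl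
    · have h3 := congr_arg (coeff m) h2
      rw [coeff_map, coeff_C, if_neg hm.ne'] at h3
      have : coeff m φ = 0 := Subtype.val_injective h3
      rw [coeff_map, this, map_zero, map_zero]
  | succ W ih =>
    intro D φ hD hφ h0
    obtain ⟨ε, hε, hε1⟩ := exists_hasQInt_E₄ (O := O)
    obtain ⟨δ, δ', hδ, hδ', hδδ⟩ := exists_hasQInt_reducedDelta h6
    set c := constantCoeff φ with hc
    have hD1 := hφ.sub ((HasQInt.const 1 c).mul (hε.pow (3 * (W + 1))))
    obtain ⟨ψ, hψ⟩ : X ∣ φ - C c * ε ^ (3 * (W + 1)) := by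
      rw [X_dvd_iff]
      simp [hε1, ← hc]
    have hcr : IsLocalRing.residue O c = 0 := by
      have := h0 0 (Nat.zero_le _)
      rwa [coeff_map, coeff_zero_eq_constantCoeff_apply] at this
    have hred : redSeries O φ = X * redSeries O ψ := by
      have := congr_arg (redSeries O) hψ
      rw [map_sub, map_mul, map_mul, map_C, hcr, map_zero, zero_mul, sub_zero] at this
      rw [this, redSeries, map_X]
    rw [hψ, ← pow_one X] at hD1
    have hD2 := hD1.div_qParam_pow.mul hδ'
    have key := ih (D := fun τ => (D τ - c * ModularForm.E₄ τ ^ (3 * (W + 1))) /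
      ModularForm.discriminant τ) (φ := ψ * δ') ?_ ?_ ?_
    · rw [map_mul] at key
      have h1 : redSeries O δ * redSeries O δ' = 1 := by rw [← map_mul, hδδ, map_one]
      have : redSeries O ψ = 0 := by
        calc redSeries O ψ = redSeries O ψ * (redSeries O δ * redSeries O δ') := by rw [h1, mul_one]
          _ = redSeries O δ * (redSeries O ψ * redSeries O δ') := by ring
          _ = 0 := by rw [key, mul_zero]
      rw [hred, this, mul_zero]
    · intro γ τ
      rw [hD, modularForm_smul, discriminant_smul]
      have := autFactor_ne_zero γ τ
      have := ModularForm.discriminant_ne_zero τ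
      field_simp
      ring
    · convert! hD2 using 2 with τ
      rw [discriminant_eq_qParam_mul]
      rw [Nat.cast_one, pow_one, ← div_eq_mul_inv, div_div]
    · intro m hm
      have : ∀ i ≤ W, coeff i (redSeries O ψ) = 0 := fun i hi => by
        have := h0 (i + 1) (by omega)
        rwa [hred, coeff_succ_X_mul] at this
      rw [map_mul, coeff_mul]
      refine Finset.sum_eq_zero fun x hx => ?_
      rw [Finset.HasAntidiagonal.mem_antidiagonal] at hx
      rw [this _ (by omega), zero_mul]

/-- Sturm's bound modulo the maximal ideal, for level one forms expanded in `q_R`. -/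
theorem redSeries_eq_zero_of_X_pow_dvd (h6 : (1728 : ℂ)⁻¹ ∈ O) {R a W : ℕ} (hR : 0 < R)
    (haW : R * W < 12 * a) {E : ℍ → ℂ} {φ : O⟦X⟧}
    (hE : ∀ (γ : SL(2, ℤ)) τ, E (γ • τ) = autFactor γ τ ^ W * E τ)
    (hφ : HasQInt O R E φ) (h0 : X ^ a ∣ redSeries O φ) : redSeries O φ = 0 := by
  have hD := hφ.pow 12
  have hDt : ∀ (γ : SL(2, ℤ)) τ, E (γ • τ) ^ 12 = autFactor γ τ ^ (12 * W) * E τ ^ 12 :=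
    fun γ τ => by rw [hE, mul_pow, ← pow_mul, mul_comm 12]
  obtain ⟨f, hf⟩ := exists_modularForm_of_hasQSeries (k := (12 * W : ℕ)) hR
    (fun γ τ => by rw [zpow_natCast, hDt]) hD
  have hθ := hasQSeries_qExpansion f
  set θ := qExpansion 1 f
  have hRθ : PowerSeries.map O.subtype (φ ^ 12) = expand R hR.ne' θ := by
    have := HasQSeries.comp (R' := R) (u := 1) hR.ne' hθ id fun τ => by
      rw [one_mul, Periodic.qParam, Periodic.qParam, ← Complex.exp_nat_mul]
      congr 1
      have : (R : ℂ) ≠ 0 := by exact_mod_cast hR.ne'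
      simp
      field_simp
    rw [rescale_one] at this
    exact HasQSeries.unique hR hD (by simpa [hf] using! this)
  have hcoe : ∀ m, O.subtype (coeff (R * m) (φ ^ 12)) = coeff m θ := fun m => by
    rw [← coeff_map, hRθ, coeff_expand_mul]
  set ψ : O⟦X⟧ := PowerSeries.mk fun m => coeff (R * m) (φ ^ 12)
  have hψ : HasQInt O 1 (fun τ => E τ ^ 12) ψ := by
    have : PowerSeries.map O.subtype ψ = θ := by
      ext m
      rw [coeff_map, coeff_mk, hcoe]
    rw [HasQInt, this]
    rw [hf] at hθ
    exact hθ
  have hred : ∀ m, coeff m (redSeries O ψ) = coeff (R * m) (redSeries O φ ^ 12) := fun m => by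
    rw [coeff_map, coeff_mk, ← map_pow, coeff_map]
  have hdvd : X ^ (12 * a) ∣ redSeries O φ ^ 12 := by
    rw [mul_comm, pow_mul]
    exact pow_dvd_pow_of_dvd h0 12
  have h1 := redSeries_eq_zero_of_levelOne h6 W hDt hψ fun m hm => by
    rw [hred]
    exact X_pow_dvd_iff.1 hdvd _ ((Nat.mul_le_mul_left R hm).trans_lt haW)
  have h2 : redSeries O φ ^ 12 = 0 := by
    ext m
    by_cases hm : R ∣ m
    · obtain ⟨i, rfl⟩ := hm
      rw [← hred, h1, map_zero, map_zero]
    · have : coeff m (φ ^ 12) = 0 := Subtype.val_injective <| by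
        have := congr_arg (coeff m) hRθ
        rwa [coeff_map, coeff_expand_of_not_dvd _ _ _ hm] at this
      rw [← map_pow, coeff_map, this, map_zero, map_zero]
  exact pow_eq_zero_iff (by norm_num) |>.1 h2

end Sturm

/-- Reduction of `SL(2, ℤ)` modulo `N`. -/
abbrev redSL (N : ℕ) : SL(2, ℤ) →* SpecialLinearGroup (Fin 2) (ZMod N) :=
  SpecialLinearGroup.map (Int.castRingHom (ZMod N))

theorem redSL_eq_iff {N : ℕ} {γ γ' : SL(2, ℤ)} :
    redSL N γ = redSL N γ' ↔ ∀ i j, ((γ i j : ℤ) : ZMod N) = (γ' i j : ℤ) := by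
  refine ⟨fun h i j => ?_, fun h => ?_⟩
  · have := congr_arg (fun g : SpecialLinearGroup (Fin 2) (ZMod N) => g i j) h
    simpa using this
  · ext i j
    simpa using h i j

section Norm

variable {O : ValuationSubring ℂ}

theorem redSeries_sum_powersetCard {Q : Type*} [Fintype Q] [DecidableEq Q] (y : Q → O⟦X⟧)
    (S : Finset Q) (hS : ∀ q, q ∈ S ↔ redSeries O (y q) ≠ 0) :
    redSeries O (∑ s ∈ Finset.powersetCard S.card Finset.univ, ∏ q ∈ s, y q) =
      ∏ q ∈ S, redSeries O (y q) := by
  rw [map_sum, Finset.sum_eq_single S]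
  · rw [map_prod]
  · intro s hs hne
    rw [map_prod]
    rw [Finset.mem_powersetCard] at hs
    obtain ⟨q, hq, hqS⟩ : ∃ q ∈ s, q ∉ S := by
      by_contra! h
      exact hne (Finset.eq_of_subset_of_card_le h hs.2.ge)
    exact Finset.prod_eq_zero hq (by simpa using mt (hS q).2 hqS)
  · intro h
    simp [Finset.mem_powersetCard] at h

/-- Sturm's bound for families permuted by `SL(2, ℤ)`. -/
theorem redSeries_eq_zero_of_family (h6 : (1728 : ℂ)⁻¹ ∈ O) {R a w : ℕ} (hR : 0 < R)
    (haw : R * w < 12 * a) (Y : SL(2, ℤ) → ℍ → ℂ)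
    (hY : ∀ γ (δ : SL(2, ℤ)) τ, Y γ (δ • τ) = autFactor δ τ ^ w * Y (γ * δ) τ)
    (hYR : ∀ γ γ', redSL R γ = redSL R γ' → Y γ = Y γ')
    (hq : ∀ γ, ∃ y : O⟦X⟧, HasQInt O R (Y γ) y ∧ (redSeries O y = 0 ∨ X ^ a ∣ redSeries O y))
    (γ : SL(2, ℤ)) {y : O⟦X⟧} (hy : HasQInt O R (Y γ) y) : redSeries O y = 0 := by
  classical
  have : NeZero R := ⟨hR.ne'⟩
  choose y' hy' hdvd using hq
  let π := redSL R
  have : Fintype π.range := Fintype.ofFinite _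
  have hsurj := π.rangeRestrict_surjective
  let rep : π.range → SL(2, ℤ) := surjInv hsurj
  have hrep : ∀ q, π (rep q) = q := fun q => congr_arg Subtype.val (surjInv_eq hsurj q)
  let S : Finset π.range := {q | redSeries O (y' (rep q)) ≠ 0}
  have hS : ∀ q, q ∈ S ↔ redSeries O (y' (rep q)) ≠ 0 := fun q => by simp [S]
  have hmem : S = ∅ := by
    by_contra hne
    have hr : 0 < S.card := Finset.card_pos.2 (Finset.nonempty_iff_ne_empty.2 hne)
    have hE := HasQInt.sum (Finset.powersetCard S.card Finset.univ)
      (fun s _ => HasQInt.prod s fun q _ => hy' (rep q))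
    have hred := redSeries_sum_powersetCard (fun q => y' (rep q)) S hS
    have h0 := redSeries_eq_zero_of_X_pow_dvd h6 (a := a * S.card) (W := w * S.card) hR
      (by nlinarith) (fun δ τ => ?_) hE ?_
    · rw [hred, Finset.prod_eq_zero_iff] at h0
      obtain ⟨q, hq, h⟩ := h0
      exact (hS q).1 hq h
    · let e : π.range ≃ π.range := Equiv.mulRight (π.rangeRestrict δ)
      have he : ∀ q, Y (rep q) (δ • τ) = autFactor δ τ ^ w * Y (rep (e q)) τ := fun q => by
        rw [hY, hYR (rep q * δ) (rep (e q))]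
        rw [map_mul]
        exact ((congr_arg (· * π δ) (hrep q)).trans (hrep (e q)).symm)
      have hprod : ∀ s ∈ Finset.powersetCard S.card Finset.univ,
          ∏ q ∈ s, Y (rep q) (δ • τ) =
            autFactor δ τ ^ (w * S.card) * ∏ q ∈ s.map e.toEmbedding, Y (rep q) τ := fun s hs => by
        rw [Finset.prod_map, Finset.prod_congr rfl fun q _ => he q, Finset.prod_mul_distrib,
          Finset.prod_const, (Finset.mem_powersetCard.1 hs).2, pow_mul]
        rfl
      rw [Finset.sum_congr rfl hprod, ← Finset.mul_sum]
      congr 1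
      conv_rhs => rw [← Finset.map_univ_equiv e, Finset.powersetCard_map, Finset.sum_map]
      rfl
    · rw [hred, pow_mul]
      rw [← Finset.prod_const]
      exact Finset.prod_dvd_prod_of_dvd _ _ fun q hq => (hdvd _).resolve_left ((hS q).1 hq)
  have hγ : π.rangeRestrict γ ∉ S := by simp [hmem]
  rw [hS, not_not] at hγ
  rw [hYR γ (rep (π.rangeRestrict γ)) (hrep (π.rangeRestrict γ)).symm] at hy
  rwa [HasQInt.unique hR hy (hy' _)]

end Norm

section Hecke

/-- The map `τ ↦ rτ + s` on the upper half plane. -/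
def affineMap (r : ℝ) (hr : 0 < r) (s : ℝ) (τ : ℍ) : ℍ :=
  ⟨r * τ + s, by simpa using mul_pos hr τ.im_pos⟩

/-- The data describing `τ ↦ ℓ (γ τ)` as `γ' ∘ σ` with `σ` affine. -/
structure HeckeDatum (M ℓ : ℕ) (hℓ : 0 < ℓ) (γ γ' : SL(2, ℤ)) (σ : ℍ → ℍ) (ε v : ℂ) (e : ℕ) :
    Prop where
  smul : ∀ τ, affineMap ℓ (by exact_mod_cast hℓ) 0 (γ • τ) = γ' • σ τ
  aut : ∀ τ, autFactor γ τ = ε * autFactor γ' (σ τ)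
  qParam : ∀ τ, Periodic.qParam M (σ τ) = v * Periodic.qParam (M * ℓ : ℕ) τ ^ e

theorem qParam_affine {M ℓ : ℕ} (hM : 0 < M) (hℓ : 0 < ℓ) (τ : ℍ) :
    Periodic.qParam M (affineMap ℓ (by exact_mod_cast hℓ) 0 τ) =
      Periodic.qParam (M * ℓ : ℕ) τ ^ ℓ ^ 2 := by
  rw [Periodic.qParam, Periodic.qParam, ← Complex.exp_nat_mul]
  congr 1
  have : (M : ℂ) ≠ 0 := by exact_mod_cast hM.ne'
  have : (ℓ : ℂ) ≠ 0 := by exact_mod_cast hℓ.ne'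
  simp [affineMap]
  field_simp

theorem qParam_affine_inv {M ℓ : ℕ} (hM : 0 < M) (hℓ : 0 < ℓ) (j : ℤ) (τ : ℍ) :
    Periodic.qParam M (affineMap (ℓ : ℝ)⁻¹ (by positivity) (j / ℓ) τ) =
      Complex.exp (2 * Real.pi * Complex.I * j / (M * ℓ : ℕ)) * Periodic.qParam (M * ℓ : ℕ) τ ^ 1 := by
  rw [Periodic.qParam, Periodic.qParam, pow_one, ← Complex.exp_add]
  congr 1
  have : (M : ℂ) ≠ 0 := by exact_mod_cast hM.ne'
  have : (ℓ : ℂ) ≠ 0 := by exact_mod_cast hℓ.ne'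
  simp [affineMap]
  field_simp
  ring

theorem heckeDatum_of_dvd {M ℓ : ℕ} (hM : 0 < M) (hℓ : 0 < ℓ) (hℓM : (ℓ : ZMod M) = 1)
    (γ : SL(2, ℤ)) (h : (ℓ : ℤ) ∣ γ 1 0) : ∃ γ' : SL(2, ℤ), redSL M γ' = redSL M γ ∧
      HeckeDatum M ℓ hℓ γ γ' (affineMap ℓ (by exact_mod_cast hℓ) 0) 1 1 (ℓ ^ 2) := by
  obtain ⟨c, hc⟩ := h
  have hdet := γ.det_coe
  rw [det_fin_two, hc] at hdet
  let γ' : SL(2, ℤ) := ⟨!![γ 0 0, ℓ * γ 0 1; c, γ 1 1], by rw [det_fin_two_of]; linarith⟩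
  have haut : ∀ τ, autFactor γ τ =
      autFactor γ' (affineMap ℓ (by exact_mod_cast hℓ) 0 τ) := fun τ => by
    simp only [autFactor, hc]
    simp [γ', affineMap]
    ring
  refine ⟨γ', redSL_eq_iff.2 ?_, ⟨fun τ => ?_, fun τ => ?_, fun τ => ?_⟩⟩
  · simp [Fin.forall_fin_two, γ', hc, hℓM]
  · ext
    rw [coe_smul_eq, ← haut]
    simp only [affineMap]
    rw [coe_mk, coe_mk, coe_smul_eq]
    have := autFactor_ne_zero γ τ
    simp [γ']
    field_simp
  · rw [one_mul, haut]
  · rw [one_mul, qParam_affine hM hℓ]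

theorem heckeDatum_of_dvd_sub {M ℓ : ℕ} (hM : 0 < M) (hℓ : 0 < ℓ)
    {γ γ' : SL(2, ℤ)} {j : ℤ} (h00 : γ' 0 0 = ℓ * γ 0 0) (h01 : γ' 0 1 = γ 0 1 - γ 0 0 * j)
    (h10 : γ' 1 0 = γ 1 0) (h11 : ℓ * γ' 1 1 = γ 1 1 - γ 1 0 * j) :
    HeckeDatum M ℓ hℓ γ γ' (affineMap (ℓ : ℝ)⁻¹ (by positivity) (j / ℓ)) ℓ
      (Complex.exp (2 * Real.pi * Complex.I * j / (M * ℓ : ℕ))) 1 := by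
  have hℓ' : (ℓ : ℂ) ≠ 0 := by exact_mod_cast hℓ.ne'
  have h11' : (ℓ : ℂ) * γ' 1 1 = γ 1 1 - γ 1 0 * j := by exact_mod_cast h11
  have haut : ∀ τ, autFactor γ τ =
      ℓ * autFactor γ' (affineMap (ℓ : ℝ)⁻¹ (by positivity) (j / ℓ) τ) := fun τ => by
    simp only [autFactor, h10]
    rw [mul_add, h11']
    simp [affineMap]
    field_simp
    ring
  refine ⟨fun τ => ?_, haut, qParam_affine_inv hM hℓ j⟩
  have h1 := autFactor_ne_zero γ τ
  have h2 := autFactor_ne_zero γ' (affineMap (ℓ : ℝ)⁻¹ (by positivity) (j / ℓ) τ)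
  ext
  rw [coe_smul_eq, affineMap, coe_mk, coe_smul_eq, haut, h00, h01]
  simp only [affineMap, coe_mk] at h2 ⊢
  push_cast
  field_simp
  ring

theorem exists_heckeDatum_of_not_dvd {M ℓ : ℕ} (hM : 0 < M) (hℓ : ℓ.Prime)
    (γ : SL(2, ℤ)) (h : ¬ (ℓ : ℤ) ∣ γ 1 0) : ∃ (γ' : SL(2, ℤ)) (j : ℤ) ,
      HeckeDatum M ℓ hℓ.pos γ γ'
        (affineMap (ℓ : ℝ)⁻¹ (by have := hℓ.pos; positivity) (j / ℓ)) ℓ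
        (Complex.exp (2 * Real.pi * Complex.I * j / (M * ℓ : ℕ))) 1 := by
  have hcop : IsCoprime (ℓ : ℤ) (γ 1 0) :=
    (Nat.prime_iff_prime_int.1 hℓ).coprime_iff_not_dvd.2 h
  obtain ⟨x, y, hxy⟩ := hcop
  have hdet := γ.det_coe
  rw [det_fin_two] at hdet
  have h11 : (ℓ : ℤ) * (x * γ 1 1) = γ 1 1 - γ 1 0 * (y * γ 1 1) := by
    linear_combination (γ 1 1) * hxy
  refine ⟨⟨!![ℓ * γ 0 0, γ 0 1 - γ 0 0 * (y * γ 1 1); γ 1 0, x * γ 1 1], ?_⟩, y * γ 1 1,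
    heckeDatum_of_dvd_sub hM hℓ.pos rfl rfl rfl h11⟩
  rw [det_fin_two_of]
  linear_combination hdet + γ 0 0 * h11

end Hecke

theorem qParam_eq_pow {A B : ℕ} (hA : 0 < A) (hB : 0 < B) (z : ℂ) :
    Periodic.qParam A z = Periodic.qParam (A * B : ℕ) z ^ B := by
  rw [Periodic.qParam, Periodic.qParam, ← Complex.exp_nat_mul]
  congr 1
  have : (A : ℂ) ≠ 0 := by exact_mod_cast hA.ne'
  have : (B : ℂ) ≠ 0 := by exact_mod_cast hB.ne'
  push_cast
  field_simp

theorem coe_unit_zpow {O : ValuationSubring ℂ} (u : Oˣ) (k : ℤ) :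
    ((u ^ k : Oˣ) : ℂ) = (u : ℂ) ^ k := by
  have := congr_arg Units.val (map_zpow (Units.map (O.subtype : O →* ℂ)) u k)
  rw [Units.val_zpow_eq_zpow_val] at this
  exact this

theorem coe_unit_ne_zero {O : ValuationSubring ℂ} (u : Oˣ) : ((u : O) : ℂ) ≠ 0 := by
  have := (Units.map (O.subtype : O →* ℂ) u).ne_zero
  exact this

theorem redSeries_expand_rescale_ne_zero {O : ValuationSubring ℂ} {a : ℕ} (ha : a ≠ 0) (u : Oˣ)
    {φ : O⟦X⟧} (h : redSeries O φ ≠ 0) : redSeries O (expand a ha (rescale (u : O) φ)) ≠ 0 := by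
  contrapose! h
  ext m
  have := congr_arg (coeff (a * m)) h
  rw [coeff_map, coeff_expand_mul, coeff_rescale, map_mul, map_zero, map_pow] at this
  rw [coeff_map, map_zero]
  exact (mul_eq_zero.1 this).resolve_left
    (pow_ne_zero _ ((u.isUnit.map (IsLocalRing.residue O)).ne_zero))

section Hecke

variable {O : ValuationSubring ℂ} {M ℓ : ℕ} {hℓ : 0 < ℓ} {γ γ' : SL(2, ℤ)} {σ : ℍ → ℍ} {ε v : Oˣ}
  {e : ℕ}

/-- The quotient `Δ(τ)^ℓ / Δ(ℓτ)`. -/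
def deltaQuotient (ℓ : ℕ) (hℓ : 0 < ℓ) (τ : ℍ) : ℂ :=
  ModularForm.discriminant τ ^ ℓ /
    ModularForm.discriminant (affineMap ℓ (by exact_mod_cast hℓ) 0 τ)

theorem HeckeDatum.deltaQuotient_smul (hM : 0 < M) (h : HeckeDatum M ℓ hℓ γ γ' σ ε v e) {t : ℕ}
    (ht : M * ℓ * ℓ = e * M + t) (τ : ℍ) :
    deltaQuotient ℓ hℓ (γ • τ) = autFactor γ τ ^ (12 * (ℓ - 1)) *
      (((ε ^ 12 * v⁻¹ ^ M : Oˣ) : ℂ) * Periodic.qParam (M * ℓ : ℕ) τ ^ t *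
        reducedDelta τ ^ ℓ * (reducedDelta (σ τ))⁻¹) := by
  obtain ⟨L, rfl⟩ : ∃ L, ℓ = L + 1 := ⟨ℓ - 1, by omega⟩
  have hε := coe_unit_ne_zero ε
  have hv := coe_unit_ne_zero v
  have hγ := autFactor_ne_zero γ' (σ τ)
  have hD : reducedDelta (σ τ) ≠ 0 :=
    div_ne_zero (ModularForm.discriminant_ne_zero _) (Periodic.qParam_ne_zero _)
  have hq : Periodic.qParam (M * (L + 1) : ℕ) τ ≠ 0 := Periodic.qParam_ne_zero _
  have h1 : Periodic.qParam 1 τ = Periodic.qParam (M * (L + 1) : ℕ) τ ^ (M * (L + 1)) := by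
    have := qParam_eq_pow (A := 1) (B := M * (L + 1)) one_pos (by positivity) τ
    rwa [one_mul, Nat.cast_one] at this
  have h2 : Periodic.qParam 1 (σ τ) = (v * Periodic.qParam (M * (L + 1) : ℕ) τ ^ e) ^ M := by
    have := qParam_eq_pow (A := 1) (B := M) one_pos hM (σ τ)
    rwa [one_mul, Nat.cast_one, h.qParam] at this
  have h3 : ((v⁻¹ : Oˣ) : ℂ) = (v : ℂ)⁻¹ := by simpa using coe_unit_zpow v (-1)
  rw [deltaQuotient, h.smul, discriminant_smul, discriminant_smul, h.aut, discriminant_eq_qParam_mul τ,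
    discriminant_eq_qParam_mul (σ τ), h1, h2]
  generalize Periodic.qParam (M * (L + 1) : ℕ) τ = q at *
  have h4 : (q ^ (M * (L + 1))) ^ (L + 1) = (q ^ e) ^ M * q ^ t := by
    rw [← pow_mul, ← pow_mul, ← pow_add, ht]
  simp only [mul_pow, Units.val_mul, Units.val_pow_eq_pow_val, MulMemClass.coe_mul,
    SubmonoidClass.coe_pow, h3, Nat.add_sub_cancel]
  rw [h4, _root_.inv_pow]
  field_simp
  ring

theorem HeckeDatum.sub_smul (h : HeckeDatum M ℓ hℓ γ γ' σ ε v e) {k k' : ℤ}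
    {F G K : SL(2, ℤ) → ℍ → ℂ} {P : ℂ}
    (hF : ∀ γ (δ : SL(2, ℤ)) τ, F γ (δ • τ) = autFactor δ τ ^ k * F (γ * δ) τ)
    (hG : ∀ γ (δ : SL(2, ℤ)) τ, G γ (δ • τ) = autFactor δ τ ^ k' * G (γ * δ) τ)
    (hGF : ∀ γ τ, G γ τ = F γ τ + P * K γ τ) (τ : ℍ) :
    F 1 (affineMap ℓ (by exact_mod_cast hℓ) 0 (γ • τ)) * G 1 (γ • τ) -
      G 1 (affineMap ℓ (by exact_mod_cast hℓ) 0 (γ • τ)) * F 1 (γ • τ) =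
      autFactor γ τ ^ (k + k') * (((ε : ℂ) ^ (-k) - (ε : ℂ) ^ (-k')) * (F γ' (σ τ) * F γ τ) +
        P * ((ε : ℂ) ^ (-k) * (F γ' (σ τ) * K γ τ) - (ε : ℂ) ^ (-k') * (K γ' (σ τ) * F γ τ))) := by
  have hε := coe_unit_ne_zero ε
  have hγ := autFactor_ne_zero γ τ
  have h1 : autFactor γ' (σ τ) = autFactor γ τ * (ε : ℂ)⁻¹ := by
    rw [h.aut]
    field_simp
  simp only [h.smul, hF, hG, one_mul, h1, mul_zpow, _root_.inv_zpow', hGF, zpow_add₀ hγ]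
  ring

/-- The integral expansion of the function built from a congruence `G = F + P K`. -/
theorem HeckeDatum.exists_hasQInt (h6 : (1728 : ℂ)⁻¹ ∈ O) (hM : 0 < M) (he : e ≠ 0)
    (h : HeckeDatum M ℓ hℓ γ γ' σ ε v e) {t : ℕ}
    (b : ℕ) (i j : Oˣ) (θ π : O)
    {F K : SL(2, ℤ) → ℍ → ℂ} {φ κ : SL(2, ℤ) → O⟦X⟧} (hφ : ∀ γ, HasQInt O M (F γ) (φ γ))
    (hκ : ∀ γ, HasQInt O M (K γ) (κ γ)) (hπ : IsLocalRing.residue O π = 0) (x : Oˣ) :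
    ∃ y U : O⟦X⟧, IsUnit U ∧ HasQInt O (M * ℓ) (fun τ =>
      ((θ : ℂ) * (F γ' (σ τ) * F γ τ) +
        π * ((i : ℂ) * (F γ' (σ τ) * K γ τ) - (j : ℂ) * (K γ' (σ τ) * F γ τ))) *
      ((x : ℂ) * Periodic.qParam (M * ℓ : ℕ) τ ^ t *
        reducedDelta τ ^ ℓ * (reducedDelta (σ τ))⁻¹) ^ b) y ∧
      redSeries O y = C (IsLocalRing.residue O θ) *
        (redSeries O (expand e he (rescale (v : O) (φ γ'))) *
          redSeries O (expand ℓ hℓ.ne' (rescale ((1 : Oˣ) : O) (φ γ)))) *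
        (X ^ (t * b) * redSeries O U) := by
  obtain ⟨δ, δ', hδ, hδ', hδδ⟩ := exists_hasQInt_reducedDelta h6
  have hid : ∀ τ : ℍ, Periodic.qParam M (id τ) =
      ((1 : Oˣ) : O) * Periodic.qParam (M * ℓ : ℕ) τ ^ ℓ := fun τ => by
    simpa using qParam_eq_pow hM hℓ τ
  have hR : M * ℓ ≠ 0 := by positivity
  have hid1 : ∀ τ : ℍ, Periodic.qParam (1 : ℕ) (id τ) =
      ((1 : Oˣ) : O) * Periodic.qParam (M * ℓ : ℕ) τ ^ (M * ℓ) := fun τ => by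
    simpa using qParam_eq_pow (A := 1) (B := M * ℓ) one_pos (by positivity) τ
  have hσ1 : ∀ τ : ℍ, Periodic.qParam (1 : ℕ) (σ τ) =
      ((v ^ M : Oˣ) : O) * Periodic.qParam (M * ℓ : ℕ) τ ^ (e * M) := fun τ => by
    have := qParam_eq_pow (A := 1) (B := M) one_pos hM (σ τ)
    rw [one_mul, h.qParam, mul_pow, ← pow_mul] at this
    simpa using this
  have hF' := fun γ => (hφ γ).comp he σ h.qParam
  have hK' := fun γ => (hκ γ).comp he σ h.qParam
  have hF := fun γ => (hφ γ).comp hℓ.ne' id hid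
  have hK := fun γ => (hκ γ).comp hℓ.ne' id hid
  have hD := hδ.comp hR id hid1
  have hD' := hδ'.comp (mul_ne_zero he hM.ne') σ hσ1
  have hδu : IsUnit δ := IsUnit.of_mul_eq_one _ hδδ
  have hδu' : IsUnit δ' := IsUnit.of_mul_eq_one_right _ hδδ
  have key := (((HasQInt.const (M * ℓ) θ).mul ((hF' γ').mul (hF γ))).add
    ((HasQInt.const (M * ℓ) π).mul
      (((HasQInt.const (M * ℓ) (i : O)).mul ((hF' γ').mul (hK γ))).sub
        ((HasQInt.const (M * ℓ) (j : O)).mul ((hK' γ').mul (hF γ)))))).mul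
    (((((HasQInt.const (M * ℓ) (x : O)).mul (HasQInt.qParam_pow O (M * ℓ) t)).mul
      (hD.pow ℓ)).mul hD').pow b)
  refine ⟨_, (C (x : O) * expand (M * ℓ) hR (rescale ((1 : Oˣ) : O) δ) ^ ℓ *
    expand (e * M) (mul_ne_zero he hM.ne') (rescale ((v ^ M : Oˣ) : O) δ')) ^ b, ?_, key, ?_⟩
  · exact (((x.isUnit.map C).mul (((hδu.map (rescale _)).map (expand _ hR)).pow ℓ)).mul
      ((hδu'.map (rescale _)).map (expand _ _))).pow b
  · simp only [map_mul, map_add, map_pow, redSeries, map_C, hπ, map_X, map_zero, zero_mul, add_zero]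
    ring

end Hecke

section ValuationSubring

variable {O : ValuationSubring ℂ}

theorem exists_unit_of_mem {x : ℂ} (hx : x ∈ O) (hx' : x⁻¹ ∈ O) (h0 : x ≠ 0) :
    ∃ u : Oˣ, (u : ℂ) = x :=
  ⟨⟨⟨x, hx⟩, ⟨x⁻¹, hx'⟩, Subtype.ext (mul_inv_cancel₀ h0), Subtype.ext (inv_mul_cancel₀ h0)⟩, rfl⟩

theorem mem_of_pow_eq_one {x : ℂ} {m : ℕ} (hm : 0 < m) (hx : x ^ m = 1) : x ∈ O := by
  rcases O.mem_or_inv_mem x with h | h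
  · exact h
  · have h0 : x ≠ 0 := by
      rintro rfl
      simp [hm.ne'] at hx
    have : x = x⁻¹ ^ (m - 1) := by
      obtain ⟨i, rfl⟩ : ∃ i, m = i + 1 := ⟨m - 1, by omega⟩
      rw [Nat.add_sub_cancel, _root_.inv_pow]
      exact eq_inv_of_mul_eq_one_left (by rwa [pow_succ'] at hx)
    rw [this]
    exact pow_mem h _

theorem exists_unit_of_pow_eq_one {x : ℂ} {m : ℕ} (hm : 0 < m) (hx : x ^ m = 1) :
    ∃ u : Oˣ, (u : ℂ) = x :=
  exists_unit_of_mem (mem_of_pow_eq_one hm hx)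
    (mem_of_pow_eq_one hm (by rw [_root_.inv_pow, hx, inv_one]))
    (by rintro rfl; simp [hm.ne'] at hx)

theorem exp_root_pow_eq_one {R : ℕ} (hR : 0 < R) (j : ℤ) :
    Complex.exp (2 * Real.pi * Complex.I * j / R) ^ R = 1 := by
  rw [← Complex.exp_nat_mul, Complex.exp_eq_one_iff]
  refine ⟨j, ?_⟩
  have : (R : ℂ) ≠ 0 := by exact_mod_cast hR.ne'
  field_simp

theorem exists_residue_eq_zero {P : O} (hP : P ≠ 0) {c : ℂ} (h : ∀ x : O, c ≠ P * x) :
    c ≠ 0 ∧ ∃ π : O, (π : ℂ) * c = P ∧ IsLocalRing.residue O π = 0 := by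
  have hP' : (P : ℂ) ≠ 0 := by simpa using hP
  have hc : c ≠ 0 := by simpa using h 0
  refine ⟨hc, ?_⟩
  rcases O.mem_or_inv_mem (P / c) with hm | hm
  · refine ⟨⟨_, hm⟩, div_mul_cancel₀ _ hc, ?_⟩
    by_contra hne
    obtain ⟨u, hu⟩ := (IsLocalRing.residue_ne_zero_iff_isUnit _).1 hne
    have h1 : ((u⁻¹ : Oˣ) : ℂ) = ((u : O) : ℂ)⁻¹ := by simpa using coe_unit_zpow u (-1)
    refine h (u⁻¹ : Oˣ) ?_
    rw [h1, hu]
    field_simp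
  · refine absurd ?_ (h ⟨_, hm⟩)
    simp only
    field_simp

end ValuationSubring

section LevelCongruence

variable {O : ValuationSubring ℂ} {M ℓ : ℕ}

/-- The function `(F(ℓτ) G(τ) - G(ℓτ) F(τ)) / c` times a power of `Δ(τ)^ℓ / Δ(ℓτ)`. -/
def heckeFun (ℓ : ℕ) (hℓ : 0 < ℓ) (F G : ℍ → ℂ) (c : ℂ) (b : ℕ) (τ : ℍ) : ℂ :=
  (F (affineMap ℓ (by exact_mod_cast hℓ) 0 τ) * G τ -
    G (affineMap ℓ (by exact_mod_cast hℓ) 0 τ) * F τ) / c * deltaQuotient ℓ hℓ τ ^ b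

theorem HeckeDatum.heckeFun_smul {hℓ : 0 < ℓ} {γ γ' : SL(2, ℤ)} {σ : ℍ → ℍ} {ε v : Oˣ}
    {e : ℕ} (hM : 0 < M) (h : HeckeDatum M ℓ hℓ γ γ' σ ε v e) {t : ℕ}
    (ht : M * ℓ * ℓ = e * M + t) {k k' : ℤ}
    {F G K : SL(2, ℤ) → ℍ → ℂ} {P c : ℂ} (hc : c ≠ 0)
    (hF : ∀ γ (δ : SL(2, ℤ)) τ, F γ (δ • τ) = autFactor δ τ ^ k * F (γ * δ) τ)
    (hG : ∀ γ (δ : SL(2, ℤ)) τ, G γ (δ • τ) = autFactor δ τ ^ k' * G (γ * δ) τ)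
    (hGF : ∀ γ τ, G γ τ = F γ τ + P * K γ τ) {b w : ℕ}
    (hw : (w : ℤ) = k + k' + 12 * (ℓ - 1 : ℕ) * b) {θ π : O}
    (hθ : (θ : ℂ) * c = (ε : ℂ) ^ (-k) - (ε : ℂ) ^ (-k')) (hπ : (π : ℂ) * c = P) (τ : ℍ) :
    (autFactor γ τ ^ w)⁻¹ * heckeFun ℓ hℓ (F 1) (G 1) c b (γ • τ) =
      ((θ : ℂ) * (F γ' (σ τ) * F γ τ) +
        π * (((ε ^ (-k) : Oˣ) : ℂ) * (F γ' (σ τ) * K γ τ) -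
          ((ε ^ (-k') : Oˣ) : ℂ) * (K γ' (σ τ) * F γ τ))) *
      (((ε ^ 12 * v⁻¹ ^ M : Oˣ) : ℂ) * Periodic.qParam (M * ℓ : ℕ) τ ^ t *
        reducedDelta τ ^ ℓ * (reducedDelta (σ τ))⁻¹) ^ b := by
  have hγ := autFactor_ne_zero γ τ
  have h1 : autFactor γ τ ^ w =
      autFactor γ τ ^ (k + k') * (autFactor γ τ ^ (12 * (ℓ - 1))) ^ b := by
    rw [← pow_mul, ← zpow_natCast, ← zpow_natCast, ← zpow_add₀ hγ, hw]
    push_cast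
    rfl
  rw [heckeFun, h.sub_smul hF hG hGF, h.deltaQuotient_smul hM ht, h1, ← hθ, ← hπ,
    coe_unit_zpow, coe_unit_zpow, mul_pow (autFactor γ τ ^ (12 * (ℓ - 1)))]
  have h2 := zpow_ne_zero (k + k') hγ
  have h3 := pow_ne_zero b (pow_ne_zero (12 * (ℓ - 1)) hγ)
  field_simp

theorem level_congruence (h6 : (1728 : ℂ)⁻¹ ∈ O) (hM : 0 < M) (hℓ : ℓ.Prime)
    (hℓM : (ℓ : ZMod M) = 1) (hℓO : (ℓ : ℂ)⁻¹ ∈ O) {k k' : ℤ} {P : O} (hP : P ≠ 0)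
    {F G K : SL(2, ℤ) → ℍ → ℂ} {φ κ : SL(2, ℤ) → O⟦X⟧}
    (hF : ∀ γ (δ : SL(2, ℤ)) τ, F γ (δ • τ) = autFactor δ τ ^ k * F (γ * δ) τ)
    (hG : ∀ γ (δ : SL(2, ℤ)) τ, G γ (δ • τ) = autFactor δ τ ^ k' * G (γ * δ) τ)
    (hFM : ∀ γ γ', redSL M γ = redSL M γ' → F γ = F γ')
    (hKM : ∀ γ γ', redSL M γ = redSL M γ' → K γ = K γ')
    (hGF : ∀ γ τ, G γ τ = F γ τ + P * K γ τ)
    (hφ : ∀ γ, HasQInt O M (F γ) (φ γ)) (hκ : ∀ γ, HasQInt O M (K γ) (κ γ))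
    (hS : redSeries O (φ ModularGroup.S) ≠ 0) :
    ∃ x : O, (ℓ : ℂ) ^ (-k) - (ℓ : ℂ) ^ (-k') = P * x := by
  by_contra! hne
  obtain ⟨hc, π, hπ, hπ0⟩ := exists_residue_eq_zero hP hne
  set c := (ℓ : ℂ) ^ (-k) - (ℓ : ℂ) ^ (-k')
  obtain ⟨ε, hε⟩ := exists_unit_of_mem (natCast_mem O ℓ) hℓO (by exact_mod_cast hℓ.ne_zero)
  have hℓ2 := hℓ.two_le
  set b := k.natAbs + k'.natAbs + 1 with hb
  have hR : 0 < M * ℓ := Nat.mul_pos hM hℓ.pos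
  obtain ⟨w, hw⟩ : ∃ w : ℕ, (w : ℤ) = k + k' + 12 * (ℓ - 1 : ℕ) * b := by
    refine ⟨(k + k' + 12 * (ℓ - 1 : ℕ) * b).toNat, Int.toNat_of_nonneg ?_⟩
    have h1 : (1 : ℤ) ≤ (ℓ - 1 : ℕ) := by omega
    have h2 : -(k + k') ≤ b := by omega
    nlinarith
  obtain ⟨t, ht⟩ : ∃ t, M * ℓ * ℓ = 1 * M + t :=
    Nat.exists_eq_add_of_le (by nlinarith [Nat.mul_le_mul hℓ2 hℓ2])
  have ht0 : M * ℓ * ℓ = ℓ ^ 2 * M + 0 := by ring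
  let Y : SL(2, ℤ) → ℍ → ℂ := fun γ τ =>
    (autFactor γ τ ^ w)⁻¹ * heckeFun ℓ hℓ.pos (F 1) (G 1) c b (γ • τ)
  have hdvd : ∀ γ : SL(2, ℤ), (ℓ : ℤ) ∣ γ 1 0 → ∃ γ' : SL(2, ℤ), redSL M γ' = redSL M γ ∧
      HeckeDatum M ℓ hℓ.pos γ γ' (affineMap ℓ (by exact_mod_cast hℓ.pos) 0)
        ((1 : Oˣ) : O) ((1 : Oˣ) : O) (ℓ ^ 2) := fun γ hγ => by
    simpa using heckeDatum_of_dvd hM hℓ.pos hℓM γ hγ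
  have hθ0 : ((0 : O) : ℂ) * c = (((1 : Oˣ) : O) : ℂ) ^ (-k) - (((1 : Oˣ) : O) : ℂ) ^ (-k') := by
    simp
  have hθ1 : ((1 : O) : ℂ) * c = (ε : ℂ) ^ (-k) - (ε : ℂ) ^ (-k') := by
    rw [hε]
    simp [c]
  have hexp : ∀ j : ℤ, ∃ v : Oˣ,
      (v : ℂ) = Complex.exp (2 * Real.pi * Complex.I * j / (M * ℓ : ℕ)) :=
    fun j => exists_unit_of_pow_eq_one hR (exp_root_pow_eq_one hR j)
  have haw : M * ℓ * w < 12 * (t * b) := by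
    zify at ht ⊢
    rw [hw]
    have ht' : (t : ℤ) = M * (ℓ - 1) * (ℓ + 1) := by linear_combination -ht
    have h3 : k + k' < b := by omega
    have h5 : (2 : ℤ) ≤ ℓ := by exact_mod_cast hℓ2
    have h4 : (ℓ : ℤ) * (k + k') < 12 * (ℓ - 1) * b := by
      have : (0 : ℤ) < b := by omega
      nlinarith
    have h6 : (0 : ℤ) < M := by exact_mod_cast hM
    rw [ht', Nat.cast_sub hℓ.one_le]
    push_cast
    nlinarith [mul_lt_mul_of_pos_left h4 h6]
  have hYS : ∃ y, HasQInt O (M * ℓ) (Y ModularGroup.S) y ∧ redSeries O y ≠ 0 := by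
    obtain ⟨v, hv⟩ := hexp 0
    have hd := heckeDatum_of_dvd_sub (γ := ModularGroup.S) (γ' := ModularGroup.S) (j := 0) hM hℓ.pos
      (by simp [ModularGroup.S]) (by simp [ModularGroup.S]) (by simp [ModularGroup.S])
      (by simp [ModularGroup.S])
    rw [← hv, ← hε] at hd
    obtain ⟨y, U, hU, hy, hred⟩ := hd.exists_hasQInt h6 hM one_ne_zero (t := t) b
      (ε ^ (-k)) (ε ^ (-k')) 1 π hφ hκ hπ0 (ε ^ 12 * v⁻¹ ^ M)
    refine ⟨y, ?_, ?_⟩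
    · convert hy using 2 with τ
      exact hd.heckeFun_smul hM ht hc hF hG hGF hw hθ1 hπ τ
    · rw [hred, map_one, map_one, one_mul]
      refine mul_ne_zero (mul_ne_zero (redSeries_expand_rescale_ne_zero _ v hS)
        (redSeries_expand_rescale_ne_zero _ 1 hS)) (mul_ne_zero (pow_ne_zero _ X_ne_zero) ?_)
      exact (hU.map (redSeries O)).ne_zero
  obtain ⟨y, hy, hy0⟩ := hYS
  have hYmul : ∀ γ (δ : SL(2, ℤ)) τ, Y γ (δ • τ) = autFactor δ τ ^ w * Y (γ * δ) τ :=
    fun γ δ τ => by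
    have h1 := autFactor_ne_zero δ τ
    simp only [Y, autFactor_mul, mul_pow, mul_smul]
    field_simp
  have hY1 : ∀ δ : SL(2, ℤ), redSL (M * ℓ) δ = 1 → Y δ = Y 1 := fun δ hδ => by
    rw [← map_one (redSL (M * ℓ)), redSL_eq_iff] at hδ
    have hδM : redSL M δ = redSL M 1 := redSL_eq_iff.2 fun i j => by
      have := congr_arg (ZMod.castHom (Dvd.intro _ rfl : M ∣ M * ℓ) (ZMod M)) (hδ i j)
      simpa using this
    have h10 : (ℓ : ℤ) ∣ δ 1 0 := by
      have : ((δ 1 0 : ℤ) : ZMod (M * ℓ)) = 0 := by simpa using hδ 1 0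
      rw [ZMod.intCast_zmod_eq_zero_iff_dvd] at this
      exact (Int.natCast_dvd_natCast.2 (Dvd.intro_left _ rfl)).trans this
    obtain ⟨γ', hγ', hd⟩ := hdvd δ h10
    obtain ⟨γ'', hγ'', hd'⟩ := hdvd 1 (by simp)
    ext τ
    refine (hd.heckeFun_smul hM ht0 hc hF hG hGF hw hθ0 hπ τ).trans
      (Eq.trans ?_ (hd'.heckeFun_smul hM ht0 hc hF hG hGF hw hθ0 hπ τ).symm)
    rw [hFM δ 1 hδM, hKM δ 1 hδM, hFM γ' γ'' (by rw [hγ', hγ'', hδM]),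
      hKM γ' γ'' (by rw [hγ', hγ'', hδM])]
  refine hy0 (redSeries_eq_zero_of_family h6 hR haw Y hYmul ?_ ?_ ModularGroup.S hy)
  · intro γ γ' hγ
    have hδ := hY1 (γ * γ'⁻¹) (by rw [map_mul, map_inv, hγ, mul_inv_cancel])
    ext τ
    have h1 := hYmul (γ * γ'⁻¹) γ' τ
    have h2 := hYmul 1 γ' τ
    rw [inv_mul_cancel_right, hδ] at h1
    rw [one_mul] at h2
    exact mul_left_cancel₀ (pow_ne_zero w (autFactor_ne_zero γ' τ)) (h1.symm.trans h2)
  · intro γ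
    by_cases hγ : (ℓ : ℤ) ∣ γ 1 0
    · obtain ⟨γ', -, hd⟩ := hdvd γ hγ
      obtain ⟨y, U, -, hy, hred⟩ := hd.exists_hasQInt h6 hM (pow_ne_zero 2 hℓ.ne_zero) (t := 0) b
        (1 ^ (-k)) (1 ^ (-k')) 0 π hφ hκ hπ0 (1 ^ 12 * 1⁻¹ ^ M)
      refine ⟨y, ?_, Or.inl ?_⟩
      · convert hy using 2 with τ
        exact hd.heckeFun_smul hM ht0 hc hF hG hGF hw hθ0 hπ τ
      · rw [hred, map_zero, map_zero, zero_mul, zero_mul]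
    · obtain ⟨γ', j, hd⟩ := exists_heckeDatum_of_not_dvd hM hℓ γ hγ
      obtain ⟨v, hv⟩ := hexp j
      rw [← hv, ← hε] at hd
      obtain ⟨y, U, -, hy, hred⟩ := hd.exists_hasQInt h6 hM one_ne_zero (t := t) b
        (ε ^ (-k)) (ε ^ (-k')) 1 π hφ hκ hπ0 (ε ^ 12 * v⁻¹ ^ M)
      refine ⟨y, ?_, Or.inr ?_⟩
      · convert hy using 2 with τ
        exact hd.heckeFun_smul hM ht hc hF hG hGF hw hθ1 hπ τ
      · rw [hred]
        exact Dvd.dvd.mul_left (Dvd.intro _ rfl) _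

end LevelCongruence

section DoubleSeries

variable {ι : Type*}

/-- The sum of `a` over the elements with first invariant `i` and second invariant `j`. -/
def fiberCoeff {ν m : ι → ℕ} (hfin : ∀ i j, {T | ν T = i ∧ m T = j}.Finite) (a : ι → ℂ)
    (i j : ℕ) : ℂ :=
  ∑ T ∈ (hfin i j).toFinset, a T

theorem hasSum_prod_fiberCoeff {ν m : ι → ℕ} (hfin : ∀ i j, {T | ν T = i ∧ m T = j}.Finite)
    {a : ι → ℂ} {x y s : ℂ} (h : HasSum (fun T => a T * x ^ m T * y ^ ν T) s) :
    HasSum (fun p : ℕ × ℕ => fiberCoeff hfin a p.1 p.2 * x ^ p.2 * y ^ p.1) s := by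
  rw [← (Equiv.sigmaFiberEquiv fun T => (ν T, m T)).hasSum_iff] at h
  refine h.sigma fun p => ?_
  have hsum := (hfin p.1 p.2).toFinset.hasSum fun T => a T * x ^ m T * y ^ ν T
  have hval : ∑ T ∈ (hfin p.1 p.2).toFinset, a T * x ^ m T * y ^ ν T =
      fiberCoeff hfin a p.1 p.2 * x ^ p.2 * y ^ p.1 := by
    unfold fiberCoeff
    rw [Finset.sum_mul, Finset.sum_mul]
    refine Finset.sum_congr rfl fun T hT => ?_
    have hT' : ν T = p.1 ∧ m T = p.2 := by simpa using hT
    rw [hT'.1, hT'.2]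
  rw [hval] at hsum
  have he : ∀ T, (ν T, m T) = p ↔ T ∈ (hfin p.1 p.2).toFinset := fun T => by
    simp [Prod.ext_iff]
  exact (Equiv.subtypeEquivRight he).hasSum_iff.2 hsum

theorem hasSum_fiberCoeff {ν m : ι → ℕ} (hfin : ∀ i j, {T | ν T = i ∧ m T = j}.Finite)
    {a : ι → ℂ} {x y s : ℂ} (hy : y ≠ 0)
    (h : HasSum (fun T => a T * x ^ m T * y ^ ν T) s) :
    (∀ i, Summable fun j => fiberCoeff hfin a i j * x ^ j) ∧
      HasSum (fun i => (∑' j, fiberCoeff hfin a i j * x ^ j) * y ^ i) s := by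
  have h1 := hasSum_prod_fiberCoeff hfin h
  have h2 : ∀ i, Summable fun j => fiberCoeff hfin a i j * x ^ j := fun i => by
    have := h1.summable.prod_factor i
    refine (this.mul_right ((y ^ i)⁻¹)).congr fun j => ?_
    dsimp only
    rw [mul_assoc, mul_inv_cancel₀ (pow_ne_zero i hy), mul_one]
  refine ⟨h2, h1.prod_fiberwise fun i => ?_⟩
  dsimp only
  exact (h2 i).hasSum.mul_right _

/-- The coefficient of `q_1(z)^i` in a double series `∑ a(T) q_M(τ)^{m(T)} q_1(z)^{ν(T)}`. -/
def partialSeries {ν m : ι → ℕ} (hfin : ∀ i j, {T | ν T = i ∧ m T = j}.Finite) (a : ι → ℂ)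
    (M i : ℕ) (τ : ℍ) : ℂ :=
  ∑' j, fiberCoeff hfin a i j * Periodic.qParam M τ ^ j

variable {ν m : ι → ℕ} {hfin : ∀ i j, {T | ν T = i ∧ m T = j}.Finite} {a : ι → ℂ} {M : ℕ}
  {Φ : ℍ → ℍ → ℂ}

theorem hasQSeries_partialSeries
    (h : ∀ τ z : ℍ, HasSum (fun T => a T * Periodic.qParam M τ ^ m T * Periodic.qParam (1 : ℕ) z ^ ν T)
      (Φ τ z)) (i : ℕ) :
    HasQSeries M (partialSeries hfin a M i) (PowerSeries.mk (fiberCoeff hfin a i)) := fun τ => by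
  simp only [coeff_mk]
  exact ((hasSum_fiberCoeff hfin (Periodic.qParam_ne_zero _) (h τ UpperHalfPlane.I)).1 i).hasSum

theorem hasQSeries_of_double_hasSum
    (h : ∀ τ z : ℍ, HasSum (fun T => a T * Periodic.qParam M τ ^ m T * Periodic.qParam (1 : ℕ) z ^ ν T)
      (Φ τ z)) (τ : ℍ) :
    HasQSeries 1 (Φ τ) (PowerSeries.mk fun i => partialSeries hfin a M i τ) := fun z => by
  simpa using! (hasSum_fiberCoeff hfin (Periodic.qParam_ne_zero _) (h τ z)).2

theorem partialSeries_eq_of_forall {m' : ι → ℕ} {hfin' : ∀ i j, {T | ν T = i ∧ m' T = j}.Finite}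
    {a' : ι → ℂ} {Φ' : ℍ → ℍ → ℂ}
    (h : ∀ τ z : ℍ, HasSum (fun T => a T * Periodic.qParam M τ ^ m T * Periodic.qParam (1 : ℕ) z ^ ν T)
      (Φ τ z))
    (h' : ∀ τ z : ℍ,
      HasSum (fun T => a' T * Periodic.qParam M τ ^ m' T * Periodic.qParam (1 : ℕ) z ^ ν T) (Φ' τ z))
    {c : ℂ} {τ τ' : ℍ} (hc : ∀ z, Φ τ z = c * Φ' τ' z) (i : ℕ) :
    partialSeries hfin a M i τ = c * partialSeries hfin' a' M i τ' := by
  have h1 := hasQSeries_of_double_hasSum (hfin := hfin) h τ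
  have h2 := (HasQSeries.const 1 c).mul (hasQSeries_of_double_hasSum (hfin := hfin') h' τ')
  have h3 : Φ τ = (fun _ => c) * Φ' τ' := funext hc
  rw [← h3] at h2
  simpa using congr_arg (coeff i) (HasQSeries.unique one_pos h1 h2)

end DoubleSeries

section SymplecticInvariance

variable {n : ℕ} {k : ℤ}

theorem matActS_fromBlocks_eq {A B C D : Matrix (Fin n) (Fin n) ℤ} {Z W : Matrix (Fin n) (Fin n) ℂ}
    (hdet : (C.map (fun a => (a : ℂ)) * Z + D.map (fun a => (a : ℂ))).det ≠ 0)
    (h : A.map (fun a => (a : ℂ)) * Z + B.map (fun a => (a : ℂ)) =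
      W * (C.map (fun a => (a : ℂ)) * Z + D.map (fun a => (a : ℂ)))) :
    matActS (fromBlocks A B C D) Z = W := by
  unfold matActS
  simp only [fromBlocks_map, toBlocks_fromBlocks₁₁, toBlocks_fromBlocks₁₂, toBlocks_fromBlocks₂₁,
    toBlocks_fromBlocks₂₂]
  rw [h, Matrix.mul_nonsing_inv_cancel_right _ _ (isUnit_iff_ne_zero.2 hdet)]

theorem mem_siegelModularGroup_of_conj {U V : Matrix (Fin n) (Fin n) ℤ} (hUV : Uᵀ * V = 1) :
    fromBlocks U 0 0 V ∈ SiegelModularGroup n := by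
  have h : Vᵀ * U = 1 := by simpa using congr_arg Matrix.transpose hUV
  simp [SiegelModularGroup, Jn, fromBlocks_transpose, fromBlocks_multiply, hUV, h]

theorem mem_siegelModularGroup_of_translate {B : Matrix (Fin n) (Fin n) ℤ} (hB : B.IsSymm) :
    fromBlocks 1 B 0 1 ∈ SiegelModularGroup n := by
  simp [SiegelModularGroup, Jn, fromBlocks_transpose, fromBlocks_multiply, hB.eq]

variable (f : SiegelModularForm n k (SiegelModularGroup n) 1)

theorem toFun_add_int {Z W : Matrix (Fin n) (Fin n) ℂ} (hZ : Z ∈ SiegelUpperHalfSpace n)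
    (hW : W.IsSymm) (h : ∀ i j, ∃ b : ℤ, W i j = Z i j + b) : f.toFun W = f.toFun Z := by
  choose b hb using h
  have hB : (Matrix.of b).IsSymm := by
    ext i j
    have h1 := hW.apply i j
    have h2 := hZ.1.apply i j
    rw [hb, hb, h2, add_right_inj] at h1
    simpa using h1
  have hmap : ∀ m : Matrix (Fin n) (Fin n) ℤ, m = 1 → m.map (fun a => (a : ℂ)) = 1 := by
    rintro m rfl
    exact Matrix.map_one _ (by simp) (by simp)
  have hmap0 : (0 : Matrix (Fin n) (Fin n) ℤ).map (fun a => (a : ℂ)) = 0 := by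
    ext; simp
  have h1 : matActS (fromBlocks 1 (Matrix.of b) 0 1) Z = W := by
    apply matActS_fromBlocks_eq
    · simp [hmap, hmap0]
    · simp only [hmap _ rfl, hmap0, zero_mul, zero_add, mul_one, one_mul]
      ext i j
      simp [hb]
  rw [← h1, f.transform _ (mem_siegelModularGroup_of_translate hB) Z hZ]
  simp [fromBlocks_map, hmap, hmap0]

theorem toFun_conj {U V : Matrix (Fin n) (Fin n) ℤ} (hUV : Uᵀ * V = 1) (hV : V.det = 1)
    {Z : Matrix (Fin n) (Fin n) ℂ} (hZ : Z ∈ SiegelUpperHalfSpace n) :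
    f.toFun (U.map (fun a => (a : ℂ)) * Z * (U.map (fun a => (a : ℂ)))ᵀ) = f.toFun Z := by
  have hmap0 : (0 : Matrix (Fin n) (Fin n) ℤ).map (fun a => (a : ℂ)) = 0 := by
    ext; simp
  have hdet : (V.map (fun a => (a : ℂ))).det = 1 := by
    have := Int.cast_det (R := ℂ) V
    rw [hV] at this
    simpa using this.symm
  have hUV' : (U.map (fun a => (a : ℂ)))ᵀ * V.map (fun a => (a : ℂ)) = 1 := by
    have h := congr_arg (fun m => m.map (Int.castRingHom ℂ)) hUV
    simp only [Matrix.map_mul] at h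
    rw [Matrix.map_one _ (by simp) (by simp)] at h
    simpa using! h
  have h1 : matActS (fromBlocks U 0 0 V) Z =
      U.map (fun a => (a : ℂ)) * Z * (U.map (fun a => (a : ℂ)))ᵀ := by
    apply matActS_fromBlocks_eq
    · simp [hmap0, hdet]
    · rw [hmap0, zero_mul, zero_add, add_zero, mul_assoc _ _ (V.map _), hUV', mul_one]
  rw [← h1, f.transform _ (mem_siegelModularGroup_of_conj hUV) Z hZ]
  simp [fromBlocks_map, hmap0, hdet]

end SymplecticInvariance

section TorsionPoints

variable {n : ℕ}

/-- The `o`-th standard basis vector. -/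
def unitVec (o : Fin n) : Fin n → ℚ := fun i => if i = o then 1 else 0

/-- The diagonal projection away from the `o`-th coordinate. -/
def complProj (o : Fin n) : Matrix (Fin n) (Fin n) ℚ :=
  Matrix.diagonal fun i => if i = o then 0 else 1

/-- The rational translation part of the point attached to `(a, b)`. -/
def torsionShift (o : Fin n) (X : Matrix (Fin n) (Fin n) ℚ) (a b : Fin n → ℚ) :
    Matrix (Fin n) (Fin n) ℚ :=
  Matrix.of fun i j => X i j + unitVec o i * b j + b i * unitVec o j + (a i * b j + b i * a j) / 2

/-- The point of the Siegel upper half space with first coordinate `τ`, abelian coordinate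
`a τ + b`, and remaining block built from `z` and `X`. -/
def torsionPoint (o : Fin n) (X : Matrix (Fin n) (Fin n) ℚ) (a b : Fin n → ℚ) (τ z : ℂ) :
    Matrix (Fin n) (Fin n) ℂ :=
  Matrix.of fun i j =>
    τ * ((unitVec o i + a i : ℚ) * (unitVec o j + a j : ℚ)) + z * (complProj o i j : ℚ) +
      (torsionShift o X a b i j : ℚ)

variable {o : Fin n} {X : Matrix (Fin n) (Fin n) ℚ} {a b : Fin n → ℚ}

theorem torsionShift_symm (hX : X.IsSymm) (i j : Fin n) :
    torsionShift o X a b i j = torsionShift o X a b j i := by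
  simp only [torsionShift, Matrix.of_apply, hX.apply i j]
  ring

theorem complProj_symm (i j : Fin n) : complProj o i j = complProj o j i := by
  rw [← Matrix.transpose_apply (complProj o), complProj, Matrix.diagonal_transpose]

theorem torsionPoint_isSymm (hX : X.IsSymm) (τ z : ℂ) : (torsionPoint o X a b τ z).IsSymm := by
  ext i j
  simp only [torsionPoint, Matrix.transpose_apply, Matrix.of_apply, torsionShift_symm hX i j,
    complProj_symm i j]
  ring

theorem torsionPoint_apply_left (hX : ∀ j, X o j = 0) (ha : a o = 0) (hb : b o = 0) (τ z : ℂ)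
    (j : Fin n) : torsionPoint o X a b τ z o j = τ * (unitVec o j + a j : ℚ) + b j := by
  by_cases h : o = j
  · subst h
    simp [torsionPoint, torsionShift, unitVec, complProj, hX, ha, hb]
  · simp [torsionPoint, torsionShift, unitVec, complProj, hX, ha, hb, h, Ne.symm h]

theorem posDef_of_rank_one_add_diagonal {u : Fin n → ℝ} (hu : u o = 1) {s t : ℝ} (hs : 0 < s)
    (ht : 0 < t) {Y : Matrix (Fin n) (Fin n) ℂ}
    (hY : ∀ i j, Y i j = ((s * (u i * u j) + t * (complProj o i j : ℚ) : ℝ) : ℂ)) : Y.PosDef := by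
  refine Matrix.PosDef.of_dotProduct_mulVec_pos ?_ fun x hx => ?_
  · ext i j
    rw [Matrix.conjTranspose_apply, hY, hY, complProj_symm i j, mul_comm (u i)]
    exact Complex.conj_ofReal _
  · have h1 : star x ⬝ᵥ Y *ᵥ x = ((s * Complex.normSq (∑ i, u i * x i) +
        t * ∑ i, (if i = o then 0 else 1) * Complex.normSq (x i) : ℝ) : ℂ) := by
      have h2 : Y *ᵥ x = fun i => s * u i * (∑ j, u j * x j) + t * ((if i = o then 0 else 1) * x i) := by
        ext i
        simp only [Matrix.mulVec, dotProduct, hY]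
        push_cast
        simp only [add_mul, Finset.sum_add_distrib, Finset.mul_sum]
        congr 1
        · exact Finset.sum_congr rfl fun j _ => by ring
        · rw [Finset.sum_eq_single i (fun j _ hj => by simp [complProj, Ne.symm hj]) (by simp)]
          split_ifs with h <;> simp [complProj, h]
      rw [h2]
      push_cast
      rw [Complex.normSq_eq_conj_mul_self, map_sum]
      simp only [dotProduct, mul_add, Finset.sum_add_distrib, Pi.star_apply, map_mul,
        Complex.conj_ofReal, Complex.normSq_eq_conj_mul_self]
      congr 1
      · rw [← mul_assoc, Finset.mul_sum _ _ (s : ℂ), Finset.sum_mul]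
        exact Finset.sum_congr rfl fun j _ => by simp; ring
      · rw [Finset.mul_sum]
        refine Finset.sum_congr rfl fun j _ => ?_
        split_ifs with h <;> simp
        ring
    rw [h1, Complex.zero_lt_real]
    have h3 : ∀ i ∈ Finset.univ, 0 ≤ (if i = o then 0 else 1 : ℝ) * Complex.normSq (x i) :=
      fun i _ => mul_nonneg (by split_ifs <;> simp) (Complex.normSq_nonneg _)
    by_cases h4 : ∃ i, i ≠ o ∧ x i ≠ 0
    · obtain ⟨i, hi, hxi⟩ := h4
      refine add_pos_of_nonneg_of_pos (mul_nonneg hs.le (Complex.normSq_nonneg _)) (mul_pos ht ?_)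
      refine Finset.sum_pos' h3 ⟨i, Finset.mem_univ _, ?_⟩
      simpa [hi] using hxi
    · push Not at h4
      have h5 : ∑ i, (u i : ℂ) * x i = x o := by
        rw [Finset.sum_eq_single o (fun i _ hi => by simp [h4 i hi]) (by simp), hu]
        simp
      have h6 : x o ≠ 0 := fun h => hx (funext fun i => by
        by_cases hi : i = o
        · exact hi ▸ h
        · exact h4 i hi)
      rw [h5]
      exact add_pos_of_pos_of_nonneg (mul_pos hs (Complex.normSq_pos.2 h6))
        (mul_nonneg ht.le (Finset.sum_nonneg h3))

theorem torsionPoint_mem (hX : X.IsSymm) (ha : a o = 0) (τ z : ℍ) :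
    torsionPoint o X a b τ z ∈ SiegelUpperHalfSpace n := by
  refine ⟨torsionPoint_isSymm hX _ _, ?_⟩
  refine posDef_of_rank_one_add_diagonal (o := o) (u := fun i => ((unitVec o i + a i : ℚ) : ℝ))
    (by simp [unitVec, ha]) τ.im_pos z.im_pos fun i j => ?_
  have h1 : (torsionPoint o X a b τ z)ᴴ i j = starRingEnd ℂ (torsionPoint o X a b τ z i j) := by
    rw [Matrix.conjTranspose_apply, (torsionPoint_isSymm hX _ _).apply]
    rfl
  have h2 : ∀ (t : ℝ), ((2 * t : ℝ) : ℂ) * Complex.I / (2 * Complex.I) = t := fun t => by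
    push_cast
    field_simp
  rw [Matrix.map_apply, Matrix.sub_apply, h1, Complex.sub_conj, h2]
  have h3 : torsionPoint o X a b τ z i j =
      τ * (((unitVec o i + a i : ℚ) * (unitVec o j + a j : ℚ) : ℝ) : ℂ) +
        z * ((complProj o i j : ℝ) : ℂ) + ((torsionShift o X a b i j : ℝ) : ℂ) := by
    simp [torsionPoint]
  rw [h3, Complex.add_im, Complex.add_im, Complex.im_mul_ofReal, Complex.im_mul_ofReal,
    Complex.ofReal_im, add_zero]
  rfl

end TorsionPoints

section TorsionTransformation

variable {n : ℕ} {k : ℤ} {o : Fin n} {X : Matrix (Fin n) (Fin n) ℚ} {a b : Fin n → ℚ}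

/-- The diagonal integer matrix with `o`-th entry `s` and all other entries `t`. -/
def diagAt (o : Fin n) (s t : ℤ) : Matrix (Fin n) (Fin n) ℤ :=
  Matrix.diagonal fun i => if i = o then s else t

theorem diagAt_mem (o : Fin n) {a b c d : ℤ} (hdet : a * d - b * c = 1) :
    fromBlocks (diagAt o a 1) (diagAt o b 0) (diagAt o c 0) (diagAt o d 1) ∈
      SiegelModularGroup n := by
  have h : ∀ s t s' t' u v u' v' x y : ℤ, s * s' - u * u' = x → t * t' - v * v' = y →
      (diagAt o s t)ᵀ * diagAt o s' t' - (diagAt o u v)ᵀ * diagAt o u' v' = diagAt o x y := by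
    rintro s t s' t' u v u' v' _ _ rfl rfl
    ext i j
    simp only [diagAt, Matrix.diagonal_transpose, Matrix.diagonal_mul_diagonal, Matrix.sub_apply,
      Matrix.diagonal_apply]
    split_ifs <;> simp
  have h0 : diagAt o 0 0 = 0 := by simp [diagAt]
  have h1 : diagAt o 1 1 = 1 := by simp [diagAt]
  have h2 : diagAt o (-1) (-1) = -1 := by
    rw [← h1]
    ext i j
    simp only [diagAt, Matrix.diagonal_apply, Matrix.neg_apply]
    split_ifs <;> simp
  refine Set.mem_ofPred.2 ?_
  simp only [Jn, fromBlocks_transpose, fromBlocks_multiply, mul_zero, zero_add, add_zero, mul_one,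
    mul_neg, neg_mul, fromBlocks_inj, ← sub_eq_add_neg]
  refine ⟨?_, ?_, ?_, ?_⟩
  · rw [← h0]
    exact h _ _ _ _ _ _ _ _ _ _ (by ring) (by ring)
  · rw [← h2]
    exact h _ _ _ _ _ _ _ _ _ _ (by linarith) (by ring)
  · rw [← h1]
    exact h _ _ _ _ _ _ _ _ _ _ (by linarith) (by ring)
  · rw [← h0]
    exact h _ _ _ _ _ _ _ _ _ _ (by ring) (by ring)

theorem diagAt_map_mul_apply (s t : ℤ) (Z : Matrix (Fin n) (Fin n) ℂ) (i j : Fin n) :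
    ((diagAt o s t).map (fun a => (a : ℂ)) * Z) i j =
      t * Z i j + (s - t) * (unitVec o i : ℂ) * Z o j := by
  rw [diagAt, Matrix.diagonal_map (by simp), Matrix.diagonal_mul]
  by_cases h : i = o
  · simp [h, unitVec]
    ring
  · simp [h, unitVec]

theorem mul_diagAt_map_apply (s t : ℤ) (Z : Matrix (Fin n) (Fin n) ℂ) (i j : Fin n) :
    (Z * (diagAt o s t).map (fun a => (a : ℂ))) i j =
      t * Z i j + (s - t) * (unitVec o j : ℂ) * Z i o := by
  rw [diagAt, Matrix.diagonal_map (by simp), Matrix.mul_diagonal]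
  by_cases h : j = o
  · simp [h, unitVec]
    ring
  · simp [h, unitVec]
    ring

theorem diagAt_map_apply (s t : ℤ) (i j : Fin n) :
    (diagAt o s t).map (fun a => (a : ℂ)) i j =
      t * (1 : Matrix (Fin n) (Fin n) ℂ) i j + (s - t) * (unitVec o i : ℂ) * (unitVec o j : ℂ) := by
  have := diagAt_map_mul_apply (o := o) s t 1 i j
  rw [mul_one] at this
  have h : (1 : Matrix (Fin n) (Fin n) ℂ) o j = unitVec o j := by
    by_cases hj : j = o
    · subst hj
      simp [unitVec]
    · simp [hj, unitVec, Ne.symm hj]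
  rw [this, h]

theorem det_autFactor (hX : ∀ j, X o j = 0) (ha : a o = 0) (hb : b o = 0) (γ : SL(2, ℤ)) (τ : ℍ)
    (z : ℂ) :
    ((diagAt o (γ 1 0) 0).map (fun a => (a : ℂ)) * torsionPoint o X a b τ z +
      (diagAt o (γ 1 1) 1).map (fun a => (a : ℂ))).det = autFactor γ τ := by
  set w : Fin n → ℂ := ((diagAt o (γ 1 0) 0).map (fun a => (a : ℂ)) * torsionPoint o X a b τ z +
      (diagAt o (γ 1 1) 1).map (fun a => (a : ℂ))) o with hw
  have h1 : (diagAt o (γ 1 0) 0).map (fun a => (a : ℂ)) * torsionPoint o X a b τ z +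
      (diagAt o (γ 1 1) 1).map (fun a => (a : ℂ)) = updateRow 1 o w := by
    ext i j
    by_cases h : i = o
    · rw [h, updateRow_self, hw]
    · rw [updateRow_ne h, Matrix.add_apply, diagAt_map_mul_apply, diagAt_map_apply]
      simp [unitVec, h]
  rw [h1, ← cramer_transpose_apply, transpose_one, cramer_one, Module.End.one_apply, hw,
    Matrix.add_apply, diagAt_map_mul_apply, diagAt_map_apply, torsionPoint_apply_left hX ha hb]
  simp [unitVec, ha, hb, autFactor]

theorem toFun_torsionPoint_smul (f : SiegelModularForm n k (SiegelModularGroup n) 1)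
    (hXs : X.IsSymm) (hX : ∀ j, X o j = 0) (ha : a o = 0) (hb : b o = 0) (γ : SL(2, ℤ)) (τ z : ℍ) :
    f.toFun (torsionPoint o X a b (γ • τ : ℍ) z) = autFactor γ τ ^ k *
      f.toFun (torsionPoint o X (fun i => γ 0 0 * a i + γ 1 0 * b i)
        (fun i => γ 0 1 * a i + γ 1 1 * b i) τ z) := by
  have hJ := autFactor_ne_zero γ τ
  have hγ : γ 0 0 * γ 1 1 - γ 0 1 * γ 1 0 = 1 := by
    rw [← Matrix.det_fin_two, γ.det_coe]
  set a' : Fin n → ℚ := fun i => γ 0 0 * a i + γ 1 0 * b i with ha'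
  set b' : Fin n → ℚ := fun i => γ 0 1 * a i + γ 1 1 * b i with hb'
  have ha0 : a' o = 0 := by simp [ha', ha, hb]
  have hb0 : b' o = 0 := by simp [hb', ha, hb]
  have hdet := det_autFactor hX ha0 hb0 γ τ z
  have hact : matActS (fromBlocks (diagAt o (γ 0 0) 1) (diagAt o (γ 0 1) 0) (diagAt o (γ 1 0) 0)
      (diagAt o (γ 1 1) 1)) (torsionPoint o X a' b' τ z) =
        torsionPoint o X a b (γ • τ : ℍ) z := by
    refine matActS_fromBlocks_eq (hdet ▸ hJ) ?_
    have r1 : ((γ • τ : ℍ) : ℂ) * (γ 1 0 * τ + γ 1 1) = γ 0 0 * τ + γ 0 1 := by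
      rw [coe_smul_eq]
      exact div_mul_cancel₀ _ hJ
    have r2 : (γ 0 0 : ℂ) * γ 1 1 - γ 0 1 * γ 1 0 = 1 := by exact_mod_cast hγ
    generalize ((γ • τ : ℍ) : ℂ) = s at r1 ⊢
    ext i j
    rw [mul_add, Matrix.add_apply, Matrix.add_apply, ← mul_assoc, mul_diagAt_map_apply,
      diagAt_map_mul_apply, diagAt_map_apply, Matrix.mul_apply]
    simp_rw [mul_diagAt_map_apply]
    rw [Finset.sum_eq_single o (fun l _ hl => by simp [unitVec, hl]) (by simp)]
    rw [(torsionPoint_isSymm hXs _ _).apply o i, torsionPoint_apply_left hX ha0 hb0,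
      torsionPoint_apply_left hX ha hb]
    simp only [torsionPoint, torsionShift, Matrix.of_apply, ha', hb']
    simp only [show unitVec o o = 1 by simp [unitVec]]
    push_cast
    linear_combination (-((unitVec o i : ℂ) + a i) * (unitVec o j + γ 0 0 * a j + γ 1 0 * b j)) * r1 +
      (s * unitVec o i * a j + unitVec o i * b j + s * a i * a j + a i * b j / 2 + b i * a j / 2) * r2
  rw [← hact, f.transform _ (diagAt_mem o hγ) _ (torsionPoint_mem hXs ha0 τ z)]
  simp only [fromBlocks_map, toBlocks_fromBlocks₂₁, toBlocks_fromBlocks₂₂, hdet]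

/-- The integer matrix `1 + d eᵀ`, with `e` the `o`-th standard basis vector. -/
def shear (o : Fin n) (d : Fin n → ℤ) : Matrix (Fin n) (Fin n) ℤ :=
  1 + vecMulVec d (Pi.single o 1)

theorem shear_transpose_mul {d : Fin n → ℤ} (hd : d o = 0) :
    (shear o d)ᵀ * (shear o (-d))ᵀ = 1 := by
  rw [← Matrix.transpose_mul, shear, shear, add_mul, mul_add, mul_add, vecMulVec_mul_vecMulVec]
  simp [hd, neg_vecMulVec]

theorem det_shear {d : Fin n → ℤ} (hd : d o = 0) : (shear o d).det = 1 := by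
  rw [shear, vecMulVec_eq Unit, det_one_add_replicateCol_mul_replicateRow]
  simp [hd]

theorem shear_conj_apply (d : Fin n → ℤ) {Z : Matrix (Fin n) (Fin n) ℂ} (i j : Fin n) :
    ((shear o d).map (fun a => (a : ℂ)) * Z * ((shear o d).map (fun a => (a : ℂ)))ᵀ) i j =
      Z i j + d i * Z o j + Z i o * d j + d i * Z o o * d j := by
  have h : (shear o d).map (fun a => (a : ℂ)) =
      1 + vecMulVec (fun i => (d i : ℂ)) (Pi.single o 1) := by
    ext i j
    simp only [shear, vecMulVec_apply, Matrix.map_apply, Matrix.add_apply, Matrix.one_apply,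
      Pi.single_apply]
    split_ifs <;> simp
  rw [h, Matrix.transpose_add, transpose_vecMulVec, transpose_one, add_mul, one_mul, mul_add,
    mul_one, vecMulVec_mul, add_mul, vecMulVec_mul_vecMulVec, mul_vecMulVec]
  simp [vecMulVec_apply]
  ring

theorem toFun_torsionPoint_congr (f : SiegelModularForm n k (SiegelModularGroup n) 1)
    (hXs : X.IsSymm) (hX : ∀ j, X o j = 0) {N : ℕ} (hN : 0 < N) {α β d w : Fin n → ℤ}
    (hα : α o = 0) (hβ : β o = 0) (hd : d o = 0) (τ z : ℍ) :
    f.toFun (torsionPoint o X (fun i => (α i + 2 * N ^ 2 * d i : ℤ) / N)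
        (fun i => (β i + 2 * N ^ 2 * w i : ℤ) / N) τ z) =
      f.toFun (torsionPoint o X (fun i => α i / N) (fun i => β i / N) τ z) := by
  have hN' : (N : ℂ) ≠ 0 := by exact_mod_cast hN.ne'
  have ha : (α o / N : ℚ) = 0 := by simp [hα]
  have hb : (β o / N : ℚ) = 0 := by simp [hβ]
  have hmem := torsionPoint_mem (o := o) (a := fun i => (α i / N : ℚ))
    (b := fun i => (β i / N : ℚ)) hXs ha τ z
  have hmem' := torsionPoint_mem (o := o) (a := fun i => ((α i + 2 * N ^ 2 * d i : ℤ) / N : ℚ))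
    (b := fun i => ((β i + 2 * N ^ 2 * w i : ℤ) / N : ℚ)) hXs (by simp [hα, hd]) τ z
  have hd' : (fun i => 2 * (N : ℤ) * d i) o = 0 := by simp [hd]
  have hdet : ((shear o (-fun i => 2 * (N : ℤ) * d i))ᵀ).det = 1 := by
    rw [Matrix.det_transpose]
    exact det_shear (by simp [hd])
  rw [← toFun_conj f (shear_transpose_mul hd') hdet hmem]
  refine (toFun_add_int f hmem' ?_ fun i j => ?_).symm
  · rw [Matrix.IsSymm, Matrix.transpose_mul, Matrix.transpose_mul, Matrix.transpose_transpose,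
      hmem.1.eq, mul_assoc]
  · refine ⟨-((if i = o then 1 else 0) * (2 * N * w j) + 2 * N * w i * (if j = o then 1 else 0) +
      α i * w j + d i * β j + 2 * N ^ 2 * d i * w j + α j * w i + d j * β i +
      2 * N ^ 2 * d j * w i - 2 * d i * β j - 2 * β i * d j), ?_⟩
    rw [shear_conj_apply, (torsionPoint_isSymm hXs _ _).apply o i]
    rw [torsionPoint_apply_left (a := fun i => (α i / N : ℚ)) (b := fun i => (β i / N : ℚ)) hX ha hb,
      torsionPoint_apply_left (a := fun i => (α i / N : ℚ)) (b := fun i => (β i / N : ℚ)) hX ha hb,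
      torsionPoint_apply_left (a := fun i => (α i / N : ℚ)) (b := fun i => (β i / N : ℚ)) hX ha hb]
    simp only [torsionPoint, torsionShift, Matrix.of_apply, ha, hb,
      show unitVec o o = 1 by simp [unitVec]]
    have hu : ∀ i, ((if i = o then 1 else 0 : ℤ) : ℂ) = (unitVec o i : ℂ) := fun i => by
      by_cases h : i = o <;> simp [unitVec, h]
    rw [Int.cast_neg]
    simp only [Int.cast_add, Int.cast_sub, Int.cast_mul, hu]
    push_cast
    field_simp
    ring

end TorsionTransformation

section TorsionExpansion

variable {n : ℕ} {k : ℤ}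

/-- The value of the quadratic form with Gram matrix `T` at `u`. -/
def quadVal (T : Matrix (Fin n) (Fin n) ℚ) (u : Fin n → ℚ) : ℚ := ∑ i, ∑ j, T i j * (u i * u j)

/-- The vector `e + α / N`, where `e` is the `o`-th standard basis vector. -/
def torsionVec (o : Fin n) (N : ℕ) (α : Fin n → ℤ) : Fin n → ℚ := fun i => unitVec o i + α i / N

/-- The exponent of `q_{2N²}(τ)` attached to `T` at the torsion point with first coordinate `α / N`. -/
def torsionExp (o : Fin n) (N : ℕ) (α : Fin n → ℤ) (T : Matrix (Fin n) (Fin n) ℚ) : ℕ :=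
  ⌊(2 * N ^ 2 : ℕ) * quadVal T (torsionVec o N α)⌋₊

/-- The trace of `T` away from the `o`-th coordinate. -/
def sideTrace (o : Fin n) (T : Matrix (Fin n) (Fin n) ℚ) : ℕ :=
  ⌊∑ i, if i = o then 0 else T i i⌋₊

/-- The root of unity attached to `T` by a rational translation. -/
def shiftChar (Y T : Matrix (Fin n) (Fin n) ℚ) : ℂ :=
  Complex.exp (2 * Real.pi * Complex.I * (∑ i, ∑ j, T i j * Y i j : ℚ))

theorem quadVal_nonneg {T : Matrix (Fin n) (Fin n) ℚ} (hT : T ∈ SiegelLattice n 1) (u : Fin n → ℚ) :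
    0 ≤ quadVal T u := by
  have h := hT.2.2.2.dotProduct_mulVec_nonneg fun i => (u i : ℝ)
  have h2 : star (fun i => (u i : ℝ)) ⬝ᵥ (T.map fun q => (q : ℝ)) *ᵥ (fun i => (u i : ℝ)) =
      ((quadVal T u : ℚ) : ℝ) := by
    simp only [quadVal, dotProduct, Matrix.mulVec, Finset.mul_sum]
    push_cast
    refine Finset.sum_congr rfl fun i _ => Finset.sum_congr rfl fun j _ => ?_
    simp
    ring
  rw [h2] at h
  exact_mod_cast h

theorem diag_nonneg {T : Matrix (Fin n) (Fin n) ℚ} (hT : T ∈ SiegelLattice n 1) (i : Fin n) :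
    0 ≤ T i i := by
  have := quadVal_nonneg hT (Pi.single i 1)
  simpa [quadVal, Pi.single_apply] using this

theorem natCast_floor_eq {r : ℚ} (hr : 0 ≤ r) (h : ∃ a : ℤ, r = a) : ((⌊r⌋₊ : ℕ) : ℚ) = r := by
  obtain ⟨a, rfl⟩ := h
  lift a to ℕ using by exact_mod_cast hr
  simp

theorem sum_int_of_forall {ι : Type*} (s : Finset ι) {f : ι → ℚ} (h : ∀ i ∈ s, ∃ a : ℤ, f i = a) :
    ∃ a : ℤ, ∑ i ∈ s, f i = a := by
  choose! g hg using h
  exact ⟨∑ i ∈ s, g i, by rw [Int.cast_sum]; exact Finset.sum_congr rfl hg⟩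

theorem coe_sideTrace {T : Matrix (Fin n) (Fin n) ℚ} (hT : T ∈ SiegelLattice n 1) (o : Fin n) :
    (sideTrace o T : ℚ) = ∑ i, if i = o then 0 else T i i := by
  refine natCast_floor_eq (Finset.sum_nonneg fun i _ => ?_) (sum_int_of_forall _ fun i _ => ?_)
  · split_ifs
    exacts [le_rfl, diag_nonneg hT i]
  · split_ifs
    · exact ⟨0, by simp⟩
    · simpa using hT.2.1 i

theorem coe_torsionExp {T : Matrix (Fin n) (Fin n) ℚ} (hT : T ∈ SiegelLattice n 1) (o : Fin n)
    {N : ℕ} (hN : 0 < N) (α : Fin n → ℤ) :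
    (torsionExp o N α T : ℚ) = (2 * N ^ 2 : ℕ) * quadVal T (torsionVec o N α) := by
  refine natCast_floor_eq (mul_nonneg (Nat.cast_nonneg _) (quadVal_nonneg hT _)) ?_
  rw [quadVal, Finset.mul_sum]
  refine sum_int_of_forall _ fun i _ => ?_
  rw [Finset.mul_sum]
  refine sum_int_of_forall _ fun j _ => ?_
  obtain ⟨t, ht⟩ := hT.2.2.1 i j
  have hN' : (N : ℚ) ≠ 0 := by exact_mod_cast hN.ne'
  have h : ∀ i, ∃ w : ℤ, torsionVec o N α i = w / N := fun i =>
    ⟨(if i = o then N else 0) + α i, by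
      by_cases hi : i = o
      · simp [torsionVec, unitVec, hi, add_div, hN']
      · simp [torsionVec, unitVec, hi]⟩
  obtain ⟨w, hw⟩ := h i
  obtain ⟨w', hw'⟩ := h j
  refine ⟨t * w * w', ?_⟩
  push_cast at ht ⊢
  rw [← ht, hw, hw']
  field_simp

theorem trace_mul_torsionPoint {T : Matrix (Fin n) (Fin n) ℚ} (hT : T ∈ SiegelLattice n 1)
    (o : Fin n) (X : Matrix (Fin n) (Fin n) ℚ) (N : ℕ) (α β : Fin n → ℤ) (τ z : ℂ) :
    ((T.map fun q => (q : ℂ)) *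
      torsionPoint o X (fun i => α i / N) (fun i => β i / N) τ z).trace =
    τ * (quadVal T (torsionVec o N α) : ℚ) + z * (∑ i, if i = o then 0 else T i i : ℚ) +
      (∑ i, ∑ j, T i j * torsionShift o X (fun i => α i / N) (fun i => β i / N) i j : ℚ) := by
  have h1 : ∑ i, (if i = o then 0 else T i i) = ∑ i, ∑ j, T i j * complProj o i j := by
    refine Finset.sum_congr rfl fun i _ => ?_
    rw [Finset.sum_eq_single i (fun j _ hj => by simp [complProj, Ne.symm hj]) (by simp)]
    by_cases h : i = o <;> simp [complProj, h]
  rw [h1, Matrix.trace, quadVal]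
  push_cast
  simp only [Finset.mul_sum, ← Finset.sum_add_distrib, Matrix.diag_apply, Matrix.mul_apply]
  rw [Finset.sum_comm]
  refine Finset.sum_congr rfl fun i _ => Finset.sum_congr rfl fun j _ => ?_
  rw [Matrix.map_apply, hT.1.apply i j]
  simp only [torsionPoint, torsionVec, Matrix.of_apply]
  push_cast
  ring

theorem hasSum_torsionPoint (f : SiegelModularForm n k (SiegelModularGroup n) 1) {o : Fin n}
    {X : Matrix (Fin n) (Fin n) ℚ} (hX : X.IsSymm) {N : ℕ} (hN : 0 < N) {α : Fin n → ℤ}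
    (hα : α o = 0) (β : Fin n → ℤ) (τ z : ℍ) :
    HasSum (fun T : SiegelLattice n 1 =>
      f.coeff T * shiftChar (torsionShift o X (fun i => α i / N) (fun i => β i / N)) T *
        Periodic.qParam (2 * N ^ 2 : ℕ) τ ^ torsionExp o N α T *
        Periodic.qParam (1 : ℕ) z ^ sideTrace o (T : Matrix (Fin n) (Fin n) ℚ))
      (f.toFun (torsionPoint o X (fun i => α i / N) (fun i => β i / N) τ z)) := by
  have hN' : (N : ℂ) ≠ 0 := by exact_mod_cast hN.ne'
  convert f.expansion _ (torsionPoint_mem (o := o) (a := fun i => (α i / N : ℚ))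
    (b := fun i => (β i / N : ℚ)) hX (by simp [hα]) τ z) using 2 with T
  rw [trace_mul_torsionPoint T.2, mul_assoc, mul_assoc, shiftChar, Periodic.qParam, Periodic.qParam,
    ← Complex.exp_nat_mul, ← Complex.exp_nat_mul, ← Complex.exp_add, ← Complex.exp_add]
  congr 2
  have h1 : (torsionExp o N α T : ℂ) = (2 * N ^ 2 : ℕ) * (quadVal T (torsionVec o N α) : ℚ) := by
    exact_mod_cast congr_arg (fun q : ℚ => (q : ℂ)) (coe_torsionExp T.2 o hN α)
  have h2 : (sideTrace o (T : Matrix (Fin n) (Fin n) ℚ) : ℂ) =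
      (∑ i, if i = o then 0 else (T : Matrix (Fin n) (Fin n) ℚ) i i : ℚ) := by
    exact_mod_cast congr_arg (fun q : ℚ => (q : ℂ)) (coe_sideTrace T.2 o)
  rw [h1, h2]
  generalize (∑ i, if i = o then 0 else (T : Matrix (Fin n) (Fin n) ℚ) i i : ℚ) = A
  generalize (quadVal T (torsionVec o N α) : ℚ) = B
  generalize (∑ i, ∑ j, (T : Matrix (Fin n) (Fin n) ℚ) i j * _ : ℚ) = C
  push_cast
  field_simp
  ring

end TorsionExpansion

section Finiteness

variable {n : ℕ}

theorem quadVal_add_quadVal (T : Matrix (Fin n) (Fin n) ℚ) (u v : Fin n → ℚ) :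
    quadVal T (u + v) + quadVal T (u - v) = 2 * quadVal T u + 2 * quadVal T v := by
  simp only [quadVal, Finset.mul_sum, ← Finset.sum_add_distrib]
  refine Finset.sum_congr rfl fun i _ => Finset.sum_congr rfl fun j _ => ?_
  simp only [Pi.add_apply, Pi.sub_apply]
  ring

theorem quadVal_single (T : Matrix (Fin n) (Fin n) ℚ) (i : Fin n) :
    quadVal T (Pi.single i 1) = T i i := by
  simp [quadVal, Pi.single_apply]

theorem two_mul_abs_le {T : Matrix (Fin n) (Fin n) ℚ} (hT : T ∈ SiegelLattice n 1) (i j : Fin n) :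
    2 * |T i j| ≤ T i i + T j j := by
  have key : ∀ s : ℚ, quadVal T (Pi.single i 1 + s • Pi.single j 1) =
      T i i + 2 * s * T i j + s ^ 2 * T j j := fun s => by
    simp only [quadVal, Pi.add_apply, Pi.smul_apply, Pi.single_apply, smul_eq_mul, mul_add, add_mul,
      Finset.sum_add_distrib]
    simp [hT.1.apply i j]
    ring
  have h1 := quadVal_nonneg hT (Pi.single i 1 + (1 : ℚ) • Pi.single j 1)
  have h2 := quadVal_nonneg hT (Pi.single i 1 + (-1 : ℚ) • Pi.single j 1)
  rw [key] at h1 h2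
  have := abs_le.2 (⟨by linarith, by linarith⟩ : -((T i i + T j j) / 2) ≤ T i j ∧ T i j ≤ (T i i + T j j) / 2)
  linarith

theorem finite_of_diag_le (C : ℚ) :
    {T : SiegelLattice n 1 | ∀ i, (T : Matrix (Fin n) (Fin n) ℚ) i i ≤ C}.Finite := by
  have hfl : ∀ (T : SiegelLattice n 1) i j,
      ((⌊2 * (T : Matrix (Fin n) (Fin n) ℚ) i j⌋ : ℤ) : ℚ) =
        2 * (T : Matrix (Fin n) (Fin n) ℚ) i j := fun T i j => by
    obtain ⟨t, ht⟩ := T.2.2.2.1 i j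
    simp only [Nat.cast_one, mul_one] at ht
    rw [ht, Int.floor_intCast]
  let φ : SiegelLattice n 1 → Fin n → Fin n → ℤ := fun T i j =>
    ⌊2 * (T : Matrix (Fin n) (Fin n) ℚ) i j⌋
  have hφ : Injective φ := fun T T' h => by
    ext i j
    have h1 := congr_arg (fun x : ℤ => (x : ℚ)) (congr_fun (congr_fun h i) j)
    simp only [φ, hfl] at h1
    linarith
  refine ((Set.finite_Icc (fun _ _ => -⌈2 * C⌉ : Fin n → Fin n → ℤ) fun _ _ => ⌈2 * C⌉).preimage
    hφ.injOn).subset fun T hT => ?_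
  have hT' : ∀ i, (T : Matrix (Fin n) (Fin n) ℚ) i i ≤ C := hT
  have h1 : ∀ i j, |((φ T i j : ℤ) : ℚ)| ≤ ⌈2 * C⌉ := fun i j => by
    have h2 := two_mul_abs_le T.2 i j
    simp only [φ, hfl]
    rw [abs_mul, abs_two]
    linarith [hT' i, hT' j, Int.le_ceil (2 * C)]
  exact ⟨fun i j => by exact_mod_cast (abs_le.1 (h1 i j)).1,
    fun i j => by exact_mod_cast (abs_le.1 (h1 i j)).2⟩

theorem diag_le_sideTrace {T : Matrix (Fin n) (Fin n) ℚ} (hT : T ∈ SiegelLattice n 1) {o i : Fin n}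
    (hi : i ≠ o) : T i i ≤ sideTrace o T := by
  rw [coe_sideTrace hT]
  have h := Finset.single_le_sum (f := fun i => if i = o then 0 else T i i) (fun i _ => by
    split_ifs
    exacts [le_rfl, diag_nonneg hT i]) (Finset.mem_univ i)
  simpa [hi] using h

theorem quadVal_le_of_apply_eq_zero {T : Matrix (Fin n) (Fin n) ℚ} (hT : T ∈ SiegelLattice n 1)
    {o : Fin n} {v : Fin n → ℚ} (hv : v o = 0) :
    quadVal T v ≤ sideTrace o T * ∑ i, ∑ j, |v i * v j| := by
  simp only [quadVal, Finset.mul_sum]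
  refine Finset.sum_le_sum fun i _ => Finset.sum_le_sum fun j _ => ?_
  by_cases hi : i = o
  · simp [hi, hv]
  by_cases hj : j = o
  · simp [hj, hv]
  refine (le_abs_self _).trans ?_
  rw [abs_mul]
  refine mul_le_mul_of_nonneg_right ?_ (abs_nonneg _)
  linarith [two_mul_abs_le hT i j, diag_le_sideTrace hT hi, diag_le_sideTrace hT hj]

theorem finite_torsion_fiber (o : Fin n) {N : ℕ} (hN : 0 < N) {α : Fin n → ℤ} (hα : α o = 0)
    (i j : ℕ) :
    {T : SiegelLattice n 1 | sideTrace o (T : Matrix (Fin n) (Fin n) ℚ) = i ∧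
      torsionExp o N α T = j}.Finite := by
  set v : Fin n → ℚ := fun i => α i / N with hv
  set S : ℚ := ∑ i, ∑ j, |v i * v j| with hS
  have hS0 : 0 ≤ S := Finset.sum_nonneg fun _ _ => Finset.sum_nonneg fun _ _ => abs_nonneg _
  refine (finite_of_diag_le (i + (2 * j + 2 * (i * S)))).subset fun T hT l => ?_
  obtain ⟨h1, h2⟩ : sideTrace o (T : Matrix (Fin n) (Fin n) ℚ) = i ∧ torsionExp o N α T = j := hT
  have hi0 : (0 : ℚ) ≤ i * S := mul_nonneg (Nat.cast_nonneg _) hS0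
  have hi1 : (0 : ℚ) ≤ i := Nat.cast_nonneg _
  have hj1 : (0 : ℚ) ≤ j := Nat.cast_nonneg _
  by_cases hl : l = o
  · subst hl
    have h3 := quadVal_le_of_apply_eq_zero (v := v) T.2 (by simp [hv, hα] : v l = 0)
    rw [h1] at h3
    have h4 := coe_torsionExp T.2 l hN α
    rw [h2] at h4
    have h5 : quadVal T (torsionVec l N α) ≤ j := by
      rw [h4]
      refine le_mul_of_one_le_left (quadVal_nonneg T.2 _) ?_
      exact_mod_cast Nat.mul_pos two_pos (pow_pos hN 2)
    have h6 := quadVal_add_quadVal T (torsionVec l N α) v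
    have h7 : torsionVec l N α - v = Pi.single l 1 := by
      ext i
      simp [torsionVec, hv, unitVec, Pi.single_apply]
    rw [h7, quadVal_single] at h6
    have h8 := quadVal_nonneg T.2 (torsionVec l N α + v)
    linarith
  · have := diag_le_sideTrace T.2 hl
    rw [h1] at this
    linarith

end Finiteness

section TorsionFamily

variable {n : ℕ} {k : ℤ}

theorem shiftChar_mem (O : ValuationSubring ℂ) (Y T : Matrix (Fin n) (Fin n) ℚ) :
    shiftChar Y T ∈ O := by
  rw [shiftChar]
  generalize (∑ i, ∑ j, T i j * Y i j : ℚ) = r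
  have h := exp_root_pow_eq_one r.den_pos r.num
  have h2 : (2 * Real.pi * Complex.I * (r : ℂ)) = 2 * Real.pi * Complex.I * r.num / r.den := by
    rw [mul_div_assoc, ← Rat.cast_def]
  rw [h2]
  exact mem_of_pow_eq_one r.den_pos h

/-- The torsion point attached to `γ`: the translate by `γ` of the one with coordinates
`(-β / N, 0)`. -/
def familyPoint (o : Fin n) (X : Matrix (Fin n) (Fin n) ℚ) (N : ℕ) (β : Fin n → ℤ) (γ : SL(2, ℤ))
    (τ z : ℂ) : Matrix (Fin n) (Fin n) ℂ :=
  torsionPoint o X (fun i => (-(γ 0 0) * β i : ℤ) / N) (fun i => (-(γ 0 1) * β i : ℤ) / N) τ z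

/-- The coefficients of the expansion of a Siegel modular form along `familyPoint`. -/
def familyCoeff (o : Fin n) (X : Matrix (Fin n) (Fin n) ℚ) (N : ℕ) (β : Fin n → ℤ)
    (c : Matrix (Fin n) (Fin n) ℚ → ℂ) (γ : SL(2, ℤ)) (T : SiegelLattice n 1) : ℂ :=
  c T * shiftChar (torsionShift o X (fun i => (-(γ 0 0) * β i : ℤ) / N)
    (fun i => (-(γ 0 1) * β i : ℤ) / N)) T

variable {o : Fin n} {X : Matrix (Fin n) (Fin n) ℚ} {N : ℕ} {β : Fin n → ℤ}

theorem finite_family_fiber (hN : 0 < N) (hβ : β o = 0) (γ : SL(2, ℤ)) (i j : ℕ) :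
    {T : SiegelLattice n 1 | sideTrace o (T : Matrix (Fin n) (Fin n) ℚ) = i ∧
      torsionExp o N (fun i => -(γ 0 0) * β i) T = j}.Finite :=
  finite_torsion_fiber o hN (by simp [hβ]) i j

theorem hasSum_familyPoint (f : SiegelModularForm n k (SiegelModularGroup n) 1)
    (hX : X.IsSymm) (hN : 0 < N) (hβ : β o = 0) (γ : SL(2, ℤ)) (τ z : ℍ) :
    HasSum (fun T : SiegelLattice n 1 => familyCoeff o X N β f.coeff γ T *
        Periodic.qParam (2 * N ^ 2 : ℕ) τ ^ torsionExp o N (fun i => -(γ 0 0) * β i) T *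
        Periodic.qParam (1 : ℕ) z ^ sideTrace o (T : Matrix (Fin n) (Fin n) ℚ))
      (f.toFun (familyPoint o X N β γ τ z)) :=
  hasSum_torsionPoint f hX hN (by simp [hβ]) _ τ z

theorem toFun_familyPoint_smul (f : SiegelModularForm n k (SiegelModularGroup n) 1)
    (hXs : X.IsSymm) (hX : ∀ j, X o j = 0) (hβ : β o = 0) (γ δ : SL(2, ℤ)) (τ z : ℍ) :
    f.toFun (familyPoint o X N β γ (δ • τ : ℍ) z) =
      autFactor δ τ ^ k * f.toFun (familyPoint o X N β (γ * δ) τ z) := by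
  rw [familyPoint, toFun_torsionPoint_smul f hXs hX (by simp [hβ]) (by simp [hβ]), familyPoint]
  have h : ∀ j, (γ * δ) 0 j = γ 0 0 * δ 0 j + γ 0 1 * δ 1 j := fun j => by
    simp [Matrix.mul_apply, Fin.sum_univ_two]
  have h2 : ∀ j, (fun i => (δ 0 j * ((-(γ 0 0) * β i : ℤ) / N) + δ 1 j * ((-(γ 0 1) * β i : ℤ) / N) : ℚ)) =
      fun i => ((-((γ * δ) 0 j) * β i : ℤ) / N : ℚ) := fun j => by
    ext i
    rw [h]
    push_cast
    ring
  rw [h2, h2]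

theorem toFun_familyPoint_congr (f : SiegelModularForm n k (SiegelModularGroup n) 1)
    (hXs : X.IsSymm) (hX : ∀ j, X o j = 0) (hN : 0 < N) (hβ : β o = 0) {γ γ' : SL(2, ℤ)}
    (h : redSL (2 * N ^ 2) γ = redSL (2 * N ^ 2) γ') (τ z : ℍ) :
    f.toFun (familyPoint o X N β γ τ z) = f.toFun (familyPoint o X N β γ' τ z) := by
  rw [redSL_eq_iff] at h
  have h1 : ∀ j, ∃ t, γ 0 j = γ' 0 j + 2 * N ^ 2 * t := fun j => by
    have := (ZMod.intCast_eq_intCast_iff_dvd_sub _ _ _).1 (h 0 j).symm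
    obtain ⟨t, ht⟩ := this
    exact ⟨t, by push_cast at ht; linarith⟩
  obtain ⟨s, hs⟩ := h1 0
  obtain ⟨t, ht⟩ := h1 1
  have := toFun_torsionPoint_congr f hXs hX hN (α := fun i => -(γ' 0 0) * β i)
    (β := fun i => -(γ' 0 1) * β i) (d := fun i => -s * β i) (w := fun i => -t * β i)
    (by simp [hβ]) (by simp [hβ]) (by simp [hβ]) τ z
  rw [familyPoint, familyPoint, ← this]
  congr 2
  · funext i
    rw [hs]
    congr 2
    ring
  · funext i
    rw [ht]
    congr 2
    ring

theorem fiberCoeff_family_mem {O : ValuationSubring ℂ} {c : Matrix (Fin n) (Fin n) ℚ → ℂ}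
    (hc : ∀ T, c T ∈ O) (hN : 0 < N) (hβ : β o = 0) (γ : SL(2, ℤ)) (i j : ℕ) :
    fiberCoeff (finite_family_fiber hN hβ γ) (familyCoeff o X N β c γ) i j ∈ O :=
  sum_mem fun T _ => mul_mem (hc T) (shiftChar_mem O _ _)

theorem siegel_level_congruence {O : ValuationSubring ℂ} (h6 : (1728 : ℂ)⁻¹ ∈ O) {k' : ℤ}
    (f : SiegelModularForm n k (SiegelModularGroup n) 1)
    (g : SiegelModularForm n k' (SiegelModularGroup n) 1) (hXs : X.IsSymm) (hX : ∀ j, X o j = 0)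
    (hN : 0 < N) (hβ : β o = 0) {ℓ : ℕ} (hℓ : ℓ.Prime) (hℓM : (ℓ : ZMod (2 * N ^ 2)) = 1)
    (hℓO : (ℓ : ℂ)⁻¹ ∈ O) {P : O} (hP : P ≠ 0) (hf : ∀ T, f.coeff T ∈ O)
    {c : Matrix (Fin n) (Fin n) ℚ → ℂ} (hc : ∀ T, c T ∈ O)
    (hg : ∀ T, g.coeff T = f.coeff T + P * c T) {ν j : ℕ}
    (hS : (⟨_, fiberCoeff_family_mem (X := X) hf hN hβ ModularGroup.S ν j⟩ : O) ∉
      IsLocalRing.maximalIdeal O) :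
    ∃ x : O, (ℓ : ℂ) ^ (-k) - (ℓ : ℂ) ^ (-k') = P * x := by
  have hM : 0 < 2 * N ^ 2 := by positivity
  have hP' : (P : ℂ) ≠ 0 := fun h => hP (Subtype.ext h)
  have hfS := hasSum_familyPoint (X := X) f hXs hN hβ
  have hgS := hasSum_familyPoint (X := X) g hXs hN hβ
  have hcS : ∀ (γ : SL(2, ℤ)) (τ z : ℍ),
      HasSum (fun T : SiegelLattice n 1 => familyCoeff o X N β c γ T *
        Periodic.qParam (2 * N ^ 2 : ℕ) τ ^ torsionExp o N (fun i => -(γ 0 0) * β i) T *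
        Periodic.qParam (1 : ℕ) z ^ sideTrace o (T : Matrix (Fin n) (Fin n) ℚ))
      ((P : ℂ)⁻¹ * (g.toFun (familyPoint o X N β γ τ z) - f.toFun (familyPoint o X N β γ τ z))) := by
    intro γ τ z
    refine (((hgS γ τ z).sub (hfS γ τ z)).mul_left (P : ℂ)⁻¹).congr_fun fun T => ?_
    simp only [familyCoeff, hg]
    field_simp
    ring
  refine level_congruence h6 hM hℓ hℓM hℓO hP
    (F := fun γ => partialSeries (finite_family_fiber hN hβ γ) (familyCoeff o X N β f.coeff γ)
      (2 * N ^ 2) ν)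
    (G := fun γ => partialSeries (finite_family_fiber hN hβ γ) (familyCoeff o X N β g.coeff γ)
      (2 * N ^ 2) ν)
    (K := fun γ => partialSeries (finite_family_fiber hN hβ γ) (familyCoeff o X N β c γ)
      (2 * N ^ 2) ν)
    (φ := fun γ => PowerSeries.mk fun j => ⟨_, fiberCoeff_family_mem (X := X) hf hN hβ γ ν j⟩)
    (κ := fun γ => PowerSeries.mk fun j => ⟨_, fiberCoeff_family_mem (X := X) hc hN hβ γ ν j⟩)
    ?_ ?_ ?_ ?_ ?_ ?_ ?_ ?_
  · exact fun γ δ τ => partialSeries_eq_of_forall (hfS γ) (hfS (γ * δ))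
      (toFun_familyPoint_smul f hXs hX hβ γ δ τ) ν
  · exact fun γ δ τ => partialSeries_eq_of_forall (hgS γ) (hgS (γ * δ))
      (toFun_familyPoint_smul g hXs hX hβ γ δ τ) ν
  · refine fun γ γ' h => funext fun τ => ?_
    rw [partialSeries_eq_of_forall (hfin' := finite_family_fiber hN hβ γ') (c := 1) (hfS γ) (hfS γ')
      (fun z => by rw [one_mul, toFun_familyPoint_congr f hXs hX hN hβ h τ z]), one_mul]
  · refine fun γ γ' h => funext fun τ => ?_
    rw [partialSeries_eq_of_forall (hfin' := finite_family_fiber hN hβ γ') (c := 1) (hcS γ) (hcS γ')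
      (fun z => by rw [one_mul, toFun_familyPoint_congr f hXs hX hN hβ h τ z,
        toFun_familyPoint_congr g hXs hX hN hβ h τ z]), one_mul]
  · intro γ τ
    have h1 := hasQSeries_partialSeries (hfin := finite_family_fiber hN hβ γ) (hfS γ) ν τ
    have h2 := hasQSeries_partialSeries (hfin := finite_family_fiber hN hβ γ) (hcS γ) ν τ
    have h3 := hasQSeries_partialSeries (hfin := finite_family_fiber hN hβ γ) (hgS γ) ν τ
    refine h3.unique ((h1.add (h2.mul_left (P : ℂ))).congr_fun fun m => ?_)
    simp only [coeff_mk, fiberCoeff, familyCoeff, hg, add_mul, Finset.sum_add_distrib, mul_assoc,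
      ← Finset.mul_sum]
  · intro γ
    rw [HasQInt]
    convert hasQSeries_partialSeries (hfin := finite_family_fiber hN hβ γ) (hfS γ) ν using 1
    ext m
    simp
  · intro γ
    rw [HasQInt]
    convert hasQSeries_partialSeries (hfin := finite_family_fiber hN hβ γ) (hcS γ) ν using 1
    ext m
    simp
  · intro h
    have h1 := congr_arg (PowerSeries.coeff j) h
    rw [PowerSeries.coeff_map, PowerSeries.coeff_mk, map_zero, IsLocalRing.residue_eq_zero_iff] at h1
    exact hS h1

end TorsionFamily

section Separation

variable {n : ℕ}

theorem exists_nat_sum_pow_ne_zero {ι : Type*} (Φ : Finset ι) (D : ι → Matrix (Fin n) (Fin n) ℚ)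
    (hD : ∀ t ∈ Φ, D t ≠ 0) :
    ∃ B : ℕ, ∀ t ∈ Φ, ∑ i, ∑ j, D t i j * (B : ℚ) ^ (finProdFinEquiv (i, j) : ℕ) ≠ 0 := by
  let q : ι → Polynomial ℚ := fun t =>
    ∑ i, ∑ j, Polynomial.monomial (finProdFinEquiv (i, j) : ℕ) (D t i j)
  have hq : ∀ t ∈ Φ, q t ≠ 0 := fun t ht h0 => hD t ht (by
    ext a b
    have := congr_arg (fun r => Polynomial.coeff r (finProdFinEquiv (a, b) : ℕ)) h0
    simp only [q, Polynomial.finsetSum_coeff, Polynomial.coeff_monomial, Fin.val_inj,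
      EmbeddingLike.apply_eq_iff_eq, Prod.mk.injEq, Polynomial.coeff_zero] at this
    simpa [ite_and] using this)
  have hprod : (∏ t ∈ Φ, q t) ≠ 0 := Finset.prod_ne_zero_iff.2 hq
  obtain ⟨B, hB⟩ : ∃ B : ℕ, (∏ t ∈ Φ, q t).eval (B : ℚ) ≠ 0 := by
    by_contra! h
    exact hprod (Polynomial.eq_zero_of_infinite_isRoot _
      ((Set.infinite_range_of_injective (Nat.cast_injective (R := ℚ))).mono (by
        rintro _ ⟨B, rfl⟩
        exact h B)))
  rw [Polynomial.eval_prod] at hB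
  refine ⟨B, fun t ht => ?_⟩
  have := Finset.prod_ne_zero_iff.1 hB t ht
  simpa [q, Polynomial.eval_finsetSum] using this

theorem exists_separating (o : Fin n) (T₀ : SiegelLattice n 1) (Φ : Finset (SiegelLattice n 1))
    (hoo : ∀ T ∈ Φ, (T : Matrix (Fin n) (Fin n) ℚ) o o = (T₀ : Matrix (Fin n) (Fin n) ℚ) o o) :
    ∃ (Ξ : Matrix (Fin n) (Fin n) ℤ) (L : SiegelLattice n 1 → ℤ), Ξ.IsSymm ∧ Ξ o o = 0 ∧
      (∀ T : SiegelLattice n 1, ∑ i, ∑ j, (T : Matrix (Fin n) (Fin n) ℚ) i j * (Ξ i j : ℚ) = L T) ∧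
      ∀ T ∈ Φ, L T = L T₀ → T = T₀ := by
  classical
  obtain ⟨B, hB⟩ := exists_nat_sum_pow_ne_zero (Φ.filter (· ≠ T₀))
    (fun T => (T : Matrix (Fin n) (Fin n) ℚ) - (T₀ : Matrix (Fin n) (Fin n) ℚ)) (fun T hT h =>
      (Finset.mem_filter.1 hT).2 (Subtype.ext (sub_eq_zero.1 h)))
  let E : Fin n → Fin n → ℤ := fun i j => (B : ℤ) ^ (finProdFinEquiv (i, j) : ℕ)
  let Ξ : Matrix (Fin n) (Fin n) ℤ := Matrix.of fun i j => if i = o ∧ j = o then 0 else E i j + E j i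
  have hcoeffs : ∀ T : SiegelLattice n 1, ∃ a : ℤ,
      ∑ i, ∑ j, (T : Matrix (Fin n) (Fin n) ℚ) i j * (Ξ i j : ℚ) = a := fun T => by
    have h1 : ∑ i, ∑ j, (T : Matrix (Fin n) (Fin n) ℚ) i j * (Ξ i j : ℚ) =
        ∑ i, ∑ j, 2 * (T : Matrix (Fin n) (Fin n) ℚ) i j *
          (if i = o ∧ j = o then 0 else (E i j : ℚ)) := by
      have h2 : ∀ i j, (T : Matrix (Fin n) (Fin n) ℚ) i j * (Ξ i j : ℚ) =
          (T : Matrix (Fin n) (Fin n) ℚ) i j * (if i = o ∧ j = o then 0 else (E i j : ℚ)) +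
          (T : Matrix (Fin n) (Fin n) ℚ) j i * (if j = o ∧ i = o then 0 else (E j i : ℚ)) := by
        intro i j
        rw [T.2.1.apply i j]
        by_cases h : i = o ∧ j = o
        · simp [Ξ, h]
        · have h' : ¬ (j = o ∧ i = o) := fun h' => h h'.symm
          simp [Ξ, h, h', mul_add]
      simp only [h2, Finset.sum_add_distrib]
      rw [Finset.sum_comm (f := fun i j => (T : Matrix (Fin n) (Fin n) ℚ) j i * _)]
      simp only [← two_mul, Finset.mul_sum, mul_assoc]
    rw [h1]
    refine sum_int_of_forall _ fun i _ => sum_int_of_forall _ fun j _ => ?_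
    obtain ⟨t, ht⟩ := T.2.2.2.1 i j
    simp only [Nat.cast_one, mul_one] at ht
    exact ⟨t * (if i = o ∧ j = o then 0 else E i j), by rw [ht]; split_ifs <;> simp⟩
  choose L hL using hcoeffs
  refine ⟨Ξ, L, ?_, by simp [Ξ], hL, fun T hT h => ?_⟩
  · ext i j
    simp only [Ξ, Matrix.transpose_apply, Matrix.of_apply, and_comm, add_comm]
  · by_contra hne
    refine hB T (Finset.mem_filter.2 ⟨hT, hne⟩) ?_
    have h1 : ∑ i, ∑ j, ((T : Matrix (Fin n) (Fin n) ℚ) i j - (T₀ : Matrix (Fin n) (Fin n) ℚ) i j) *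
        (Ξ i j : ℚ) = 0 := by
      simp only [sub_mul, Finset.sum_sub_distrib]
      rw [hL, hL, h, sub_self]
    have h2 : ∀ i j,
        ((T : Matrix (Fin n) (Fin n) ℚ) i j - (T₀ : Matrix (Fin n) (Fin n) ℚ) i j) * (Ξ i j : ℚ) =
        ((T : Matrix (Fin n) (Fin n) ℚ) i j - (T₀ : Matrix (Fin n) (Fin n) ℚ) i j) * (E i j : ℚ) +
        ((T : Matrix (Fin n) (Fin n) ℚ) j i - (T₀ : Matrix (Fin n) (Fin n) ℚ) j i) * (E j i : ℚ) := by
      intro i j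
      by_cases h : i = o ∧ j = o
      · simp [Ξ, h, hoo T hT]
      · simp only [Ξ, Matrix.of_apply, if_neg h, T.2.1.apply i j, T₀.2.1.apply i j]
        push_cast
        ring
    simp only [h2, Finset.sum_add_distrib] at h1
    rw [Finset.sum_comm (f := fun i j => ((T : Matrix (Fin n) (Fin n) ℚ) j i - _) * _)] at h1
    simp only [E, Int.cast_pow, Int.cast_natCast] at h1
    simp only [Matrix.sub_apply]
    linarith

theorem sum_exp_eq_zero {N : ℕ} {d : ℤ} (hN : 0 < N) (hd : ¬ (N : ℤ) ∣ d) :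
    ∑ s ∈ Finset.range N, Complex.exp (2 * Real.pi * Complex.I * d / N) ^ s = 0 := by
  have hN' : (N : ℂ) ≠ 0 := by exact_mod_cast hN.ne'
  have h1 := exp_root_pow_eq_one hN d
  have h2 : Complex.exp (2 * Real.pi * Complex.I * d / N) ≠ 1 := by
    rw [Ne, Complex.exp_eq_one_iff]
    rintro ⟨m, hm⟩
    refine hd ⟨m, ?_⟩
    have h3 : (d : ℂ) = N * m := by
      have hpi : (2 * Real.pi * Complex.I : ℂ) ≠ 0 := Complex.two_pi_I_ne_zero
      field_simp at hm
      apply mul_left_cancel₀ hpi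
      linear_combination (2 * Real.pi * Complex.I) * hm
    exact_mod_cast h3
  have h3 := geom_sum_mul (Complex.exp (2 * Real.pi * Complex.I * d / N)) N
  rw [h1, sub_self] at h3
  exact (mul_eq_zero.1 h3).resolve_right (sub_ne_zero.2 h2)

end Separation

section Nonvanishing

variable {n : ℕ}

theorem torsionExp_eq_iff {o : Fin n} {N : ℕ} (hN : 0 < N) (T T₀ : SiegelLattice n 1) :
    torsionExp o N 0 T = torsionExp o N 0 T₀ ↔
      (T : Matrix (Fin n) (Fin n) ℚ) o o = (T₀ : Matrix (Fin n) (Fin n) ℚ) o o := by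
  have h1 : torsionVec o N 0 = Pi.single o 1 := by
    ext i
    simp [torsionVec, unitVec, Pi.single_apply]
  have h2 : ((2 * N ^ 2 : ℕ) : ℚ) ≠ 0 := by positivity
  rw [← Nat.cast_inj (R := ℚ), coe_torsionExp T.2 o hN, coe_torsionExp T₀.2 o hN, h1, quadVal_single,
    quadVal_single, mul_right_inj' h2]

theorem S_apply_zero_zero : ModularGroup.S 0 0 = 0 := by simp [ModularGroup.S]

theorem S_apply_zero_one : ModularGroup.S 0 1 = -1 := by simp [ModularGroup.S]

/-- The block of `s Ξ / N` away from the `o`-th coordinate. -/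
def blockShift (o : Fin n) (Ξ : Matrix (Fin n) (Fin n) ℤ) (N s : ℕ) : Matrix (Fin n) (Fin n) ℚ :=
  Matrix.of fun i j => if i = o ∨ j = o then 0 else s * Ξ i j / N

theorem blockShift_isSymm {o : Fin n} {Ξ : Matrix (Fin n) (Fin n) ℤ} (hΞ : Ξ.IsSymm) (N s : ℕ) :
    (blockShift o Ξ N s).IsSymm := by
  ext i j
  simp only [blockShift, Matrix.transpose_apply, Matrix.of_apply, or_comm, hΞ.apply i j]

theorem familyCoeff_S {o : Fin n} {Ξ : Matrix (Fin n) (Fin n) ℤ} {L : SiegelLattice n 1 → ℤ}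
    (hΞ : Ξ.IsSymm) (hoo : Ξ o o = 0)
    (hL : ∀ T : SiegelLattice n 1, ∑ i, ∑ j, (T : Matrix (Fin n) (Fin n) ℚ) i j * (Ξ i j : ℚ) = L T)
    (c : Matrix (Fin n) (Fin n) ℚ → ℂ) (N s : ℕ) (T : SiegelLattice n 1) :
    familyCoeff o (blockShift o Ξ N s) N (fun i => s * Ξ o i) c ModularGroup.S T =
      c T * Complex.exp (2 * Real.pi * Complex.I * L T / N) ^ s := by
  have h1 : ∀ i j, torsionShift o (blockShift o Ξ N s)
      (fun i => (-(ModularGroup.S 0 0) * (s * Ξ o i) : ℤ) / N)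
      (fun i => (-(ModularGroup.S 0 1) * (s * Ξ o i) : ℤ) / N) i j = Ξ i j * (s / N : ℚ) := by
    intro i j
    rw [S_apply_zero_zero, S_apply_zero_one]
    by_cases hi : i = o
    · by_cases hj : j = o
      · simp [torsionShift, blockShift, unitVec, hi, hj, hoo]
      · simp [torsionShift, blockShift, unitVec, hi, hj]
        ring
    · by_cases hj : j = o
      · simp [torsionShift, blockShift, unitVec, hi, hj, hΞ.apply i o]
        ring
      · simp [torsionShift, blockShift, unitVec, hi, hj]
        ring
  rw [familyCoeff, shiftChar, ← Complex.exp_nat_mul]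
  simp only [h1]
  simp only [← mul_assoc, ← Finset.sum_mul]
  rw [hL]
  congr 2
  push_cast
  ring

theorem fiberCoeff_family_S {o : Fin n} {Ξ : Matrix (Fin n) (Fin n) ℤ} {L : SiegelLattice n 1 → ℤ}
    (hΞ : Ξ.IsSymm) (hoo : Ξ o o = 0)
    (hL : ∀ T : SiegelLattice n 1, ∑ i, ∑ j, (T : Matrix (Fin n) (Fin n) ℚ) i j * (Ξ i j : ℚ) = L T)
    (c : Matrix (Fin n) (Fin n) ℚ → ℂ) {N : ℕ} (hN : 0 < N) (s : ℕ) (T₀ : SiegelLattice n 1)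
    (hβ : (fun i => (s : ℤ) * Ξ o i) o = 0) {Φ : Finset (SiegelLattice n 1)}
    (hΦ : ∀ T : SiegelLattice n 1, T ∈ Φ ↔ sideTrace o (T : Matrix (Fin n) (Fin n) ℚ) =
      sideTrace o (T₀ : Matrix (Fin n) (Fin n) ℚ) ∧
      (T : Matrix (Fin n) (Fin n) ℚ) o o = (T₀ : Matrix (Fin n) (Fin n) ℚ) o o) :
    fiberCoeff (finite_family_fiber (β := fun i => (s : ℤ) * Ξ o i) hN hβ ModularGroup.S)
      (familyCoeff o (blockShift o Ξ N s) N (fun i => s * Ξ o i) c ModularGroup.S)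
      (sideTrace o (T₀ : Matrix (Fin n) (Fin n) ℚ)) (torsionExp o N 0 T₀) =
      ∑ T ∈ Φ, c T * Complex.exp (2 * Real.pi * Complex.I * L T / N) ^ s := by
  have hα : (fun i => -(ModularGroup.S 0 0) * ((s : ℤ) * Ξ o i)) = 0 := by
    ext i
    rw [S_apply_zero_zero, neg_zero, zero_mul, Pi.zero_apply]
  rw [fiberCoeff]
  refine Finset.sum_congr ?_ fun T _ => familyCoeff_S hΞ hoo hL c N s T
  ext T
  rw [Set.Finite.mem_toFinset, hΦ, ← torsionExp_eq_iff hN T T₀, Set.mem_ofPred_eq, hα]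

theorem sum_exp_mul_sum_exp {ι : Type*} {N : ℕ} (hN : 0 < N) {Φ : Finset ι} {L : ι → ℤ} {t : ι}
    (ht : t ∈ Φ) (hΦ : ∀ T ∈ Φ, T ≠ t → ¬ (N : ℤ) ∣ L T - L t) (c : ι → ℂ) :
    ∑ s ∈ Finset.range N, Complex.exp (2 * Real.pi * Complex.I * (-L t : ℤ) / N) ^ s *
      ∑ T ∈ Φ, c T * Complex.exp (2 * Real.pi * Complex.I * L T / N) ^ s = N * c t := by
  classical
  simp only [Finset.mul_sum]
  rw [Finset.sum_comm]
  have h1 : ∀ (T : ι) (s : ℕ),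
      Complex.exp (2 * Real.pi * Complex.I * (-L t : ℤ) / N) ^ s *
      (c T * Complex.exp (2 * Real.pi * Complex.I * L T / N) ^ s) =
      c T * Complex.exp (2 * Real.pi * Complex.I * (L T - L t : ℤ) / N) ^ s := fun T s => by
    rw [mul_left_comm, ← mul_pow, ← Complex.exp_add]
    congr 3
    push_cast
    ring
  simp only [h1, ← Finset.mul_sum]
  rw [Finset.sum_eq_single t]
  · simp [mul_comm]
  · exact fun T hT hne => by rw [sum_exp_eq_zero hN (hΦ T hT hne), mul_zero]
  · exact fun h => (h ht).elim

theorem exists_modulus {ι : Type*} {p : ℕ} (hp : 2 ≤ p) {Φ : Finset ι} {L : ι → ℤ} {t : ι}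
    (hL : ∀ T ∈ Φ, L T = L t → T = t) :
    ∃ N : ℕ, 0 < N ∧ ¬ p ∣ N ∧ ∀ T ∈ Φ, T ≠ t → ¬ (N : ℤ) ∣ L T - L t := by
  refine ⟨p * (∑ T ∈ Φ, (L T - L t).natAbs) + 1, Nat.succ_pos _, fun h => ?_, fun T hT hne h => ?_⟩
  · have := Nat.le_of_dvd one_pos ((Nat.dvd_add_right (Dvd.intro _ rfl)).1 h)
    omega
  · have h1 : L T - L t ≠ 0 := fun h => hne (hL T hT (sub_eq_zero.1 h))
    have h2 : (L T - L t).natAbs ≤ ∑ T ∈ Φ, (L T - L t).natAbs :=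
      Finset.single_le_sum (f := fun T => (L T - L t).natAbs) (fun _ _ => Nat.zero_le _) hT
    have h3 := Nat.le_of_dvd (Int.natAbs_pos.2 h1) (Int.natCast_dvd.1 h)
    have h4 : ∑ T ∈ Φ, (L T - L t).natAbs ≤ p * ∑ T ∈ Φ, (L T - L t).natAbs :=
      Nat.le_mul_of_pos_left _ (by omega)
    omega

theorem exists_unit_fiberCoeff {O : ValuationSubring ℂ} {p : ℕ} (hp : 2 ≤ p)
    (hu : ∀ m : ℕ, ¬ p ∣ m → O.valuation (m : ℂ) = 1) (c : Matrix (Fin n) (Fin n) ℚ → ℂ)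
    (o : Fin n) (T₀ : SiegelLattice n 1) (h0 : ¬ O.valuation (c T₀) < 1) :
    ∃ (N : ℕ) (hN : 0 < N) (X : Matrix (Fin n) (Fin n) ℚ) (β : Fin n → ℤ) (hβ : β o = 0) (j : ℕ),
      ¬ p ∣ N ∧ X.IsSymm ∧ (∀ j, X o j = 0) ∧
      ¬ O.valuation (fiberCoeff (finite_family_fiber hN hβ ModularGroup.S)
        (familyCoeff o X N β c ModularGroup.S) (sideTrace o (T₀ : Matrix (Fin n) (Fin n) ℚ)) j) < 1 := by
  classical
  obtain ⟨Φ, hmem⟩ : ∃ Φ : Finset (SiegelLattice n 1), ∀ T : SiegelLattice n 1, T ∈ Φ ↔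
      sideTrace o (T : Matrix (Fin n) (Fin n) ℚ) =
      sideTrace o (T₀ : Matrix (Fin n) (Fin n) ℚ) ∧
      (T : Matrix (Fin n) (Fin n) ℚ) o o = (T₀ : Matrix (Fin n) (Fin n) ℚ) o o :=
    ⟨(finite_torsion_fiber o one_pos (α := 0) rfl (sideTrace o (T₀ : Matrix (Fin n) (Fin n) ℚ))
      (torsionExp o 1 0 T₀)).toFinset, fun T => by
        rw [Set.Finite.mem_toFinset, ← torsionExp_eq_iff one_pos, Set.mem_ofPred_eq]⟩
  obtain ⟨Ξ, L, hΞ, hoo, hL, hsep⟩ := exists_separating o T₀ Φ fun T hT => ((hmem T).1 hT).2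
  obtain ⟨N, hN, hpN, hdvd⟩ := exists_modulus hp hsep
  by_contra! hall
  have hβ : ∀ s : ℕ, (fun i => (s : ℤ) * Ξ o i) o = 0 := fun s => by simp [hoo]
  have hsmall : ∀ s : ℕ,
      O.valuation (∑ T ∈ Φ, c T * Complex.exp (2 * Real.pi * Complex.I * L T / N) ^ s) < 1 := by
    intro s
    rw [← fiberCoeff_family_S hΞ hoo hL c hN s T₀ (hβ s) hmem]
    exact hall N hN (blockShift o Ξ N s) _ (hβ s) (torsionExp o N 0 T₀) hpN
      (blockShift_isSymm hΞ N s) fun j => by simp [blockShift]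
  refine h0 ?_
  have h2 : O.valuation ((N : ℂ) * c T₀) < 1 := by
    rw [← sum_exp_mul_sum_exp hN ((hmem T₀).2 ⟨rfl, rfl⟩) hdvd fun T => c T]
    refine Valuation.map_sum_lt _ one_ne_zero fun s _ => ?_
    rw [map_mul]
    refine (mul_le_of_le_one_left' ?_).trans_lt (hsmall s)
    rw [ValuationSubring.valuation_le_one_iff]
    exact pow_mem (mem_of_pow_eq_one hN (exp_root_pow_eq_one hN _)) s
  rwa [map_mul, hu N hpN, one_mul] at h2

end Nonvanishing

section PadicWeight

theorem exists_valuationSubring_int {p : ℕ} (hp : p.Prime) :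
    ∃ O : ValuationSubring ℂ, ∀ m : ℤ, (O.valuation (m : ℂ) < 1 ↔ (p : ℤ) ∣ m) ∧ (m : ℂ) ∈ O := by
  set A : Subring ℂ := (Int.castRingHom ℂ).range with hA
  have hmemA : ∀ m : ℤ, (m : ℂ) ∈ A := fun m => ⟨m, rfl⟩
  have hI : Ideal.span {(p : A)} ≠ ⊤ := by
    rw [Ne, Ideal.span_singleton_eq_top, isUnit_iff_exists_inv]
    rintro ⟨⟨_, b, rfl⟩, hb⟩
    have h1 : ((p : ℤ) * b : ℂ) = 1 := congrArg Subtype.val hb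
    have h2 : (p : ℤ) * b = 1 := by exact_mod_cast h1
    exact (Nat.prime_iff_prime_int.1 hp).not_isUnit (IsUnit.of_mul_eq_one _ h2)
  obtain ⟨O, hO, hnon⟩ := Ideal.image_subset_nonunits_valuationSubring _ hI
  have hmem : ∀ m : ℤ, (m : ℂ) ∈ O := fun m => hO (hmemA m)
  have hp1 : O.valuation (p : ℂ) < 1 := by
    rw [← ValuationSubring.mem_nonunits_iff]
    exact hnon ⟨_, Ideal.subset_span rfl, by simp⟩
  refine ⟨O, fun m => ⟨⟨fun h => ?_, ?_⟩, hmem m⟩⟩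
  · by_contra hpm
    obtain ⟨a, b, hab⟩ := ((Nat.prime_iff_prime_int.1 hp).coprime_iff_not_dvd.2 hpm)
    have h1 : O.valuation ((a : ℂ) * (p : ℂ) + b * m) < 1 := by
      refine Valuation.map_add_lt _ ?_ ?_
      · rw [map_mul]
        exact (mul_le_of_le_one_left' ((O.valuation_le_one_iff _).2 (hmem a))).trans_lt hp1
      · rw [map_mul]
        exact (mul_le_of_le_one_left' ((O.valuation_le_one_iff _).2 (hmem b))).trans_lt h
    have h2 : (a : ℂ) * (p : ℂ) + b * m = 1 := by exact_mod_cast hab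
    rw [h2, map_one] at h1
    exact lt_irrefl _ h1
  · rintro ⟨t, rfl⟩
    push_cast
    rw [map_mul, mul_comm]
    exact (mul_le_of_le_one_left' ((O.valuation_le_one_iff _).2 (hmem t))).trans_lt hp1

variable {p : ℕ} {O : ValuationSubring ℂ}

theorem valuation_eq_one_of_not_dvd
    (hO : ∀ m : ℤ, (O.valuation (m : ℂ) < 1 ↔ (p : ℤ) ∣ m) ∧ (m : ℂ) ∈ O) {m : ℤ}
    (hm : ¬ (p : ℤ) ∣ m) : O.valuation (m : ℂ) = 1 :=
  le_antisymm ((O.valuation_le_one_iff _).2 (hO m).2) (not_lt.1 fun h => hm ((hO m).1.1 h))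

theorem inv_mem_of_not_dvd
    (hO : ∀ m : ℤ, (O.valuation (m : ℂ) < 1 ↔ (p : ℤ) ∣ m) ∧ (m : ℂ) ∈ O) {m : ℤ}
    (hm : ¬ (p : ℤ) ∣ m) : (m : ℂ)⁻¹ ∈ O := by
  rw [← O.valuation_le_one_iff, map_inv₀, valuation_eq_one_of_not_dvd hO hm, inv_one]

theorem IsPIntegral.mem_valuationSubring
    (hO : ∀ m : ℤ, (O.valuation (m : ℂ) < 1 ↔ (p : ℤ) ∣ m) ∧ (m : ℂ) ∈ O) {z : ℂ}
    (hz : IsPIntegral p z) : z ∈ O := by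
  obtain ⟨a, b, hb, h⟩ := hz
  have h1 := (hO a).2
  rwa [← O.valuation_le_one_iff, ← h, map_mul, valuation_eq_one_of_not_dvd hO hb, one_mul,
    O.valuation_le_one_iff] at h1

theorem IsPIntegral.modCongr_zero_of_valuation_lt (hp : p.Prime)
    (hO : ∀ m : ℤ, (O.valuation (m : ℂ) < 1 ↔ (p : ℤ) ∣ m) ∧ (m : ℂ) ∈ O) {z : ℂ}
    (hz : IsPIntegral p z) (hlt : O.valuation z < 1) : ModCongr p 1 z 0 := by
  obtain ⟨a, b, hb, h⟩ := hz
  have h1 : O.valuation (a : ℂ) < 1 := by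
    rwa [← h, map_mul, valuation_eq_one_of_not_dvd hO hb, one_mul]
  obtain ⟨t, rfl⟩ := (hO a).1.1 h1
  have hp0 : (p : ℂ) ≠ 0 := by exact_mod_cast hp.ne_zero
  refine ⟨t, b, hb, ?_⟩
  rw [sub_zero, pow_one, ← mul_div_assoc, h]
  push_cast
  field_simp

theorem pow_dvd_of_eq_mul (hp : p.Prime)
    (hO : ∀ m : ℤ, (O.valuation (m : ℂ) < 1 ↔ (p : ℤ) ∣ m) ∧ (m : ℂ) ∈ O) (l : ℕ) {D : ℤ} {x : ℂ}
    (hx : x ∈ O) (h : (D : ℂ) = p ^ l * x) : (p : ℤ) ^ l ∣ D := by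
  induction l generalizing D with
  | zero => simp
  | succ l ih =>
    have hp0 : (p : ℂ) ≠ 0 := by exact_mod_cast hp.ne_zero
    have h1 : O.valuation (D : ℂ) < 1 := by
      rw [h, pow_succ', mul_assoc, map_mul, mul_comm]
      have h2 : O.valuation ((p : ℤ) : ℂ) < 1 := (hO p).1.2 dvd_rfl
      refine (mul_le_of_le_one_left' ((O.valuation_le_one_iff _).2 ?_)).trans_lt
        (by exact_mod_cast h2)
      exact mul_mem (pow_mem (by exact_mod_cast (hO p).2) l) hx
    obtain ⟨t, rfl⟩ := (hO D).1.1 h1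
    rw [pow_succ']
    refine mul_dvd_mul_left _ (ih (mul_left_cancel₀ hp0 ?_))
    push_cast at h
    rw [h]
    ring

theorem exists_prime_generator {p : ℕ} (hp : p.Prime) (hp2 : p ≠ 2) {l M : ℕ} (hl : 1 ≤ l)
    (hM : 0 < M) (hpM : ¬ p ∣ M) :
    ∃ ℓ : ℕ, ℓ.Prime ∧ (ℓ : ZMod M) = 1 ∧ ∃ u : (ZMod (p ^ l))ˣ, (u : ZMod (p ^ l)) = ℓ ∧
      orderOf u = p ^ (l - 1) * (p - 1) := by
  have : NeZero (p ^ l) := ⟨pow_ne_zero _ hp.ne_zero⟩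
  have := ZMod.isCyclic_units_of_prime_pow p hp hp2 l
  obtain ⟨u, hu⟩ := IsCyclic.exists_generator (α := (ZMod (p ^ l))ˣ)
  have hcop : (p ^ l).Coprime M := Nat.Coprime.pow_left l ((Nat.Prime.coprime_iff_not_dvd hp).2 hpM)
  obtain ⟨a, ha1, ha2⟩ := Nat.chineseRemainder hcop (u : ZMod (p ^ l)).val 1
  have hau : ((a : ℕ) : ZMod (p ^ l)) = u := by
    rw [(ZMod.natCast_eq_natCast_iff _ _ _).2 ha1, ZMod.natCast_zmod_val]
  have hac : a.Coprime (p ^ l * M) := by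
    refine Nat.Coprime.mul_right ?_ ?_
    · rw [← ZMod.isUnit_iff_coprime, hau]
      exact u.isUnit
    · rw [Nat.Coprime, ha2.gcd_eq, Nat.gcd_one_left]
  obtain ⟨ℓ, -, hℓ, hmod⟩ := Nat.forall_exists_prime_gt_and_modEq 0
    (mul_ne_zero (pow_ne_zero l hp.ne_zero) hM.ne') hac
  refine ⟨ℓ, hℓ, ?_, u, ?_, ?_⟩
  · rw [← Nat.cast_one, ZMod.natCast_eq_natCast_iff]
    exact (hmod.of_mul_left _).trans ha2
  · rw [← hau, ZMod.natCast_eq_natCast_iff]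
    exact (hmod.of_mul_right _).symm
  · rw [orderOf_eq_card_of_forall_mem_zpowers hu, Nat.card_eq_fintype_card,
      ZMod.card_units_eq_totient, Nat.totient_prime_pow hp hl]

theorem zpow_sub_eq_one_of_padic (hp : p.Prime)
    (hO : ∀ m : ℤ, (O.valuation (m : ℂ) < 1 ↔ (p : ℤ) ∣ m) ∧ (m : ℂ) ∈ O) {l ℓ : ℕ} (hℓ : 0 < ℓ)
    {u : (ZMod (p ^ l))ˣ} (hu : (u : ZMod (p ^ l)) = ℓ) {k k' : ℤ} {x : ℂ} (hx : x ∈ O)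
    (h : (ℓ : ℂ) ^ (-k) - (ℓ : ℂ) ^ (-k') = p ^ l * x) : u ^ (k - k') = 1 := by
  have hℓ0 : (ℓ : ℂ) ≠ 0 := by exact_mod_cast hℓ.ne'
  set e : ℕ := k.natAbs + k'.natAbs with he
  obtain ⟨a, ha⟩ : ∃ a : ℕ, (a : ℤ) = e + -k := ⟨(e + -k).toNat, by omega⟩
  obtain ⟨b, hb⟩ : ∃ b : ℕ, (b : ℤ) = e + -k' := ⟨(e + -k').toNat, by omega⟩
  have h1 : (((ℓ : ℤ) ^ a - (ℓ : ℤ) ^ b : ℤ) : ℂ) = p ^ l * ((ℓ : ℂ) ^ e * x) := by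
    push_cast
    rw [← zpow_natCast (ℓ : ℂ) a, ← zpow_natCast (ℓ : ℂ) b, ha, hb, zpow_add₀ hℓ0, zpow_add₀ hℓ0,
      zpow_natCast, ← mul_sub, h]
    ring
  have h2 := pow_dvd_of_eq_mul hp hO l
    (mul_mem (pow_mem (by exact_mod_cast (hO ℓ).2) e) hx) h1
  have h3 : u ^ b = u ^ a := by
    ext
    have := (ZMod.intCast_eq_intCast_iff_dvd_sub ((ℓ : ℤ) ^ b) ((ℓ : ℤ) ^ a) (p ^ l)).2
      (by exact_mod_cast h2)
    push_cast at this
    push_cast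
    rw [hu, this]
  have h4 : k - k' = (b : ℤ) - a := by omega
  rw [h4, _root_.zpow_sub, zpow_natCast, zpow_natCast, h3, mul_inv_cancel]

end PadicWeight

end

/-- **Ichikawa's theorem: well-definedness of the p-adic weight for Siegel
modular forms** (Theorem 3.3). Let `p` be a prime with `p > n + 3` or
`p ≡ 1 (mod 4)`, and `f ∈ M_k(Γ_n)_{ℤ_(p)}`, `g ∈ M_{k'}(Γ_n)_{ℤ_(p)}`. If
`f ≡ g (mod p^l)` coefficientwise and `f ≢ 0 (mod p)`, then
`k ≡ k' (mod (p-1)p^(l-1))`. -/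
theorem ichikawa_padic_weight_siegel
    (n : ℕ) (hn : 1 ≤ n) (p : ℕ) (hp : Nat.Prime p)
    (hpn : n + 3 < p ∨ p % 4 = 1) (l : ℕ) (hl : 1 ≤ l) (k k' : ℤ)
    (f : SiegelModularForm n k (SiegelModularGroup n) 1)
    (g : SiegelModularForm n k' (SiegelModularGroup n) 1)
    (hfint : ∀ T, IsPIntegral p (f.coeff T)) (hgint : ∀ T, IsPIntegral p (g.coeff T))
    (hfg : ∀ T, ModCongr p l (f.coeff T) (g.coeff T))
    (hf0 : ¬ ∀ T, ModCongr p 1 (f.coeff T) 0) :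
    ((p : ℤ) - 1) * (p : ℤ) ^ (l - 1) ∣ k - k' := by
  have hp5 : 4 < p := by
    rcases hpn with h | h
    · omega
    · have := hp.two_le
      by_contra hle
      interval_cases p <;> omega
  have hp3 : ∀ m : ℕ, m = 2 ∨ m = 3 → ¬ p ∣ m := fun m hm h => by
    have := Nat.le_of_dvd (by omega) h
    omega
  obtain ⟨O, hO⟩ := exists_valuationSubring_int hp
  have h6 : (1728 : ℂ)⁻¹ ∈ O := by
    have h : ¬ (p : ℤ) ∣ 1728 := fun h => by
      have h1 : p ∣ 2 ^ 6 * 3 ^ 3 := by exact_mod_cast h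
      rcases hp.dvd_mul.1 h1 with h | h
      · exact hp3 2 (Or.inl rfl) (hp.dvd_of_dvd_pow h)
      · exact hp3 3 (Or.inr rfl) (hp.dvd_of_dvd_pow h)
    exact_mod_cast inv_mem_of_not_dvd hO h
  have hfO : ∀ T, f.coeff T ∈ O := fun T => (hfint T).mem_valuationSubring hO
  obtain ⟨T, hT⟩ := not_forall.1 hf0
  have hval : ¬ O.valuation (f.coeff T) < 1 := fun h =>
    hT ((hfint T).modCongr_zero_of_valuation_lt hp hO h)
  have hTmem : T ∈ SiegelLattice n 1 := f.coeff_supported T fun h => hval (by simp [h])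
  have hu : ∀ m : ℕ, ¬ p ∣ m → O.valuation (m : ℂ) = 1 := fun m hm => by
    have := valuation_eq_one_of_not_dvd hO (m := m) (by exact_mod_cast hm)
    exact_mod_cast this
  obtain ⟨N, hN, X, β, hβ, j, hpN, hXs, hX, hS⟩ :=
    exists_unit_fiberCoeff hp.two_le hu f.coeff ⟨0, hn⟩ ⟨T, hTmem⟩ hval
  have hpM : ¬ p ∣ 2 * N ^ 2 := fun h => by
    rcases hp.dvd_mul.1 h with h | h
    · exact hp3 2 (Or.inl rfl) h
    · exact hpN (hp.dvd_of_dvd_pow h)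
  obtain ⟨ℓ, hℓ, hℓM, u, hul, hord⟩ :=
    exists_prime_generator hp (by omega : p ≠ 2) hl (by positivity : 0 < 2 * N ^ 2) hpM
  have hpℓ : ¬ (p : ℤ) ∣ ℓ := fun h => by
    have h1 : p = ℓ := (Nat.prime_dvd_prime_iff_eq hp hℓ).1 (by exact_mod_cast h)
    have h2 : IsUnit ((ℓ : ℕ) : ZMod (p ^ l)) := hul ▸ u.isUnit
    rw [ZMod.isUnit_iff_coprime, ← h1, Nat.coprime_pow_right_iff hl, Nat.coprime_self] at h2
    omega
  have hp0 : (p : ℂ) ≠ 0 := by exact_mod_cast hp.ne_zero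
  have hpO : (p : ℂ) ^ l ∈ O := pow_mem (by exact_mod_cast (hO p).2) l
  have hc : ∀ T, -((f.coeff T - g.coeff T) / (p : ℂ) ^ l) ∈ O := fun T =>
    neg_mem (IsPIntegral.mem_valuationSubring hO (hfg T))
  obtain ⟨x, hx⟩ := siegel_level_congruence h6 f g hXs hX hN hβ hℓ hℓM
    (by exact_mod_cast inv_mem_of_not_dvd hO hpℓ) (P := ⟨_, hpO⟩)
    (fun h => pow_ne_zero l hp0 (congrArg Subtype.val h)) hfO hc
    (fun T => by field_simp; ring) (by rwa [ValuationSubring.valuation_lt_one_iff])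
  have h1 := orderOf_dvd_iff_zpow_eq_one.2 (zpow_sub_eq_one_of_padic hp hO hℓ.pos hul x.2 hx)
  rw [hord] at h1
  rw [mul_comm]
  have h2 : ((p ^ (l - 1) * (p - 1) : ℕ) : ℤ) = (p : ℤ) ^ (l - 1) * ((p : ℤ) - 1) := by
    push_cast [hp.one_le]
    rfl
  rwa [h2] at h1

end
end
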